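/- Races to infinity (first part): Let S ⊂ Λ* be finite and let U(z) := Σ_{p∈S} a_p·exp(i⟨p+K,z⟩) where each a_p ∈ π·ℚ(ω/√3) (π times the smallest subfield of ℂ containing ω/√3), and assume U(ωz) = ω·U(z). Consider the chiral model D(α) built from U. If the set of magic parameters is nonempty, then the set of non-simple magic parameters {α ∈ ℂ : α magic and dim_ℂ Ker(α,k) ≥ 2 for every k ∈ ℂ} is infinite. -/

import Mathlib

noncomputable section

open Complex MeasureTheory

namespace TBG

/-- `ω = exp(2πi/3)`. -/
def ω : ℂ := Complex.exp (2 * Real.pi * Complex.I / 3)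

/-- The moiré lattice `Λ = ℤω + ℤ ⊂ ℂ`. -/
def Λ : Set ℂ := {z : ℂ | ∃ m n : ℤ, z = m * ω + n}

/-- The dual lattice `Λ* = (4πi/√3)·Λ`. -/
def Λdual : Set ℂ := {p : ℂ | ∃ m n : ℤ, p = 4 * Real.pi * Complex.I / Real.sqrt 3 * (m * ω + n)}

/-- The high symmetry point `K = 4π/3`. -/
def K : ℂ := 4 * Real.pi / 3

/-- `⟨z,w⟩ = Re (z · conj w)`. -/
def pair (z w : ℂ) : ℝ := (z * (starRingEnd ℂ) w).re

/-- `2 D_z̄ f = (1/i)(∂_x f + i ∂_y f)`. -/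
def Dbar (f : ℂ → ℂ) (z : ℂ) : ℂ :=
  1 / Complex.I * (fderiv ℝ f z 1 + Complex.I * fderiv ℝ f z Complex.I)

/-- A tunnelling potential: smooth, with the translational and rotational symmetries. -/
def IsTunnelling (U : ℂ → ℂ) : Prop :=
  ContDiff ℝ (⊤ : ℕ∞) U ∧
    (∀ γ ∈ Λ, ∀ z : ℂ, U (z + γ) = Complex.exp (Complex.I * (pair γ K : ℂ)) * U z) ∧
    ∀ z : ℂ, U (ω * z) = ω * U z

/-- Membership in `ker_{L²₀}(D(α)+k)` for the chiral model with tunnelling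
potentials `U₊ = Up`, `U₋ = Um`: smooth solutions of `(D(α)+k)u = 0` with the
Floquet boundary conditions. -/
def InKer (Up Um : ℂ → ℂ) (α k : ℂ) (u : ℂ → ℂ × ℂ) : Prop :=
  ContDiff ℝ (⊤ : ℕ∞) u ∧
    (∀ z : ℂ, Dbar (fun w => (u w).1) z + k * (u z).1 + α * Up z * (u z).2 = 0) ∧
    (∀ z : ℂ, Dbar (fun w => (u w).2) z + k * (u z).2 + α * Um z * (u z).1 = 0) ∧
    (∀ γ ∈ Λ, ∀ z : ℂ, (u (z + γ)).1 = Complex.exp (-Complex.I * (pair γ K : ℂ)) * (u z).1) ∧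
    (∀ γ ∈ Λ, ∀ z : ℂ, (u (z + γ)).2 = Complex.exp (Complex.I * (pair γ K : ℂ)) * (u z).2)

/-- `Ker(α,k)` as a set of functions. -/
def kerSet (Up Um : ℂ → ℂ) (α k : ℂ) : Set (ℂ → ℂ × ℂ) := {u | InKer Up Um α k u}

/-- `dim_ℂ Ker(α,k)` (the set `Ker(α,k)` is a linear subspace, so the finrank of its span
is its dimension). -/
def kerDim (Up Um : ℂ → ℂ) (α k : ℂ) : ℕ :=
  Module.finrank ℂ ↥(Submodule.span ℂ (kerSet Up Um α k))

/-- `Ker_p(α) = {u ∈ Ker(α,0) : u(ωz) = ω^(−p)·u(z)}`. -/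
def kerPSet (Up Um : ℂ → ℂ) (α : ℂ) (p : ℕ) : Set (ℂ → ℂ × ℂ) :=
  {u | u ∈ kerSet Up Um α 0 ∧ ∀ z : ℂ, u (ω * z) = (ω ^ (-(p : ℤ))) • u z}

/-- `dim_ℂ Ker_p(α)`. -/
def kerPDim (Up Um : ℂ → ℂ) (α : ℂ) (p : ℕ) : ℕ :=
  Module.finrank ℂ ↥(Submodule.span ℂ (kerPSet Up Um α p))

/-- `α` is magic: the flat band condition `Ker(α,k) ≠ {0}` for every `k`. -/
def IsMagic (Up Um : ℂ → ℂ) (α : ℂ) : Prop :=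
  ∀ k : ℂ, ∃ u ∈ kerSet Up Um α k, u ≠ 0


/-- Membership in `π·ℚ(ω/√3)`: `π` times the smallest subfield of `ℂ` containing `ω/√3`. -/
def InPiQomega (c : ℂ) : Prop :=
  ∃ q ∈ Subfield.closure {ω / (Real.sqrt 3 : ℂ)}, c = (Real.pi : ℂ) * q

open Polynomial in
/-- An integer polynomial with nonzero constant term killing a finite family of nonzero
algebraic numbers. -/
lemma exists_common_intPoly {L κ : Type*} [Field L] [CharZero L] [Algebra ℚ L] (P : Finset κ)
    (β : κ → L) (hβ : ∀ s ∈ P, β s ≠ 0) (halg : ∀ s ∈ P, IsAlgebraic ℤ (β s)) :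
    ∃ F : ℤ[X], F.eval 0 ≠ 0 ∧ ∀ s ∈ P, aeval (β s) F = 0 := by
  classical
  induction P using Finset.induction_on with
  | empty => exact ⟨1, by simp, by simp⟩
  | insert a P ha ih =>
    obtain ⟨F, hF0, hF⟩ := ih (fun s hs => hβ s (Finset.mem_insert_of_mem hs))
      (fun s hs => halg s (Finset.mem_insert_of_mem hs))
    obtain ⟨q, hq0, hq⟩ := (halg a (Finset.mem_insert_self _ _)).exists_nonzero_coeff_and_aeval_eq_zero
      (mem_nonZeroDivisors_of_ne_zero (hβ a (Finset.mem_insert_self _ _)))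
    refine ⟨q * F, ?_, ?_⟩
    · rw [eval_mul]
      exact mul_ne_zero (by rwa [← coeff_zero_eq_eval_zero]) hF0
    · intro s hs
      rcases Finset.mem_insert.1 hs with rfl | hs
      · simp [hq]
      · simp [hF s hs]

open Polynomial in
lemma isIntegral_leadingCoeff_pow_mul_aeval {L : Type*} [Field L] (F g : ℤ[X]) (x : L)
    (hx : aeval x F = 0) (M : ℕ) (hg : g.natDegree ≤ M) :
    IsIntegral ℤ ((F.leadingCoeff : L) ^ M * aeval x g) := by
  have h1 : IsIntegral ℤ ((F.leadingCoeff : L) * x) := by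
    simpa using isIntegral_leadingCoeff_smul F x hx
  rw [aeval_eq_sum_range' (Nat.lt_succ_of_le hg), Finset.mul_sum]
  refine IsIntegral.sum _ fun i hi => ?_
  have hi' : i ≤ M := Nat.lt_succ_iff.1 (Finset.mem_range.1 hi)
  have : (F.leadingCoeff : L) ^ M * (g.coeff i • x ^ i)
      = (((F.leadingCoeff ^ (M - i) * g.coeff i : ℤ)) : L) * ((F.leadingCoeff : L) * x) ^ i := by
    rw [zsmul_eq_mul, mul_pow]
    nth_rewrite 1 [← Nat.sub_add_cancel hi']
    push_cast
    ring
  rw [this]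
  exact IsIntegral.mul (isIntegral_algebraMap (R := ℤ) (A := L)
    (x := F.leadingCoeff ^ (M - i) * g.coeff i)) (h1.pow i)

open Polynomial in
/-- A Galois-stable sum of exponentials of nonzero algebraic numbers is not a negative integer. -/
lemma natCast_add_sum_exp_ne_zero {L κ : Type*} [Field L] [CharZero L] [Algebra ℚ L]
    [FiniteDimensional ℚ L] [IsGalois ℚ L] (ι : L →+* ℂ) (P : Finset κ) (β : κ → L)
    (hβ : ∀ s ∈ P, β s ≠ 0)
    (hσ : ∀ (σ : L ≃ₐ[ℚ] L) (g : ℤ[X]), σ (∑ s ∈ P, aeval (β s) g) = ∑ s ∈ P, aeval (β s) g)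
    (k : ℕ) (hk : 1 ≤ k) : (k : ℂ) + ∑ s ∈ P, Complex.exp (ι (β s)) ≠ 0 := by
  intro h0
  obtain ⟨F, hF0, hF⟩ := exists_common_intPoly P β hβ (fun s _ =>
    (IsFractionRing.isAlgebraic_iff ℤ ℚ L).2 (Algebra.IsAlgebraic.isAlgebraic (R := ℚ) (β s)))
  obtain ⟨c, hc⟩ := LindemannWeierstrass.exp_polynomial_approx F hF0
  have hFne : F ≠ 0 := by rintro rfl; simp at hF0
  set a : ℤ := F.leadingCoeff with ha
  have ha0 : a ≠ 0 := by simpa [ha] using hFne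
  set D := F.natDegree
  -- smallness
  have hlim : Filter.Tendsto (fun n : ℕ => (P.card : ℝ) * (((|a| : ℤ) : ℝ) ^ D * |c|) *
      ((((|a| : ℤ) : ℝ) ^ D * |c|) ^ n / (n.factorial : ℝ))) Filter.atTop (nhds 0) := by
    simpa using (FloorSemiring.tendsto_pow_div_factorial_atTop
      (((|a| : ℤ) : ℝ) ^ D * |c|)).const_mul ((P.card : ℝ) * (((|a| : ℤ) : ℝ) ^ D * |c|))
  obtain ⟨N, hN⟩ := Filter.eventually_atTop.1 (hlim.eventually_lt_const zero_lt_one)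
  obtain ⟨p, hpge, hp⟩ := Nat.exists_infinite_primes
    (N + (Polynomial.eval 0 F).natAbs + a.natAbs + k + 2)
  have hp1 : 1 ≤ p := hp.one_le
  obtain ⟨n, hpn, gp, hgp, hr⟩ := hc p (by omega) hp
  -- integrality of the sum
  have hfix : (∑ s ∈ P, aeval (β s) gp) ∈ (⊥ : IntermediateField ℚ L) :=
    (IsGalois.mem_bot_iff_fixed _).2 fun σ => hσ σ gp
  obtain ⟨G, hG⟩ := IntermediateField.mem_bot.1 hfix
  have hcoef : IsIntegral ℤ ((a : L) ^ (p * D) * ∑ s ∈ P, aeval (β s) gp) := by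
    rw [Finset.mul_sum]
    exact IsIntegral.sum _ fun s hs => isIntegral_leadingCoeff_pow_mul_aeval F gp _ (hF s hs) _
      (by omega)
  have hsum' : IsIntegral ℤ ((a : ℚ) ^ (p * D) * G) := by
    refine (isIntegral_algebraMap_iff (algebraMap ℚ L).injective).1 ?_
    rw [map_mul, hG]
    simpa using hcoef
  obtain ⟨z, hz⟩ := IsIntegrallyClosed.isIntegral_iff.1 hsum'
  have hzL : (z : L) = (a : L) ^ (p * D) * ∑ s ∈ P, aeval (β s) gp := by
    have := congrArg (algebraMap ℚ L) hz
    rw [map_mul, hG] at this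
    simpa using this
  have hzC : (z : ℂ) = (a : ℂ) ^ (p * D) * ∑ s ∈ P, aeval (ι (β s)) gp := by
    have := congrArg ι hzL
    simpa [map_sum, Polynomial.aeval_def, Polynomial.hom_eval₂, RingHom.ext_int
      ((ι.comp (Int.castRingHom L))) (Int.castRingHom ℂ)] using this
  have hroot : ∀ s ∈ P, ι (β s) ∈ F.aroots ℂ := by
    intro s hs
    rw [mem_aroots]
    refine ⟨hFne, ?_⟩
    have := congrArg ι (hF s hs)
    simpa [Polynomial.aeval_def, Polynomial.hom_eval₂, RingHom.ext_int
      ((ι.comp (Int.castRingHom L))) (Int.castRingHom ℂ)] using this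
  have hkey : ((a ^ (p * D) * n * k + p * z : ℤ) : ℂ) = -(a : ℂ) ^ (p * D) *
      ∑ s ∈ P, (n • Complex.exp (ι (β s)) - p • aeval (ι (β s)) gp) := by
    have hk' : (k : ℂ) = -∑ s ∈ P, Complex.exp (ι (β s)) := by linear_combination h0
    push_cast
    rw [hzC, hk', Finset.sum_sub_distrib, ← Finset.smul_sum, ← Finset.smul_sum]
    simp only [zsmul_eq_mul, nsmul_eq_mul]
    ring
  have hne : a ^ (p * D) * n * k + p * z ≠ 0 := by
    intro h
    have hd : (p : ℤ) ∣ a ^ (p * D) * n * k := ⟨-z, by linear_combination h⟩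
    have hpp : Prime (p : ℤ) := Nat.prime_iff_prime_int.1 hp
    rcases hpp.dvd_or_dvd hd with h1 | h1
    · rcases hpp.dvd_or_dvd h1 with h2 | h2
      · have h3 := hpp.dvd_of_dvd_pow h2
        have := Int.natAbs_le_of_dvd_ne_zero h3 ha0
        simp at this
        omega
      · exact hpn h2
    · have := Nat.le_of_dvd (by omega) (Int.natCast_dvd_natCast.1 h1)
      omega
  have hge : (1 : ℝ) ≤ ‖((a ^ (p * D) * n * k + p * z : ℤ) : ℂ)‖ := by
    rw [Complex.norm_intCast]
    exact_mod_cast Int.one_le_abs hne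
  have hle : ‖((a ^ (p * D) * n * k + p * z : ℤ) : ℂ)‖ ≤
      ((|a| : ℤ) : ℝ) ^ (p * D) * (P.card * (|c| ^ p / ((p - 1).factorial : ℝ))) := by
    rw [hkey, norm_mul, norm_neg, norm_pow, Complex.norm_intCast]
    push_cast
    gcongr
    refine (norm_sum_le _ _).trans ?_
    rw [← nsmul_eq_mul]
    refine Finset.sum_le_card_nsmul _ _ _ fun s hs => (hr (hroot s hs)).trans ?_
    refine div_le_div_of_nonneg_right ?_ (by positivity)
    exact (le_abs_self _).trans (abs_pow c p).le
  have hlt := hN (p - 1) (by omega)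
  have : ((|a| : ℤ) : ℝ) ^ (p * D) * (P.card * (|c| ^ p / ((p - 1).factorial : ℝ))) =
      (P.card : ℝ) * (((|a| : ℤ) : ℝ) ^ D * |c|) *
      ((((|a| : ℤ) : ℝ) ^ D * |c|) ^ (p - 1) / ((p - 1).factorial : ℝ)) := by
    obtain ⟨m, rfl⟩ : ∃ m, p = m + 1 := ⟨p - 1, by omega⟩
    simp only [Nat.add_sub_cancel]
    rw [mul_comm (m + 1) D, pow_mul]
    ring
  linarith

open Polynomial in
lemma false_of_pi_mul_I_root (p : ℚ[X]) (hp0 : p ≠ 0) (hp : aeval (Real.pi * Complex.I : ℂ) p = 0)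
    (L : Type) [Field L] [Algebra ℚ L] [IsSplittingField ℚ L p] : False := by
  classical
  have : CharZero L := charZero_of_injective_algebraMap (algebraMap ℚ L).injective
  have : FiniteDimensional ℚ L := IsSplittingField.finiteDimensional L p
  have : Normal ℚ L := Normal.of_isSplittingField p
  have : IsGalois ℚ L := ⟨⟩
  let ι : L →ₐ[ℚ] ℂ := IsAlgClosed.lift
  let R : Finset L := (p.rootSet L).toFinset
  have hRmem : ∀ x : L, x ∈ R ↔ aeval x p = 0 := by
    intro x; simp [R, mem_rootSet, hp0]
  obtain ⟨θ, hθR, hθ⟩ : ∃ θ ∈ R, ι θ = Real.pi * Complex.I := by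
    have h1 : (Real.pi * Complex.I : ℂ) ∈ p.rootSet ℂ := by
      rw [mem_rootSet]; exact ⟨hp0, hp⟩
    have h2 := (IsSplittingField.splits L p).image_rootSet ι
    rw [← h2] at h1
    obtain ⟨θ, h3, h4⟩ := h1
    exact ⟨θ, by simpa [R] using h3, h4⟩
  have hprod : ∏ x ∈ R, (1 + Complex.exp (ι x)) = 0 :=
    Finset.prod_eq_zero hθR (by rw [hθ, Complex.exp_pi_mul_I]; ring)
  rw [Finset.prod_one_add] at hprod
  set β : Finset L → L := fun s => ∑ x ∈ s, x with hβdef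
  have hexp : ∀ s : Finset L, ∏ x ∈ s, Complex.exp (ι x) = Complex.exp (ι (β s)) := by
    intro s; rw [hβdef, map_sum, Complex.exp_sum]
  simp_rw [hexp] at hprod
  rw [← Finset.sum_filter_add_sum_filter_not _ (fun s => β s = 0)] at hprod
  have h1 : ∑ s ∈ R.powerset with β s = 0, Complex.exp (ι (β s)) =
      ((R.powerset.filter (fun s => β s = 0)).card : ℂ) := by
    rw [Finset.card_eq_sum_ones, Nat.cast_sum]
    refine Finset.sum_congr rfl fun s hs => ?_
    rw [(Finset.mem_filter.1 hs).2]; simp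
  rw [h1] at hprod
  refine natCast_add_sum_exp_ne_zero ι.toRingHom (R.powerset.filter (fun s => ¬ β s = 0)) β
    (fun s hs => (Finset.mem_filter.1 hs).2) ?_ _ ?_ hprod
  · intro σ g
    have hσR : ∀ x, x ∈ R ↔ σ x ∈ R := by
      intro x
      rw [hRmem, hRmem, show σ x = σ.toAlgHom x from rfl, aeval_algHom_apply]
      simp
    have hσβ : ∀ s : Finset L, β (s.map σ.toEquiv.toEmbedding) = σ (β s) := by
      intro s; simp [hβdef, map_sum]
    rw [map_sum]
    refine Finset.sum_bij (fun s _ => s.map σ.toEquiv.toEmbedding) ?_ ?_ ?_ ?_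
    · intro s hs
      simp only [Finset.mem_filter, Finset.mem_powerset] at hs ⊢
      refine ⟨?_, ?_⟩
      · intro y hy
        obtain ⟨x, hx, rfl⟩ := Finset.mem_map.1 hy
        exact (hσR x).1 (hs.1 hx)
      · rw [hσβ]; simpa using hs.2
    · intro s _ t _ h
      exact Finset.map_injective _ h
    · intro t ht
      simp only [Finset.mem_filter, Finset.mem_powerset] at ht
      have hts : (t.map σ.symm.toEquiv.toEmbedding).map σ.toEquiv.toEmbedding = t := by
        ext y; simp
      refine ⟨t.map σ.symm.toEquiv.toEmbedding, ?_, hts⟩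
      simp only [Finset.mem_filter, Finset.mem_powerset]
      refine ⟨?_, ?_⟩
      · intro y hy
        obtain ⟨x, hx, rfl⟩ := Finset.mem_map.1 hy
        rw [hσR]
        simpa using ht.1 hx
      · intro h
        apply ht.2
        rw [← hts, hσβ, h, map_zero]
    · intro s hs
      rw [hσβ]
      rw [show σ (β s) = (σ.toAlgHom.restrictScalars ℤ) (β s) from rfl, aeval_algHom_apply]
      rfl
  · rw [Nat.succ_le_iff, Finset.card_pos]
    exact ⟨∅, by simp [hβdef]⟩

open Polynomial in
theorem transcendental_pi : Transcendental ℚ (Real.pi : ℂ) := by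
  intro hpi
  have hI : IsAlgebraic ℚ Complex.I := by
    refine ⟨X ^ 2 + 1, ?_, by simp⟩
    exact (monic_X_pow_add_C (1 : ℚ) two_ne_zero).ne_zero
  obtain ⟨p, hp0, hp⟩ := hpi.mul hI
  exact @false_of_pi_mul_I_root p hp0 hp p.SplittingField _ _
    (IsSplittingField.splittingField p)

/-- The coefficients of the power series `S` with `S(0) = 1` and `S' = -(∑ g (n+1) Xⁿ) S`. -/
def expRec {R : Type*} [CommRing R] [Algebra ℚ R] (g : ℕ → R) : ℕ → R
  | 0 => 1
  | n + 1 => algebraMap ℚ R (1 / ((n : ℚ) + 1)) *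
      (-∑ j : Fin (n + 1), g (n + 1 - j) * expRec g j)

lemma map_expRec {R R' : Type*} [CommRing R] [Algebra ℚ R] [CommRing R'] [Algebra ℚ R']
    (φ : R →+* R') (g : ℕ → R) (n : ℕ) : φ (expRec g n) = expRec (fun i => φ (g i)) n := by
  induction n using Nat.strong_induction_on with
  | _ n ih =>
    cases n with
    | zero => simp [expRec]
    | succ n =>
      rw [expRec, expRec, map_mul, map_neg, map_sum, RingHom.map_rat_algebraMap]
      congr 2
      refine Finset.sum_congr rfl fun j _ => ?_
      rw [map_mul, ih j j.2]

lemma sum_fin_eq_antidiagonal {R : Type*} [CommRing R] (g E : ℕ → R) (n : ℕ) :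
    ∑ j : Fin (n + 1), g (n + 1 - j) * E j =
      ∑ p ∈ Finset.HasAntidiagonal.antidiagonal n, g (p.1 + 1) * E p.2 := by
  rw [Finset.Nat.sum_antidiagonal_eq_sum_range_succ_mk, ← Fin.sum_univ_eq_sum_range
    (fun k => g (k + 1) * E (n - k)) (n + 1), ← Equiv.sum_comp Fin.revPerm]
  refine Finset.sum_congr rfl fun j _ => ?_
  have : (Fin.revPerm j : Fin (n + 1)).val = n - j := by simp [Fin.revPerm, Fin.val_rev]
  rw [this]
  have hj : (j : ℕ) ≤ n := Nat.lt_succ_iff.1 j.2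
  rw [show n + 1 - (n - (j : ℕ)) = j + 1 by omega]

lemma eq_expRec {R : Type*} [Field R] [Algebra ℚ R] (g E : ℕ → R) (h0 : E 0 = 1)
    (h : ∀ n : ℕ, ((n : R) + 1) * E (n + 1) =
      -∑ p ∈ Finset.HasAntidiagonal.antidiagonal n, g (p.1 + 1) * E p.2) (n : ℕ) : E n = expRec g n := by
  have : CharZero R := charZero_of_injective_algebraMap (algebraMap ℚ R).injective
  induction n using Nat.strong_induction_on with
  | _ n ih =>
    cases n with
    | zero => simp [expRec, h0]
    | succ n =>
      rw [expRec]
      have h1 : ∑ j : Fin (n + 1), g (n + 1 - j) * expRec g j =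
          ∑ j : Fin (n + 1), g (n + 1 - j) * E j :=
        Finset.sum_congr rfl fun j _ => by rw [ih j j.2]
      rw [h1, sum_fin_eq_antidiagonal, ← h n]
      have : (n : R) + 1 ≠ 0 := by exact_mod_cast Nat.succ_ne_zero n
      simp only [map_div₀, map_one, map_add, map_natCast]
      field_simp

lemma expRec_succ {R : Type*} [Field R] [Algebra ℚ R] (g : ℕ → R) (n : ℕ) :
    ((n : R) + 1) * expRec g (n + 1) =
      -∑ p ∈ Finset.HasAntidiagonal.antidiagonal n, g (p.1 + 1) * expRec g p.2 := by
  have : CharZero R := charZero_of_injective_algebraMap (algebraMap ℚ R).injective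
  rw [expRec, sum_fin_eq_antidiagonal]
  have : (n : R) + 1 ≠ 0 := by exact_mod_cast Nat.succ_ne_zero n
  simp only [map_div₀, map_one, map_add, map_natCast]
  field_simp

open PowerSeries in
lemma derivative_mk_expRec {R : Type*} [Field R] [Algebra ℚ R] (g : ℕ → R) :
    d⁄dX R (mk (expRec g)) = -(mk fun n => g (n + 1)) * mk (expRec g) := by
  ext n
  rw [coeff_derivative, coeff_mk, mul_comm, expRec_succ, neg_mul, map_neg, coeff_mul]
  simp

open PowerSeries in
lemma eq_mk_expRec {R : Type*} [Field R] [Algebra ℚ R] (g : ℕ → R) (S : R⟦X⟧)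
    (h0 : constantCoeff S = 1) (h : d⁄dX R S = -(mk fun n => g (n + 1)) * S) :
    S = mk (expRec g) := by
  ext n
  rw [coeff_mk]
  refine eq_expRec g (fun n => coeff n S) (by simpa using h0) (fun n => ?_) n
  have := congrArg (coeff n) h
  rw [coeff_derivative, neg_mul, map_neg, coeff_mul] at this
  rw [mul_comm, this]
  simp

open PowerSeries in
lemma mk_expRec_mul {R : Type*} [Field R] [Algebra ℚ R] (g h : ℕ → R) :
    mk (expRec g) * mk (expRec h) = mk (expRec (fun i => g i + h i)) := by
  refine eq_mk_expRec _ _ ?_ ?_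
  · simp [expRec]
  · rw [Derivation.leibniz, derivative_mk_expRec, derivative_mk_expRec]
    have : (mk fun n => g (n + 1) + h (n + 1)) = (mk fun n => g (n + 1)) + mk fun n => h (n + 1) := by
      ext; simp
    rw [this]
    simp only [smul_eq_mul]
    ring

open Polynomial in
/-- If the exponential-type series attached to `t • q + c` terminates uniformly in `t`,
then `q` vanishes. -/
lemma eq_zero_of_expRec_vanish {A : Type*} [Field A] [Algebra ℚ A] (q c : ℕ → A) (N : ℕ)
    (h : ∀ n > N, expRec (R := A[X]) (fun i => X * C (q i) + C (c i)) n = 0) (n : ℕ) :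
    q (n + 1) = 0 := by
  have : CharZero A := charZero_of_injective_algebraMap (algebraMap ℚ A).injective
  set e : A → ℕ → A := fun t => expRec (fun i => t * q i + c i) with he
  set Ep : ℕ → A[X] := expRec (R := A[X]) (fun i => X * C (q i) + C (c i)) with hEp
  have heval : ∀ t n, (Ep n).eval t = e t n := by
    intro t n
    have := map_expRec (evalRingHom t) (fun i => X * C (q i) + C (c i)) n
    rw [hEp, he]
    simpa only [coe_evalRingHom, eval_add, eval_mul, eval_X, eval_C] using this
  have he0 : ∀ t, ∀ n > N, e t n = 0 := fun t n hn => by rw [← heval, h n hn, eval_zero]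
  set F : A[X][X] := ∑ n ∈ Finset.range (N + 1), (Ep n).map C * C (X ^ n) with hF
  have hFeval : ∀ t, F.eval (C t) = ∑ n ∈ Finset.range (N + 1), C (e t n) * X ^ n := by
    intro t
    rw [hF, eval_finsetSum]
    refine Finset.sum_congr rfl fun n _ => ?_
    rw [eval_mul, eval_C, eval_map, ← heval, eval₂_at_apply]
  have hFcoe : ∀ t, ((F.eval (C t) : A[X]) : PowerSeries A) = PowerSeries.mk (e t) := by
    intro t
    ext n
    rw [Polynomial.coeff_coe, PowerSeries.coeff_mk, hFeval, finsetSum_coeff]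
    simp only [coeff_C_mul_X_pow]
    rw [Finset.sum_ite_eq]
    split_ifs with hn
    · rfl
    · rw [he0 t n (by simpa using hn)]
  have hprod : F * F.comp (-X) = C (F.eval 0 ^ 2) := by
    refine eq_of_infinite_eval_eq _ _ ((Set.infinite_range_of_injective (C_injective (R := A))).mono ?_)
    rintro _ ⟨t, rfl⟩
    simp only [Set.mem_ofPred_eq, eval_mul, eval_comp, eval_neg, eval_X, eval_C]
    apply Polynomial.coe_injective A
    rw [← C_neg, ← C_0, Polynomial.coe_mul, Polynomial.coe_pow, hFcoe, hFcoe, hFcoe, sq]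
    simp only [he]
    rw [mk_expRec_mul, mk_expRec_mul]
    congr 2
    ext i
    ring
  have hF00 : F.eval 0 ≠ 0 := by
    intro h0
    have := hFcoe 0
    rw [C_0, h0] at this
    have := congrArg (PowerSeries.coeff 0) this
    simp [he, expRec] at this
  have hne : F * F.comp (-X) ≠ 0 := by
    rw [hprod]; exact C_ne_zero.2 (pow_ne_zero _ hF00)
  have hdeg : F.natDegree = 0 := by
    have h1 := natDegree_mul (left_ne_zero_of_mul hne) (right_ne_zero_of_mul hne)
    rw [hprod, natDegree_C] at h1
    omega
  have hconst : e 1 = e 0 := by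
    have h1 : PowerSeries.mk (e 1) = PowerSeries.mk (e 0) := by
      rw [← hFcoe, ← hFcoe, eq_C_of_natDegree_eq_zero hdeg, eval_C, eval_C]
    ext n
    simpa using congrArg (PowerSeries.coeff n) h1
  have h1 := derivative_mk_expRec (fun i => 1 * q i + c i)
  have h0 := derivative_mk_expRec (fun i => 0 * q i + c i)
  simp only [he] at hconst
  rw [hconst, h0] at h1
  have hne : PowerSeries.mk (expRec fun i => 0 * q i + c i) ≠ 0 := by
    intro h
    have := congrArg (PowerSeries.coeff 0) h
    simp [expRec] at this
  have h2 := mul_right_cancel₀ hne h1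
  have := congrArg (PowerSeries.coeff n) h2
  simp at this
  exact this

open Polynomial in
theorem eq_zero_of_pi_expRec_vanish (q c E : ℕ → ℂ) (hq : ∀ n, IsAlgebraic ℚ (q n))
    (hc : ∀ n, IsAlgebraic ℚ (c n)) (h0 : E 0 = 1)
    (h : ∀ n : ℕ, ((n : ℂ) + 1) * E (n + 1) =
      -∑ p ∈ Finset.HasAntidiagonal.antidiagonal n, (Real.pi * q (p.1 + 1) + c (p.1 + 1)) * E p.2)
    (N : ℕ) (hN : ∀ n > N, E n = 0) (n : ℕ) : q (n + 1) = 0 := by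
  set A := algebraicClosure ℚ ℂ
  set q' : ℕ → A := fun n => ⟨q n, mem_algebraicClosure_iff.2 (hq n)⟩
  set c' : ℕ → A := fun n => ⟨c n, mem_algebraicClosure_iff.2 (hc n)⟩
  have htr : ∀ p : A[X], aeval (Real.pi : ℂ) p = 0 → p = 0 := by
    intro p hp
    by_contra hne
    have : Algebra.IsAlgebraic ℚ A := algebraicClosure.isAlgebraic ℚ ℂ
    exact transcendental_pi (IsAlgebraic.restrictScalars ℚ (⟨p, hne, hp⟩ : IsAlgebraic A (Real.pi : ℂ)))
  have key := eq_zero_of_expRec_vanish q' c' N (fun n hn => htr _ ?_) n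
  · exact congrArg Subtype.val key
  · have h1 := map_expRec (aeval (R := A) (Real.pi : ℂ)).toRingHom
      (fun i => X * C (q' i) + C (c' i)) n
    have h2 := eq_expRec (fun i => Real.pi * q i + c i) E h0 h n
    rw [hN n hn] at h2
    refine Eq.trans ?_ h2.symm
    refine h1.trans ?_
    congr 1
    ext i
    simp [q', c']
    exact mul_comm _ _

open Filter Topology in
lemma exists_entire_factor_aux (z₀ : ℂ) (n : ℕ) : ∀ f : ℂ → ℂ, Differentiable ℂ f →
    (∃ g₀ : ℂ → ℂ, ContinuousAt g₀ z₀ ∧ g₀ z₀ ≠ 0 ∧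
      ∀ᶠ z in 𝓝[≠] z₀, f z = (z - z₀) ^ n * g₀ z) →
    ∃ g : ℂ → ℂ, Differentiable ℂ g ∧ g z₀ ≠ 0 ∧ ∀ z, f z = (z - z₀) ^ n * g z := by
  induction n with
  | zero =>
    rintro f hf ⟨g₀, hc, h0, h⟩
    refine ⟨f, hf, ?_, by simp⟩
    have h1 : Tendsto f (𝓝[≠] z₀) (𝓝 (f z₀)) := (hf z₀).continuousAt.tendsto.mono_left nhdsWithin_le_nhds
    have h2 : Tendsto g₀ (𝓝[≠] z₀) (𝓝 (g₀ z₀)) := hc.tendsto.mono_left nhdsWithin_le_nhds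
    have h3 : f =ᶠ[𝓝[≠] z₀] g₀ := by filter_upwards [h] with z hz; simpa using hz
    rw [tendsto_nhds_unique (h1.congr' h3) h2]
    exact h0
  | succ n ih =>
    rintro f hf ⟨g₀, hc, h0, h⟩
    have hfz : f z₀ = 0 := by
      have h1 : Tendsto f (𝓝[≠] z₀) (𝓝 (f z₀)) := (hf z₀).continuousAt.tendsto.mono_left nhdsWithin_le_nhds
      have h2 : Tendsto (fun z => (z - z₀) ^ (n + 1) * g₀ z) (𝓝[≠] z₀) (𝓝 0) := by
        have : ContinuousAt (fun z => (z - z₀) ^ (n + 1) * g₀ z) z₀ := by fun_prop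
        have := this.tendsto.mono_left (nhdsWithin_le_nhds (s := {z₀}ᶜ))
        simpa using this
      exact tendsto_nhds_unique h1 (h2.congr' (by filter_upwards [h] with z hz; exact hz.symm))
    have hd : Differentiable ℂ (dslope f z₀) := by
      rw [← differentiableOn_univ] at hf ⊢
      exact (Complex.differentiableOn_dslope univ_mem).2 hf
    have hmul : ∀ z, f z = (z - z₀) * dslope f z₀ z := by
      intro z
      have := sub_smul_dslope f z₀ z
      rw [hfz, sub_zero, smul_eq_mul] at this
      exact this.symm
    obtain ⟨g, hg, hg0, hfg⟩ := ih _ hd ⟨g₀, hc, h0, by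
      filter_upwards [h, self_mem_nhdsWithin] with z hz hne
      have hne' : z - z₀ ≠ 0 := sub_ne_zero.2 hne
      rw [hmul, pow_succ'] at hz
      exact mul_left_cancel₀ hne' (by rw [hz]; ring)⟩
    exact ⟨g, hg, hg0, fun z => by rw [hmul, hfg, pow_succ']; ring⟩

open Filter Topology in
lemma exists_entire_factor (f : ℂ → ℂ) (hf : Differentiable ℂ f) (w : ℂ) (hw : f w ≠ 0) (z₀ : ℂ) :
    ∃ (n : ℕ) (g : ℂ → ℂ), Differentiable ℂ g ∧ g z₀ ≠ 0 ∧ ∀ z, f z = (z - z₀) ^ n * g z := by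
  have han : AnalyticOnNhd ℂ f Set.univ := hf.differentiableOn.analyticOnNhd isOpen_univ
  have hne : ¬ ∀ᶠ z in 𝓝 z₀, f z = 0 := by
    intro h
    exact hw (han.eqOn_zero_of_preconnected_of_eventuallyEq_zero isPreconnected_univ
      (Set.mem_univ z₀) h (Set.mem_univ w))
  obtain ⟨n, g₀, hg₀, hg0, h⟩ := (han z₀ (Set.mem_univ _)).exists_eventuallyEq_pow_smul_nonzero_iff.2 hne
  obtain ⟨g, h1, h2, h3⟩ := exists_entire_factor_aux z₀ n f hf ⟨g₀, hg₀.continuousAt, hg0, by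
    filter_upwards [nhdsWithin_le_nhds h] with z hz
    simpa using hz⟩
  exact ⟨n, g, h1, h2, h3⟩

open Polynomial in
lemma exists_entire_zerofree_factor (s : Finset ℂ) : ∀ (f : ℂ → ℂ), Differentiable ℂ f →
    {z | f z = 0} ⊆ s → ∃ (P : ℂ[X]) (R : ℝ) (g : ℂ → ℂ), Differentiable ℂ g ∧ (∀ z, g z ≠ 0) ∧
      (∀ z, f z = P.eval z * g z) ∧ 0 < R ∧ ∀ z, R ≤ ‖z‖ → 1 ≤ ‖P.eval z‖ := by
  classical
  induction s using Finset.induction_on with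
  | empty =>
    intro f hf hs
    exact ⟨1, 1, f, hf, fun z hz => by simpa using hs hz, by simp, one_pos, by simp⟩
  | insert a s ha ih =>
    intro f hf hs
    obtain ⟨w, hw⟩ : ∃ w, f w ≠ 0 := by
      by_contra! h
      exact Set.infinite_univ ((Finset.finite_toSet (insert a s)).subset
        (fun z _ => hs (by simpa using h z)))
    obtain ⟨n, g, hg, hga, hfg⟩ := exists_entire_factor f hf w hw a
    obtain ⟨P, R, g', hg', h0, hgP, hR, hP⟩ := ih g hg (by
      intro z hz
      have hz : g z = 0 := hz
      have : f z = 0 := by rw [hfg, hz, mul_zero]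
      have h1 := hs this
      rcases Finset.mem_insert.1 (Finset.mem_coe.1 h1) with rfl | h
      · exact absurd hz hga
      · exact h)
    refine ⟨(X - C a) ^ n * P, max R (‖a‖ + 1), g', hg', h0, fun z => ?_, lt_max_of_lt_left hR, ?_⟩
    · rw [hfg, hgP]; simp; ring
    · intro z hz
      have h1 := hP z ((le_max_left _ _).trans hz)
      have h2 : 1 ≤ ‖z - a‖ := by
        have := norm_sub_norm_le z a
        have := (le_max_right R _).trans hz
        linarith
      simp only [eval_mul, eval_pow, eval_sub, eval_X, eval_C, norm_mul, norm_pow]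
      exact one_le_mul_of_one_le_of_one_le (one_le_pow₀ h2) h1

open Filter Topology in
/-- A zero-free entire function of order less than one is constant. -/
lemma zerofree_growth_const (g : ℂ → ℂ) (hg : Differentiable ℂ g) (h0 : ∀ z, g z ≠ 0)
    (A B : ℝ) (hA : 0 < A) (hB : 0 ≤ B)
    (hgr : ∀ z, ‖g z‖ ≤ A * Real.exp (B * ‖z‖ ^ (3 / 4 : ℝ))) (z : ℂ) : g z = g 0 := by
  have hd : Differentiable ℂ (fun z => deriv g z / g z) := by
    have := hg.deriv
    intro z
    exact (this z).div (hg z) (h0 z)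
  obtain ⟨h, hh0, hh⟩ := hd.isExactOn_univ.with_val_at 0 0
  have hhd : Differentiable ℂ h := fun z => (hh z (Set.mem_univ z)).differentiableAt
  have hgh : ∀ z, g z = g 0 * Complex.exp (h z) := by
    intro z
    have hc : ∀ x, HasDerivAt (fun z => g z * Complex.exp (-h z)) 0 x := by
      intro x
      have h1 := (hg x).hasDerivAt.mul ((hh x (Set.mem_univ x)).neg.cexp)
      refine h1.congr_deriv ?_
      have := h0 x
      simp only [Pi.neg_apply]
      field_simp
      ring
    have := is_const_of_deriv_eq_zero (fun x => (hc x).differentiableAt) (fun x => (hc x).deriv) z 0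
    simp only [hh0, neg_zero, Complex.exp_zero, mul_one] at this
    rw [← this, mul_assoc, ← Complex.exp_add]
    simp
  set C₀ := |Real.log (A / ‖g 0‖)| + 1 with hC₀
  have hg0 : 0 < ‖g 0‖ := norm_pos_iff.2 (h0 0)
  have hre : ∀ z, (h z).re ≤ C₀ + B * ‖z‖ ^ (3 / 4 : ℝ) := by
    intro z
    have h1 := hgr z
    rw [hgh, norm_mul, Complex.norm_exp] at h1
    have h2 : Real.exp (h z).re ≤ (A / ‖g 0‖) * Real.exp (B * ‖z‖ ^ (3 / 4 : ℝ)) := by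
      rw [div_mul_eq_mul_div, le_div_iff₀ hg0]; linarith
    have h3 := Real.log_le_log (Real.exp_pos _) h2
    rw [Real.log_exp, Real.log_mul (by positivity) (Real.exp_ne_zero _), Real.log_exp] at h3
    have := le_abs_self (Real.log (A / ‖g 0‖))
    linarith
  have hz : ‖h z‖ ≤ 0 := by
    have hbound : ∀ᶠ R : ℝ in atTop, ‖h z‖ ≤ 2 * (C₀ + B * R ^ (3 / 4 : ℝ)) * ‖z‖ / (R - ‖z‖) := by
      filter_upwards [eventually_gt_atTop ‖z‖] with R hR
      have hRpos : 0 < R := (norm_nonneg z).trans_lt hR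
      refine Complex.borelCaratheodory_zero (by positivity) hhd.differentiableOn ?_ hRpos
        (by simpa using hR) hh0
      intro x hx
      have hx : ‖x‖ < R := by simpa using hx
      refine (hre x).trans ?_
      gcongr
    refine ge_of_tendsto ?_ hbound
    have h1 : Tendsto (fun R : ℝ => R ^ (3 / 4 : ℝ) / R) atTop (𝓝 0) := by
      have := tendsto_rpow_neg_atTop (show (0 : ℝ) < 1 / 4 by norm_num)
      refine this.congr' ?_
      filter_upwards [eventually_gt_atTop 0] with R hR
      rw [← Real.rpow_sub_one hR.ne']; norm_num
    have h2 : Tendsto (fun R : ℝ => (R)⁻¹) atTop (𝓝 0) := tendsto_inv_atTop_zero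
    have h3 : Tendsto (fun R : ℝ => 2 * (C₀ * R⁻¹ + B * (R ^ (3 / 4 : ℝ) / R)) * ‖z‖ / (1 - ‖z‖ * R⁻¹))
        atTop (𝓝 (2 * (C₀ * 0 + B * 0) * ‖z‖ / (1 - ‖z‖ * 0))) := by
      refine Tendsto.div ?_ ?_ (by simp)
      · exact (((h2.const_mul C₀).add (h1.const_mul B)).const_mul 2).mul_const _
      · exact (h2.const_mul _).const_sub 1
    simp only [mul_zero, add_zero, zero_mul, zero_div] at h3
    refine h3.congr' ?_
    filter_upwards [eventually_gt_atTop ‖z‖] with R hR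
    have hRpos : 0 < R := (norm_nonneg z).trans_lt hR
    have : R - ‖z‖ ≠ 0 := by linarith
    have h4 : 1 - ‖z‖ * R⁻¹ ≠ 0 := by
      rw [← div_eq_mul_inv, ne_eq, sub_eq_zero, eq_div_iff hRpos.ne']; linarith
    have h5 : 1 - ‖z‖ * R⁻¹ = (R - ‖z‖) / R := by field_simp
    rw [h5]
    field_simp
  have hz0 : h z = 0 := norm_le_zero_iff.1 hz
  rw [hgh z, hz0]; simp

open Polynomial in
/-- An entire function of order less than one with finitely many zeros is a polynomial. -/
theorem exists_polynomial_of_growth (f : ℂ → ℂ) (hf : Differentiable ℂ f)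
    (hfin : {z | f z = 0}.Finite) (A B : ℝ) (hA : 0 < A) (hB : 0 ≤ B)
    (hgr : ∀ z, ‖f z‖ ≤ A * Real.exp (B * ‖z‖ ^ (3 / 4 : ℝ))) :
    ∃ P : ℂ[X], ∀ z, f z = P.eval z := by
  obtain ⟨P, R, g, hg, h0, hfg, hR, hP⟩ := exists_entire_zerofree_factor hfin.toFinset f hf
    (by simp)
  obtain ⟨M, hM⟩ := (isCompact_closedBall (0 : ℂ) R).exists_bound_of_continuousOn
    hg.continuous.continuousOn
  have hgr' : ∀ z, ‖g z‖ ≤ (A + |M|) * Real.exp (B * ‖z‖ ^ (3 / 4 : ℝ)) := by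
    intro z
    have he : 1 ≤ Real.exp (B * ‖z‖ ^ (3 / 4 : ℝ)) := Real.one_le_exp (by positivity)
    rcases le_total ‖z‖ R with hz | hz
    · have h1 := hM z (by simpa using hz)
      have h2 := le_abs_self M
      nlinarith [abs_nonneg M]
    · have h1 := hgr z
      rw [hfg, norm_mul] at h1
      have h2 := hP z hz
      have h3 : ‖g z‖ ≤ ‖P.eval z‖ * ‖g z‖ := le_mul_of_one_le_left (norm_nonneg _) h2
      nlinarith [abs_nonneg M, Real.exp_pos (B * ‖z‖ ^ (3 / 4 : ℝ))]
  have hc := zerofree_growth_const g hg h0 (A + |M|) B (by positivity) hB hgr'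
  exact ⟨P * C (g 0), fun z => by rw [hfg, hc z]; simp⟩

section InfiniteDeterminant

open Filter Topology

lemma norm_det_le_prod_row_sum {n : Type*} [Fintype n] [DecidableEq n] (M : Matrix n n ℂ) :
    ‖M.det‖ ≤ ∏ i, ∑ j, ‖M i j‖ := by
  rw [← Matrix.det_transpose, Matrix.det_apply]
  refine (norm_sum_le _ _).trans ?_
  rw [Finset.prod_univ_sum, Fintype.piFinset_univ]
  have h1 : ∀ σ : Equiv.Perm n, ‖Equiv.Perm.sign σ • ∏ i, M.transpose (σ i) i‖ = ∏ i, ‖M i (σ i)‖ := by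
    intro σ
    rcases Int.units_eq_one_or (Equiv.Perm.sign σ) with h | h <;> simp [h, norm_prod]
  simp_rw [h1]
  have hinj : Function.Injective (fun σ : Equiv.Perm n => (σ : n → n)) := DFunLike.coe_injective
  rw [← Finset.sum_image (s := Finset.univ) (g := fun σ : Equiv.Perm n => (σ : n → n))
    (f := fun p : n → n => ∏ i, ‖M i (p i)‖) (fun a _ b _ h => hinj h)]
  exact Finset.sum_le_sum_of_subset_of_nonneg (Finset.subset_univ _)
    (fun _ _ _ => Finset.prod_nonneg fun _ _ => norm_nonneg _)

lemma norm_det_fromBlocks_sub_le {n : Type*} [Fintype n] [DecidableEq n] (A : Matrix n n ℂ)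
    (b : n → ℂ) (c : n → ℂ) (d : ℂ) :
    ‖(Matrix.fromBlocks A (Matrix.of fun i (_ : Unit) => b i) (Matrix.of fun (_ : Unit) j => c j)
      (Matrix.of fun _ _ => 1 + d)).det - A.det‖ ≤
      (∑ j, ‖c j‖ + ‖d‖) * ∏ i, (∑ j, ‖A i j‖ + ‖b i‖) := by
  set M := Matrix.fromBlocks A (Matrix.of fun i (_ : Unit) => b i)
    (Matrix.of fun (_ : Unit) j => c j) (Matrix.of fun _ _ => 1 + d) with hM
  have h1 : M.updateRow (Sum.inr ()) (Sum.elim (0 : n → ℂ) (fun _ => 1) + Sum.elim c (fun _ => d)) = M := by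
    ext i j
    rcases i with i | i <;> rcases j with j | j <;> simp [hM, Matrix.updateRow_apply]
  have h2 : (M.updateRow (Sum.inr ()) (Sum.elim (0 : n → ℂ) (fun _ => 1))).det = A.det := by
    have : M.updateRow (Sum.inr ()) (Sum.elim (0 : n → ℂ) (fun _ => 1)) =
        Matrix.fromBlocks A (Matrix.of fun i (_ : Unit) => b i) 0 1 := by
      ext i j
      rcases i with i | i <;> rcases j with j | j <;> simp [hM, Matrix.updateRow_apply]
    rw [this, Matrix.det_fromBlocks_zero₂₁, Matrix.det_one, mul_one]
  rw [← h1, Matrix.det_updateRow_add, h2, add_sub_cancel_left]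
  refine (norm_det_le_prod_row_sum _).trans ?_
  rw [Fintype.prod_sum_type]
  simp [Matrix.updateRow_apply, hM, mul_comm]

variable {ι : Type*} [DecidableEq ι]

/-- The determinant of `1 - N` restricted to a finite set of indices. -/
def detS (N : ι → ι → ℂ) (S : Finset ι) : ℂ :=
  Matrix.det (1 - Matrix.of (fun i j : S => N i j))

/-- The determinant of `1 - N` for an infinite matrix with summable row sums. -/
def detI (N : ι → ι → ℂ) : ℂ := limUnder atTop (detS N)

/-- `r` bounds the absolute row sums of `N`. -/
def RowBdd (N : ι → ι → ℂ) (r : ι → ℝ) : Prop :=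
  ∀ x, ∀ T : Finset ι, ∑ y ∈ T, ‖N x y‖ ≤ r x

omit [DecidableEq ι] in
lemma RowBdd.nonneg {N : ι → ι → ℂ} {r : ι → ℝ} (h : RowBdd N r) (x : ι) : 0 ≤ r x := by
  simpa using h x ∅

omit [DecidableEq ι] in
lemma RowBdd.summable {N : ι → ι → ℂ} {r : ι → ℝ} (h : RowBdd N r) (x : ι) :
    Summable fun y => ‖N x y‖ :=
  summable_of_sum_le (fun _ => norm_nonneg _) (h x)

lemma norm_detS_insert_sub_le {N : ι → ι → ℂ} {r : ι → ℝ} (h : RowBdd N r) (S : Finset ι) (a : ι)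
    (ha : a ∉ S) : ‖detS N (insert a S) - detS N S‖ ≤ r a * ∏ x ∈ S, (1 + r x) := by
  set e : S ⊕ Unit ≃ ↥(insert a S) :=
    ((Finset.subtypeInsertEquivOption ha).trans (Equiv.optionEquivSumPUnit _)).symm with he
  have he1 : ∀ i : S, (e (Sum.inl i) : ι) = i := by
    intro i; simp [he, Finset.subtypeInsertEquivOption]
  have he2 : ∀ u, (e (Sum.inr u) : ι) = a := by
    intro i; simp [he, Finset.subtypeInsertEquivOption]
  set M := (1 - Matrix.of (fun i j : ↥(insert a S) => N i j)) with hM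
  have h1 : detS N (insert a S) = (M.submatrix e e).det := by
    rw [Matrix.det_submatrix_equiv_self]; rfl
  set A := (1 - Matrix.of (fun i j : S => N i j)) with hA
  have h2 : M.submatrix e e = Matrix.fromBlocks A (Matrix.of fun i (_ : Unit) => -N i a)
      (Matrix.of fun (_ : Unit) j => -N a j) (Matrix.of fun _ _ => 1 + -N a a) := by
    ext i j
    rcases i with i | i <;> rcases j with j | j
    · simp [hM, hA, he1, Matrix.one_apply]
    · simp [hM, he1, he2]
    · simp [hM, he1, he2]
    · simp [hM, he2, sub_eq_add_neg]
  rw [h1, h2]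
  refine (norm_det_fromBlocks_sub_le A _ _ _).trans ?_
  have h3 : ∀ x, ∑ j : S, ‖N x j‖ + ‖N x a‖ ≤ r x := by
    intro x
    have := h x (insert a S)
    rw [Finset.sum_insert ha] at this
    rw [Finset.sum_coe_sort S (fun j => ‖N x j‖)]
    linarith
  rw [← Finset.prod_coe_sort S]
  refine mul_le_mul (by simpa using h3 a) (Finset.prod_le_prod (fun _ _ => by positivity) fun i _ => ?_)
    (Finset.prod_nonneg fun _ _ => by positivity) (h.nonneg a)
  have h4 : ∑ j : S, ‖A i j‖ ≤ 1 + ∑ j : S, ‖N i j‖ := by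
    calc ∑ j : S, ‖A i j‖ ≤ ∑ j : S, (‖(1 : Matrix S S ℂ) i j‖ + ‖N i j‖) :=
          Finset.sum_le_sum fun j _ => by simpa [hA] using norm_sub_le _ _
      _ = _ := by
          rw [Finset.sum_add_distrib]
          congr 1
          rw [Finset.sum_eq_single i]
          · simp
          · intro j _ hj; simp [Matrix.one_apply_ne hj.symm]
          · simp
  have := h3 i
  simp only [norm_neg]
  linarith

lemma norm_detS_sub_le {N : ι → ι → ℂ} {r : ι → ℝ} (h : RowBdd N r) (S T : Finset ι)
    (hST : S ⊆ T) :
    ‖detS N T - detS N S‖ ≤ ∏ x ∈ T, (1 + r x) - ∏ x ∈ S, (1 + r x) := by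
  obtain ⟨U, hU⟩ : ∃ U, T = S ∪ U := ⟨T, (Finset.union_eq_right.2 hST).symm⟩
  subst hU
  clear hST
  induction U using Finset.induction_on with
  | empty => simp
  | insert a U _ ih =>
    rw [Finset.union_insert]
    by_cases ha : a ∈ S ∪ U
    · rwa [Finset.insert_eq_of_mem ha]
    · rw [Finset.prod_insert ha]
      have h1 := norm_detS_insert_sub_le h _ a ha
      have h2 := norm_sub_le_norm_sub_add_norm_sub (detS N (insert a (S ∪ U))) (detS N (S ∪ U)) (detS N S)
      linarith

omit [DecidableEq ι] in
lemma RowBdd.prod_le {N : ι → ι → ℂ} {r : ι → ℝ} (h : RowBdd N r) (hr : Summable r) (S : Finset ι) :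
    ∏ x ∈ S, (1 + r x) ≤ ∏' x, (1 + r x) := by
  have hm : Multipliable fun x => 1 + r x := Real.multipliable_one_add_of_summable hr
  refine ge_of_tendsto hm.hasProd ?_
  filter_upwards [eventually_ge_atTop S] with T hT
  classical
  rw [← Finset.prod_sdiff hT]
  refine le_mul_of_one_le_left (Finset.prod_nonneg fun x _ => by linarith [h.nonneg x]) ?_
  exact Finset.one_le_prod fun x _ => by linarith [h.nonneg x]

lemma norm_detS_sub_le_tprod {N : ι → ι → ℂ} {r : ι → ℝ} (h : RowBdd N r) (hr : Summable r)
    (S T : Finset ι) (hST : S ⊆ T) :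
    ‖detS N T - detS N S‖ ≤ ∏' x, (1 + r x) - ∏ x ∈ S, (1 + r x) :=
  (norm_detS_sub_le h S T hST).trans (by linarith [h.prod_le hr T])

lemma norm_detS_le {N : ι → ι → ℂ} {r : ι → ℝ} (h : RowBdd N r) (S : Finset ι) :
    ‖detS N S‖ ≤ ∏ x ∈ S, (1 + r x) := by
  have h1 := norm_detS_sub_le h ∅ S (Finset.empty_subset _)
  have h0 : detS N ∅ = 1 := by simp [detS]
  rw [h0, Finset.prod_empty] at h1
  have := norm_sub_norm_le (detS N S) 1
  simp at this
  linarith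

lemma tendsto_detS {N : ι → ι → ℂ} {r : ι → ℝ} (h : RowBdd N r) (hr : Summable r) :
    Tendsto (detS N) atTop (𝓝 (detI N)) := by
  have hm : Multipliable fun x => 1 + r x := Real.multipliable_one_add_of_summable hr
  have hc : Cauchy (map (detS N) atTop) := by
    rw [Metric.cauchy_iff]
    refine ⟨inferInstance, fun ε hε => ?_⟩
    have h1 : ∀ᶠ S : Finset ι in atTop, ∏' x, (1 + r x) - ∏ x ∈ S, (1 + r x) < ε / 2 := by
      have := hm.hasProd.eventually_const_lt (show ∏' x, (1 + r x) - ε / 2 < ∏' x, (1 + r x) by linarith)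
      filter_upwards [this] with S hS
      linarith
    obtain ⟨S, hS⟩ := h1.exists
    refine ⟨detS N '' Set.Ici S, image_mem_map (Ici_mem_atTop S), ?_⟩
    rintro _ ⟨T, hT, rfl⟩ _ ⟨T', hT', rfl⟩
    have e1 := norm_detS_sub_le_tprod h hr S T hT
    have e2 := norm_detS_sub_le_tprod h hr S T' hT'
    rw [dist_eq_norm]
    rw [norm_sub_rev] at e2
    have := norm_sub_le_norm_sub_add_norm_sub (detS N T) (detS N S) (detS N T')
    linarith
  exact tendsto_nhds_limUnder (CompleteSpace.complete hc)

lemma norm_detI_sub_le {N : ι → ι → ℂ} {r : ι → ℝ} (h : RowBdd N r) (hr : Summable r)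
    (S : Finset ι) : ‖detI N - detS N S‖ ≤ ∏' x, (1 + r x) - ∏ x ∈ S, (1 + r x) := by
  refine le_of_tendsto ((tendsto_detS h hr).sub_const _).norm ?_
  filter_upwards [eventually_ge_atTop S] with T hT
  exact norm_detS_sub_le_tprod h hr S T hT

lemma norm_detI_le {N : ι → ι → ℂ} {r : ι → ℝ} (h : RowBdd N r) (hr : Summable r) :
    ‖detI N‖ ≤ ∏' x, (1 + r x) :=
  le_of_tendsto (tendsto_detS h hr).norm
    (Eventually.of_forall fun S => (norm_detS_le h S).trans (h.prod_le hr S))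

lemma tendstoUniformlyOn_detS {P : Type*} {N : P → ι → ι → ℂ} {r : ι → ℝ} {U : Set P}
    (h : ∀ z ∈ U, RowBdd (N z) r) (hr : Summable r) :
    TendstoUniformlyOn (fun S z => detS (N z) S) (fun z => detI (N z)) atTop U := by
  have hm : Multipliable fun x => 1 + r x := Real.multipliable_one_add_of_summable hr
  rw [Metric.tendstoUniformlyOn_iff]
  intro ε hε
  have := hm.hasProd.eventually_const_lt (show ∏' x, (1 + r x) - ε < ∏' x, (1 + r x) by linarith)
  filter_upwards [this] with S hS z hz
  rw [dist_eq_norm]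
  linarith [norm_detI_sub_le (h z hz) hr S]

lemma differentiableOn_detS {N : ℂ → ι → ι → ℂ} {U : Set ℂ}
    (hd : ∀ x y, DifferentiableOn ℂ (fun z => N z x y) U) (S : Finset ι) :
    DifferentiableOn ℂ (fun z => detS (N z) S) U := by
  unfold detS
  simp only [Matrix.det_apply]
  refine DifferentiableOn.fun_sum fun σ _ => DifferentiableOn.const_smul (DifferentiableOn.fun_finsetProd fun i _ => ?_) _
  simp only [Matrix.sub_apply, Matrix.of_apply]
  exact (hd _ _).const_sub _

end InfiniteDeterminant

section FiniteNewton

open Polynomial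

variable {n : Type*} [Fintype n] [DecidableEq n]

lemma eval_charpolyRev_eq (A : Matrix n n ℂ) (μ : ℂ) :
    A.charpolyRev.eval μ = (1 - μ • A).det := by
  rw [Matrix.charpolyRev, ← coe_evalRingHom, RingHom.map_det]
  congr 1
  ext i j
  by_cases h : i = j
  · simp [h, mul_comm (A j j)]
  · simp [h, mul_comm (A i j)]

lemma map_eval_one_sub_X_smul (A : Matrix n n ℂ) (μ : ℂ) :
    (evalRingHom μ).mapMatrix (1 - (X : ℂ[X]) • A.map C) = 1 - μ • A := by
  ext i j
  by_cases h : i = j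
  · simp [h, mul_comm (A j j)]
  · simp [h, mul_comm (A i j)]

lemma eval_derivative_charpolyRev (A : Matrix n n ℂ) (μ : ℂ) (h : (1 - μ • A).det ≠ 0) :
    (derivative A.charpolyRev).eval μ = -((1 - μ • A).adjugate * A).trace := by
  set M := 1 - μ • A with hM
  have hu : IsUnit M.det := isUnit_iff_ne_zero.2 h
  have h1 : ∀ x : ℂ, A.charpolyRev.eval (μ + x) = M.det * (1 + x • (-(M⁻¹ * A))).det := by
    intro x
    rw [eval_charpolyRev_eq, ← Matrix.det_mul]
    congr 1
    rw [mul_add, mul_one, Matrix.mul_smul, mul_neg, ← mul_assoc, Matrix.mul_nonsing_inv _ hu, one_mul, hM]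
    module
  have h2 : HasDerivAt (fun x : ℂ => A.charpolyRev.eval (μ + x)) ((derivative A.charpolyRev).eval μ) 0 := by
    have := (A.charpolyRev.hasDerivAt (μ + 0)).comp_const_add μ 0
    simpa using this
  set q := -(M⁻¹ * A) with hq
  have h3 : HasDerivAt (fun x : ℂ => A.charpolyRev.eval (μ + x)) (M.det * q.trace) 0 := by
    have e : (fun x : ℂ => A.charpolyRev.eval (μ + x)) = fun x => (C M.det * ((1 : ℂ[X]) + C q.trace * X +
        (Matrix.det ((1 : Matrix n n ℂ[X]) + (X : ℂ[X]) • q.map C)).divX.divX * X ^ 2) : ℂ[X]).eval x := by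
      funext x
      rw [h1, Matrix.det_one_add_smul]
      simp
    rw [e]
    refine (Polynomial.hasDerivAt _ _).congr_deriv ?_
    simp
  rw [h2.unique h3, hq, Matrix.trace_neg, Matrix.inv_def, Matrix.smul_mul, Matrix.trace_smul,
    Ring.inverse_eq_inv', smul_eq_mul]
  field_simp

lemma derivative_charpolyRev (A : Matrix n n ℂ) :
    derivative A.charpolyRev = -((1 - (X : ℂ[X]) • A.map C).adjugate * A.map C).trace := by
  refine Polynomial.eq_of_infinite_eval_eq _ _ ?_
  have h0 : A.charpolyRev ≠ 0 := by
    intro h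
    have := A.eval_charpolyRev
    rw [h] at this; simp at this
  refine (A.charpolyRev.rootSet_finite ℂ).infinite_compl.mono ?_
  intro μ hμ
  have h1 : (1 - μ • A).det ≠ 0 := by
    rw [← eval_charpolyRev_eq]
    intro h
    apply hμ
    rw [Polynomial.mem_rootSet]
    exact ⟨h0, by simpa using h⟩
  show eval _ _ = eval _ _
  rw [eval_derivative_charpolyRev A μ h1, eval_neg, ← map_eval_one_sub_X_smul, ← coe_evalRingHom,
    ← AddMonoidHom.coe_coe, AddMonoidHom.map_trace]
  congr 2
  rw [AddMonoidHom.coe_coe]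
  change _ = (evalRingHom μ).mapMatrix _
  rw [map_mul, RingHom.map_adjugate]
  congr 1
  ext i j
  simp

/-- Newton's identities in terms of traces of powers of a matrix. -/
lemma newton_charpolyRev (A : Matrix n n ℂ) (k : ℕ) :
    ((k : ℂ) + 1) * A.charpolyRev.coeff (k + 1) =
      -∑ p ∈ Finset.HasAntidiagonal.antidiagonal k, (A ^ (p.1 + 1)).trace * A.charpolyRev.coeff p.2 := by
  have h1 := derivative_charpolyRev A
  set B := A.map C with hB
  set M := 1 - (X : ℂ[X]) • B with hM
  have h2 : ∀ N : ℕ, B = M * (∑ i ∈ Finset.range N, (X : ℂ[X]) ^ i • B ^ (i + 1)) + (X : ℂ[X]) ^ N • B ^ (N + 1) := by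
    intro N
    induction N with
    | zero => simp
    | succ N ih =>
      rw [Finset.sum_range_succ, mul_add]
      nth_rewrite 1 [ih]
      rw [add_assoc]
      congr 1
      rw [hM, sub_mul, one_mul, Matrix.smul_mul, Matrix.mul_smul, ← pow_succ' B, smul_smul, ← pow_succ']
      simp
  have h3 : ((M.adjugate * B).trace) = A.charpolyRev * (∑ i ∈ Finset.range (k + 1), (X : ℂ[X]) ^ i * C (A ^ (i + 1)).trace)
      + (M.adjugate * B ^ (k + 2)).trace * X ^ (k + 1) := by
    have hP : M.det = A.charpolyRev := rfl
    have hB' : ∀ i : ℕ, (B ^ (i + 1)).trace = C (A ^ (i + 1)).trace := by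
      intro i
      have : B ^ (i + 1) = (A ^ (i + 1)).map C := by
        rw [hB, ← RingHom.mapMatrix_apply, ← RingHom.mapMatrix_apply, map_pow]
      rw [this]
      simp [Matrix.trace]
    generalize hQ : M.adjugate = Q
    have hQM : Q * M = A.charpolyRev • (1 : Matrix n n ℂ[X]) := by
      rw [← hQ, Matrix.adjugate_mul, hP]
    have e : Q * B = A.charpolyRev • (∑ i ∈ Finset.range (k + 1), (X : ℂ[X]) ^ i • B ^ (i + 1)) +
        (X : ℂ[X]) ^ (k + 1) • (Q * B ^ (k + 2)) := by
      conv_lhs => rw [h2 (k + 1)]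
      rw [mul_add, ← mul_assoc, hQM, Matrix.smul_mul, one_mul, Matrix.mul_smul]
    rw [e, Matrix.trace_add, Matrix.trace_smul, Matrix.trace_smul, Matrix.trace_sum]
    simp only [Matrix.trace_smul, smul_eq_mul, hB']
    rw [mul_comm (X ^ (k + 1))]
  rw [h3] at h1
  have h4 := congrArg (fun p => coeff p k) h1
  simp only [coeff_derivative, coeff_neg, coeff_add] at h4
  rw [mul_comm, h4, coeff_mul_X_pow', if_neg (by omega), add_zero, coeff_mul,
    ← Finset.Nat.sum_antidiagonal_swap]
  congr 1
  refine Finset.sum_congr rfl fun p hp => ?_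
  have hp' : p.1 < k + 1 := by
    have := Finset.HasAntidiagonal.mem_antidiagonal.1 hp; omega
  simp only [Prod.swap, finsetSum_coeff, coeff_X_pow_mul', coeff_C]
  rw [Finset.sum_eq_single p.1]
  · simp [mul_comm]
  · intro j _ hj
    by_cases h : j ≤ p.1
    · rw [if_pos h, if_neg (by omega)]
    · rw [if_neg h]
  · intro h; exact absurd (Finset.mem_range.2 hp') h

end FiniteNewton

section InfiniteNewton

open Filter Topology

lemma tendstoLocallyUniformlyOn_iteratedDeriv {P : Type*} {φ : Filter P} [φ.NeBot] {F : P → ℂ → ℂ}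
    {f : ℂ → ℂ} {U : Set ℂ} (hU : IsOpen U) (hf : TendstoLocallyUniformlyOn F f φ U)
    (hF : ∀ p, DifferentiableOn ℂ (F p) U) (n : ℕ) :
    TendstoLocallyUniformlyOn (fun p => iteratedDeriv n (F p)) (iteratedDeriv n f) φ U ∧
      ∀ p, DifferentiableOn ℂ (iteratedDeriv n (F p)) U := by
  induction n with
  | zero => simpa [iteratedDeriv_zero] using ⟨hf, hF⟩
  | succ n ih =>
    simp only [iteratedDeriv_succ]
    exact ⟨ih.1.deriv (Eventually.of_forall ih.2) hU, fun p => (ih.2 p).deriv hU⟩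

lemma iteratedDeriv_polynomial_zero (P : Polynomial ℂ) (n : ℕ) :
    iteratedDeriv n (fun x => P.eval x) 0 = n.factorial * P.coeff n := by
  have h : ∀ (m : ℕ), iteratedDeriv m (fun x => P.eval x) = fun x => (Polynomial.derivative^[m] P).eval x := by
    intro m
    induction m with
    | zero => simp
    | succ m ih =>
      rw [iteratedDeriv_succ, ih]
      funext x
      rw [Polynomial.deriv, Function.iterate_succ_apply']
  rw [h]
  show Polynomial.eval 0 _ = _
  rw [← Polynomial.coeff_zero_eq_eval_zero, Polynomial.coeff_iterate_derivative]
  simp [Nat.descFactorial_self]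

variable {ι : Type*}

/-- `infPow N n` is the matrix power `N ^ (n + 1)`. -/
def infPow (N : ι → ι → ℂ) : ℕ → ι → ι → ℂ
  | 0 => N
  | n + 1 => fun x y => ∑' z, N x z * infPow N n z y

/-- The trace of `N ^ (n + 1)`. -/
def infTr (N : ι → ι → ℂ) (n : ℕ) : ℂ := ∑' x, infPow N n x x

lemma RowBdd.tsum_le {N : ι → ι → ℂ} {r : ι → ℝ} (h : RowBdd N r) (x : ι) :
    ∑' y, ‖N x y‖ ≤ r x :=
  (h.summable x).tsum_le_of_sum_le (h x)

lemma norm_infPow_le {N : ι → ι → ℂ} {r : ι → ℝ} (h : RowBdd N r) {R : ℝ} (hR : ∀ x, r x ≤ R) (n : ℕ)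
    (x y : ι) : ‖infPow N n x y‖ ≤ r x * R ^ n := by
  induction n generalizing x with
  | zero => simpa [infPow] using h x {y}
  | succ n ih =>
    have hR0 : 0 ≤ R := (h.nonneg x).trans (hR x)
    have hb : ∀ z, ‖N x z * infPow N n z y‖ ≤ ‖N x z‖ * R ^ (n + 1) := by
      intro z
      rw [norm_mul]
      refine mul_le_mul_of_nonneg_left ((ih z).trans ?_) (norm_nonneg _)
      rw [pow_succ']
      exact mul_le_mul_of_nonneg_right (hR z) (by positivity)
    rw [infPow]
    have hs := (h.summable x).mul_right (R ^ (n + 1))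
    refine (tsum_of_norm_bounded hs.hasSum hb).trans ?_
    rw [tsum_mul_right]
    exact mul_le_mul_of_nonneg_right (h.tsum_le x) (by positivity)

variable [DecidableEq ι]

/-- Restriction of a matrix to a finite set of indices, extended by zero. -/
def truncMat (S : Finset ι) (N : ι → ι → ℂ) (x y : ι) : ℂ := if x ∈ S ∧ y ∈ S then N x y else 0

lemma RowBdd.truncMat {N : ι → ι → ℂ} {r : ι → ℝ} (h : RowBdd N r) (S : Finset ι) :
    RowBdd (truncMat S N) r := by
  intro x T
  refine (Finset.sum_le_sum fun y _ => ?_).trans (h x T)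
  unfold TBG.truncMat
  split_ifs <;> simp

lemma tendsto_truncMat (N : ι → ι → ℂ) (x y : ι) :
    Tendsto (fun S => truncMat S N x y) atTop (𝓝 (N x y)) := by
  refine tendsto_const_nhds.congr' ?_
  filter_upwards [eventually_ge_atTop {x, y}] with S hS
  have hx : x ∈ S := hS (by simp)
  have hy : y ∈ S := hS (by simp)
  simp [truncMat, hx, hy]

lemma norm_truncMat_le (N : ι → ι → ℂ) (S : Finset ι) (x y : ι) : ‖truncMat S N x y‖ ≤ ‖N x y‖ := by
  unfold truncMat
  split_ifs <;> simp

lemma tendsto_infPow_truncMat {N : ι → ι → ℂ} {r : ι → ℝ} (h : RowBdd N r) {R : ℝ} (hR : ∀ x, r x ≤ R)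
    (n : ℕ) (x y : ι) :
    Tendsto (fun S => infPow (truncMat S N) n x y) atTop (𝓝 (infPow N n x y)) := by
  induction n generalizing x with
  | zero => exact tendsto_truncMat N x y
  | succ n ih =>
    have hR0 : 0 ≤ R := (h.nonneg x).trans (hR x)
    simp only [infPow]
    refine tendsto_tsum_of_dominated_convergence ((h.summable x).mul_right (R ^ (n + 1)))
      (fun z => (tendsto_truncMat N x z).mul (ih z)) (Eventually.of_forall fun S z => ?_)
    rw [norm_mul]
    refine mul_le_mul (norm_truncMat_le _ _ _ _) ((norm_infPow_le (h.truncMat S) hR n z y).trans ?_)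
      (norm_nonneg _) (norm_nonneg _)
    rw [pow_succ']
    exact mul_le_mul_of_nonneg_right (hR z) (by positivity)

lemma infPow_truncMat_of_notMem (N : ι → ι → ℂ) (S : Finset ι) (n : ℕ) {x : ι} (hx : x ∉ S) (y : ι) :
    infPow (truncMat S N) n x y = 0 := by
  cases n with
  | zero => simp [infPow, truncMat, hx]
  | succ n => simp [infPow, truncMat, hx]

lemma infPow_truncMat (N : ι → ι → ℂ) (S : Finset ι) (n : ℕ) (x y : S) :
    infPow (truncMat S N) n x y = ((Matrix.of fun i j : S => N i j) ^ (n + 1)) x y := by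
  induction n generalizing x with
  | zero => simp [infPow, truncMat]
  | succ n ih =>
    have e : infPow (truncMat S N) (n + 1) x y =
        ∑ z ∈ S, truncMat S N x z * infPow (truncMat S N) n z y :=
      tsum_eq_sum fun z hz => by rw [infPow_truncMat_of_notMem N S n hz, mul_zero]
    rw [e, pow_succ', Matrix.mul_apply, ← Finset.sum_coe_sort]
    refine Finset.sum_congr rfl fun z _ => ?_
    rw [ih z]
    simp [truncMat]

lemma infTr_truncMat (N : ι → ι → ℂ) (S : Finset ι) (n : ℕ) :
    infTr (truncMat S N) n = ((Matrix.of fun i j : S => N i j) ^ (n + 1)).trace := by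
  rw [infTr, tsum_eq_sum (s := S) (fun z hz => infPow_truncMat_of_notMem N S n hz z),
    ← Finset.sum_coe_sort]
  exact Finset.sum_congr rfl fun z _ => infPow_truncMat N S n z z

lemma tendsto_infTr_truncMat {N : ι → ι → ℂ} {r : ι → ℝ} (h : RowBdd N r) (hr : Summable r) {R : ℝ}
    (hR : ∀ x, r x ≤ R) (n : ℕ) :
    Tendsto (fun S => infTr (truncMat S N) n) atTop (𝓝 (infTr N n)) :=
  tendsto_tsum_of_dominated_convergence (hr.mul_right (R ^ n))
    (fun x => tendsto_infPow_truncMat h hR n x x)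
    (Eventually.of_forall fun S x => norm_infPow_le (h.truncMat S) hR n x x)

omit [DecidableEq ι] in
lemma RowBdd.smul {N : ι → ι → ℂ} {r : ι → ℝ} (h : RowBdd N r) (μ : ℂ) :
    RowBdd (fun x y => μ * N x y) (fun x => ‖μ‖ * r x) := by
  intro x T
  simp only [norm_mul, ← Finset.mul_sum]
  exact mul_le_mul_of_nonneg_left (h x T) (norm_nonneg _)

lemma detS_smul_eq (N : ι → ι → ℂ) (S : Finset ι) (μ : ℂ) :
    detS (fun x y => μ * N x y) S = (Matrix.of fun i j : S => N i j).charpolyRev.eval μ := by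
  rw [eval_charpolyRev_eq, detS]
  congr 1

lemma tendstoLocallyUniformlyOn_detS_smul {N : ι → ι → ℂ} {r : ι → ℝ} (h : RowBdd N r) (hr : Summable r) :
    TendstoLocallyUniformlyOn (fun S μ => detS (fun x y => μ * N x y) S)
      (fun μ => detI (fun x y => μ * N x y)) atTop Set.univ := by
  rw [tendstoLocallyUniformlyOn_iff_forall_isCompact isOpen_univ]
  intro L _ hL
  obtain ⟨M, hM⟩ := hL.isBounded.exists_norm_le
  refine tendstoUniformlyOn_detS (r := fun x => M * r x) (fun z hz => ?_) (hr.mul_left M)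
  intro x T
  exact (h.smul z x T).trans (mul_le_mul_of_nonneg_right (hM z hz) (h.nonneg x))

lemma differentiable_detI_smul {N : ι → ι → ℂ} {r : ι → ℝ} (h : RowBdd N r) (hr : Summable r) :
    Differentiable ℂ fun μ => detI (fun x y => μ * N x y) := by
  rw [← differentiableOn_univ]
  refine (tendstoLocallyUniformlyOn_detS_smul h hr).differentiableOn (Eventually.of_forall fun S => ?_) isOpen_univ
  exact differentiableOn_detS (fun x y => by fun_prop) S

/-- The Taylor coefficients of `μ ↦ det (1 - μ N)`. -/
def detCoeff (N : ι → ι → ℂ) (n : ℕ) : ℂ :=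
  iteratedDeriv n (fun μ => detI (fun x y => μ * N x y)) 0 / n.factorial

lemma tendsto_coeff_charpolyRev {N : ι → ι → ℂ} {r : ι → ℝ} (h : RowBdd N r) (hr : Summable r) (n : ℕ) :
    Tendsto (fun S : Finset ι => (Matrix.of fun i j : S => N i j).charpolyRev.coeff n) atTop
      (𝓝 (detCoeff N n)) := by
  have h1 := (tendstoLocallyUniformlyOn_iteratedDeriv isOpen_univ (tendstoLocallyUniformlyOn_detS_smul h hr)
    (fun S => differentiableOn_detS (fun x y => by fun_prop) S) n).1.tendsto_at (Set.mem_univ 0)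
  have h2 := h1.div_const (n.factorial : ℂ)
  refine h2.congr fun S => ?_
  simp only [detS_smul_eq]
  rw [iteratedDeriv_polynomial_zero]
  field_simp [Nat.factorial_ne_zero]

lemma detCoeff_zero {N : ι → ι → ℂ} {r : ι → ℝ} (h : RowBdd N r) (hr : Summable r) :
    detCoeff N 0 = 1 := by
  refine tendsto_nhds_unique (tendsto_coeff_charpolyRev h hr 0) ?_
  simp only [Polynomial.coeff_zero_eq_eval_zero, Matrix.eval_charpolyRev]
  exact tendsto_const_nhds

lemma detCoeff_newton {N : ι → ι → ℂ} {r : ι → ℝ} (h : RowBdd N r) (hr : Summable r) {R : ℝ}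
    (hR : ∀ x, r x ≤ R) (k : ℕ) :
    ((k : ℂ) + 1) * detCoeff N (k + 1) =
      -∑ p ∈ Finset.HasAntidiagonal.antidiagonal k, infTr N p.1 * detCoeff N p.2 := by
  refine tendsto_nhds_unique ((tendsto_coeff_charpolyRev h hr (k + 1)).const_mul _) ?_
  have := (tendsto_finsetSum (Finset.HasAntidiagonal.antidiagonal k) fun p _ =>
    (tendsto_infTr_truncMat h hr hR p.1).mul (tendsto_coeff_charpolyRev h hr p.2)).neg
  refine this.congr fun S => ?_
  rw [newton_charpolyRev]
  simp only [infTr_truncMat]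

end InfiniteNewton

section InfiniteKernel

open Filter Topology

variable {ι : Type*} [DecidableEq ι]

lemma sum_norm_one_sub_le {N : ι → ι → ℂ} {r : ι → ℝ} (h : RowBdd N r) (S : Finset ι) (i : S) :
    ∑ j, ‖(1 - Matrix.of (fun i j : S => N i j)) i j‖ ≤ 1 + r i := by
  have h1 : ∑ j : S, ‖(1 - Matrix.of (fun i j : S => N i j)) i j‖ ≤ ∑ j : S, (‖(1 : Matrix S S ℂ) i j‖ + ‖N i j‖) :=
    Finset.sum_le_sum fun j _ => by simpa using norm_sub_le _ _
  have h2 : ∑ j : S, ‖(1 : Matrix S S ℂ) i j‖ = 1 := by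
    rw [Finset.sum_eq_single i]
    · simp
    · intro j _ hj; simp [Matrix.one_apply_ne hj.symm]
    · simp
  have h3 := h i S
  rw [← Finset.sum_coe_sort] at h3
  rw [Finset.sum_add_distrib, h2] at h1
  linarith

lemma norm_adjugate_le {N : ι → ι → ℂ} {r : ι → ℝ} (h : RowBdd N r) (hr : Summable r) (S : Finset ι)
    (w x : S) : ‖(1 - Matrix.of (fun i j : S => N i j)).adjugate w x‖ ≤ ∏' x, (1 + r x) := by
  rw [Matrix.adjugate_apply]
  refine (norm_det_le_prod_row_sum _).trans (le_trans ?_ (h.prod_le hr S))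
  rw [← Finset.prod_coe_sort S]
  refine Finset.prod_le_prod (fun _ _ => by positivity) fun i _ => ?_
  by_cases hi : i = x
  · subst hi
    simp only [Matrix.updateRow_self]
    rw [Finset.sum_eq_single w]
    · simpa using h.nonneg i
    · intro j _ hj; simp [hj]
    · simp
  · simp only [Matrix.updateRow_ne hi]
    exact sum_norm_one_sub_le h S i

lemma detI_eq_zero_of_fixed {N : ι → ι → ℂ} {r : ι → ℝ} (h : RowBdd N r) (hr : Summable r)
    {c : ι → ℂ} {C : ℝ} (hC : ∀ x, ‖c x‖ ≤ C) (hc : ∀ x, HasSum (fun y => N x y * c y) (c x))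
    {w : ι} (hw : c w ≠ 0) : detI N = 0 := by
  have hC0 : 0 ≤ C := (norm_nonneg _).trans (hC w)
  set Q := ∏' x, (1 + r x) with hQ
  have hb : ∀ (S : Finset ι) x, ‖c x - ∑ y ∈ S, N x y * c y‖ ≤ 2 * C * r x := by
    intro S x
    have h1 : ‖∑ y ∈ S, N x y * c y‖ ≤ C * r x := by
      refine (norm_sum_le _ _).trans ?_
      calc ∑ y ∈ S, ‖N x y * c y‖ ≤ ∑ y ∈ S, C * ‖N x y‖ :=
            Finset.sum_le_sum fun y _ => by
              rw [norm_mul, mul_comm]; exact mul_le_mul_of_nonneg_right (hC y) (norm_nonneg _)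
        _ ≤ C * r x := by rw [← Finset.mul_sum]; exact mul_le_mul_of_nonneg_left (h x S) hC0
    have h2 : ‖c x‖ ≤ C * r x := by
      rw [← (hc x).tsum_eq]
      refine (tsum_of_norm_bounded ((h.summable x).mul_left C).hasSum fun y => ?_).trans ?_
      · rw [norm_mul, mul_comm]; exact mul_le_mul_of_nonneg_right (hC y) (norm_nonneg _)
      · rw [tsum_mul_left]; exact mul_le_mul_of_nonneg_left (h.tsum_le x) hC0
    have := norm_sub_le (c x) (∑ y ∈ S, N x y * c y)
    linarith
  have h0 : Tendsto (fun S : Finset ι => ∑' x, ‖c x - ∑ y ∈ S, N x y * c y‖) atTop (𝓝 (∑' _ : ι, (0 : ℝ))) := by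
    refine tendsto_tsum_of_dominated_convergence (hr.mul_left (2 * C)) (fun x => ?_)
      (Eventually.of_forall fun S x => by rw [norm_norm]; exact hb S x)
    have := ((hc x).const_sub (c x)).norm
    simpa using this
  rw [tsum_zero] at h0
  have h1 : ∀ᶠ S : Finset ι in atTop, ‖detS N S * c w‖ ≤ Q * ∑' x, ‖c x - ∑ y ∈ S, N x y * c y‖ := by
    filter_upwards [eventually_ge_atTop {w}] with S hS
    have hwS : w ∈ S := hS (by simp)
    set M := (1 - Matrix.of (fun i j : S => N i j)) with hM
    have e1 : M.adjugate.mulVec (M.mulVec fun i : S => c i) = M.det • fun i : S => c i := by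
      rw [Matrix.mulVec_mulVec, Matrix.adjugate_mul, Matrix.smul_mulVec, Matrix.one_mulVec]
    have e2 : ∀ i : S, M.mulVec (fun i : S => c i) i = c i - ∑ y ∈ S, N i y * c y := by
      intro i
      rw [hM, Matrix.sub_mulVec, Matrix.one_mulVec, Pi.sub_apply, ← Finset.sum_coe_sort]
      rfl
    have e3 := congrFun e1 ⟨w, hwS⟩
    have e4 : detS N S * c w = ∑ i : S, M.adjugate ⟨w, hwS⟩ i * (c i - ∑ y ∈ S, N i y * c y) := by
      rw [Pi.smul_apply, smul_eq_mul] at e3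
      rw [show detS N S = M.det from rfl, ← e3, Matrix.mulVec, dotProduct]
      exact Finset.sum_congr rfl fun i _ => by rw [e2]
    have hs : Summable fun x => ‖c x - ∑ y ∈ S, N x y * c y‖ :=
      Summable.of_nonneg_of_le (fun _ => norm_nonneg _) (hb S) (hr.mul_left (2 * C))
    rw [e4]
    refine (norm_sum_le _ _).trans ?_
    calc ∑ i : S, ‖M.adjugate ⟨w, hwS⟩ i * (c i - ∑ y ∈ S, N i y * c y)‖
        ≤ ∑ i : S, Q * ‖c i - ∑ y ∈ S, N i y * c y‖ := Finset.sum_le_sum fun i _ => by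
          rw [norm_mul]
          exact mul_le_mul_of_nonneg_right (norm_adjugate_le h hr S _ _) (norm_nonneg _)
      _ = Q * ∑ x ∈ S, ‖c x - ∑ y ∈ S, N x y * c y‖ := by
          rw [← Finset.mul_sum, ← Finset.sum_coe_sort S]
      _ ≤ _ := mul_le_mul_of_nonneg_left (hs.sum_le_tsum _ fun _ _ => norm_nonneg _)
          ((norm_nonneg _).trans (norm_detI_le h hr))
  have h2 : Tendsto (fun S : Finset ι => detS N S * c w) atTop (𝓝 0) := by
    refine squeeze_zero_norm' h1 ?_
    simpa using h0.const_mul Q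
  have h3 := tendsto_nhds_unique ((tendsto_detS h hr).mul_const (c w)) h2
  exact (mul_eq_zero.1 h3).resolve_right hw

lemma exists_norm_eq_one_mul (z : ℂ) : ∃ s : ℂ, ‖s‖ ≤ 1 ∧ z * s = ‖z‖ := by
  by_cases hz : z = 0
  · exact ⟨0, by simp, by simp [hz]⟩
  · have hz' : (‖z‖ : ℂ) ≠ 0 := by simpa using hz
    refine ⟨(starRingEnd ℂ) z / ‖z‖, ?_, ?_⟩
    · simp [hz]
    · rw [mul_div_assoc', Complex.mul_conj']
      field_simp

lemma one_le_norm_detS_mul {N : ι → ι → ℂ} {r : ι → ℝ} (h : RowBdd N r) (hr : Summable r) (S : Finset ι)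
    {M : ℝ} (hM : 0 < M)
    (hS : ∀ v : S → ℂ, ‖v‖ ≤ M * ‖(1 - Matrix.of (fun i j : S => N i j)).mulVec v‖) :
    1 ≤ ‖detS N S‖ * ∏' x, (1 + M * r x) := by
  set T := Matrix.of (fun i j : S => N i j) with hT
  set A := 1 - T with hA
  have hdet : A.det ≠ 0 := by
    intro h0
    obtain ⟨v, hv, hv0⟩ := Matrix.exists_mulVec_eq_zero_iff.2 h0
    have := hS v
    rw [hv0, norm_zero, mul_zero] at this
    exact hv (norm_le_zero_iff.1 this)
  have hu : IsUnit A.det := isUnit_iff_ne_zero.2 hdet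
  set X := A⁻¹ with hX
  have hAX : A * X = 1 := Matrix.mul_nonsing_inv _ hu
  have hXeq : X = 1 + T * X := by
    rw [← hAX, hA, sub_mul, one_mul]; abel
  have hrow : ∀ y, ∑ z, ‖X y z‖ ≤ M := by
    intro y
    choose s hs1 hs2 using fun z => exists_norm_eq_one_mul (X y z)
    have e1 : (X.mulVec s) y = ((∑ z, ‖X y z‖ : ℝ) : ℂ) := by
      rw [Matrix.mulVec, dotProduct]
      push_cast
      exact Finset.sum_congr rfl fun z _ => hs2 z
    have e2 := hS (X.mulVec s)
    rw [Matrix.mulVec_mulVec, hAX, Matrix.one_mulVec] at e2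
    have e3 : ‖s‖ ≤ 1 := (pi_norm_le_iff_of_nonneg zero_le_one).2 hs1
    have e4 := norm_le_pi_norm (X.mulVec s) y
    rw [e1, Complex.norm_real, Real.norm_of_nonneg (Finset.sum_nonneg fun _ _ => norm_nonneg _)] at e4
    nlinarith
  have hXdet : ‖X.det‖ ≤ ∏' x, (1 + M * r x) := by
    have hb : RowBdd (fun x y => (M : ℂ) * N x y) (fun x => M * r x) := by
      have := h.smul (M : ℂ)
      simpa [abs_of_pos hM] using this
    refine (norm_det_le_prod_row_sum _).trans (le_trans ?_ (hb.prod_le (hr.mul_left M) S))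
    rw [← Finset.prod_coe_sort S]
    refine Finset.prod_le_prod (fun _ _ => by positivity) fun i _ => ?_
    have e1 : ∀ j, ‖X i j‖ ≤ ‖(1 : Matrix S S ℂ) i j‖ + ∑ k, ‖T i k‖ * ‖X k j‖ := by
      intro j
      conv_lhs => rw [hXeq]
      rw [Matrix.add_apply, Matrix.mul_apply]
      refine (norm_add_le _ _).trans (add_le_add_right ?_ _)
      exact (norm_sum_le _ _).trans (Finset.sum_le_sum fun _ _ => norm_mul_le _ _)
    refine (Finset.sum_le_sum fun j _ => e1 j).trans ?_
    rw [Finset.sum_add_distrib, Finset.sum_comm]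
    have h2 : ∑ j : S, ‖(1 : Matrix S S ℂ) i j‖ = 1 := by
      rw [Finset.sum_eq_single i]
      · simp
      · intro j _ hj; simp [Matrix.one_apply_ne hj.symm]
      · simp
    have h3 := h i S
    rw [← Finset.sum_coe_sort] at h3
    simp only [← Finset.mul_sum]
    rw [h2]
    have h4 : ∑ k, ‖T i k‖ * ∑ j, ‖X k j‖ ≤ ∑ k : S, ‖N i k‖ * M :=
      Finset.sum_le_sum fun k _ => mul_le_mul_of_nonneg_left (hrow k) (norm_nonneg _)
    rw [← Finset.sum_mul] at h4
    nlinarith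
  have hd : ‖A.det‖ * ‖X.det‖ = 1 := by
    rw [← norm_mul, ← Matrix.det_mul, hAX, Matrix.det_one, norm_one]
  refine hd.symm.le.trans ?_
  exact mul_le_mul_of_nonneg_left hXdet (norm_nonneg _)

lemma exists_fixed_of_detI_eq_zero {N : ι → ι → ℂ} {r : ι → ℝ} (h : RowBdd N r) (hr : Summable r)
    (h0 : detI N = 0) :
    ∃ c : ι → ℂ, (∃ w, c w ≠ 0) ∧ (∀ x, ‖c x‖ ≤ 1) ∧ ∀ x, HasSum (fun y => N x y * c y) (c x) := by
  have hW : {x | 1 / 2 ≤ r x}.Finite := by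
    have := hr.tendsto_cofinite_zero.eventually (gt_mem_nhds (show (0 : ℝ) < 1 / 2 by norm_num))
    rw [Filter.eventually_cofinite] at this
    simpa using this
  have key : ∀ p : Finset ι × ℕ, ∃ (S : Finset ι) (f : ι → ℂ), p.1 ⊆ S ∧ (∀ x ∉ S, f x = 0) ∧ (∀ x, ‖f x‖ ≤ 1) ∧
      (∃ w ∈ {x | 1 / 2 ≤ r x}, ‖f w‖ = 1) ∧ ∀ x ∈ S, ‖f x - ∑' y, N x y * f y‖ ≤ 1 / ((p.2 : ℝ) + 2) := by
    rintro ⟨T, n⟩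
    have hM : (0 : ℝ) < (n : ℝ) + 2 := by positivity
    have h1 : Tendsto (fun S => ‖detS N S‖ * ∏' x, (1 + ((n : ℝ) + 2) * r x)) atTop (𝓝 0) := by
      have := (tendsto_detS h hr).norm.mul_const (∏' x, (1 + ((n : ℝ) + 2) * r x))
      simpa [h0] using this
    obtain ⟨S, hS1, hST⟩ := ((h1.eventually (gt_mem_nhds one_pos)).and (eventually_ge_atTop T)).exists
    have h2 : ¬ ∀ v : S → ℂ, ‖v‖ ≤ ((n : ℝ) + 2) * ‖(1 - Matrix.of (fun i j : S => N i j)).mulVec v‖ :=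
      fun hv => absurd (one_le_norm_detS_mul h hr S hM hv) (not_le.2 hS1)
    push Not at h2
    obtain ⟨v, hv⟩ := h2
    have hvpos : 0 < ‖v‖ := lt_of_le_of_lt (by positivity) hv
    set f : ι → ℂ := fun x => if hx : x ∈ S then v ⟨x, hx⟩ / ‖v‖ else 0 with hf
    have hfS : ∀ i : S, f i = v i / ‖v‖ := fun i => by simp [hf]
    have hf0 : ∀ x ∉ S, f x = 0 := fun x hx => by simp [hf, hx]
    have hf1 : ∀ x, ‖f x‖ ≤ 1 := by
      intro x
      by_cases hx : x ∈ S
      · rw [hfS ⟨x, hx⟩, norm_div, Complex.norm_real, norm_norm, div_le_one hvpos]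
        exact norm_le_pi_norm v _
      · simp [hf0 x hx]
    have hsum : ∀ x, ∑' y, N x y * f y = ∑ y ∈ S, N x y * f y := fun x =>
      tsum_eq_sum fun y hy => by rw [hf0 y hy, mul_zero]
    have hres : ∀ x ∈ S, ‖f x - ∑' y, N x y * f y‖ ≤ 1 / ((n : ℝ) + 2) := by
      intro x hx
      have e1 : f x - ∑' y, N x y * f y =
          ((1 - Matrix.of (fun i j : S => N i j)).mulVec v ⟨x, hx⟩) / ‖v‖ := by
        rw [hsum, Matrix.sub_mulVec, Matrix.one_mulVec, Pi.sub_apply, sub_div, ← Finset.sum_coe_sort,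
          hfS ⟨x, hx⟩, Matrix.mulVec, dotProduct, Finset.sum_div]
        congr 1
        refine Finset.sum_congr rfl fun i _ => ?_
        rw [hfS, Matrix.of_apply, mul_div_assoc]
      rw [e1, norm_div, Complex.norm_real, norm_norm, div_le_div_iff₀ hvpos hM]
      have := norm_le_pi_norm ((1 - Matrix.of (fun i j : S => N i j)).mulVec v) ⟨x, hx⟩
      nlinarith
    refine ⟨S, f, hST, hf0, hf1, ?_, hres⟩
    have hne : Nonempty S := by
      by_contra hemp
      rw [not_nonempty_iff] at hemp
      have : v = 0 := Subsingleton.elim _ _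
      rw [this, norm_zero] at hvpos
      exact lt_irrefl _ hvpos
    obtain ⟨w, hw⟩ := Finite.exists_max (fun i : S => ‖v i‖)
    have hwv : ‖v w‖ = ‖v‖ := le_antisymm (norm_le_pi_norm v w)
      ((pi_norm_le_iff_of_nonneg (norm_nonneg _)).2 hw)
    have hfw : ‖f w‖ = 1 := by
      rw [hfS, norm_div, hwv, Complex.norm_real, norm_norm, div_self hvpos.ne']
    refine ⟨w, ?_, hfw⟩
    have h3 : ‖∑' y, N w y * f y‖ ≤ r w := by
      rw [hsum]
      refine (norm_sum_le _ _).trans (le_trans (Finset.sum_le_sum fun y _ => ?_) (h w S))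
      rw [norm_mul]
      exact mul_le_of_le_one_right (norm_nonneg _) (hf1 y)
    have h4 := hres w w.2
    have h5 := norm_sub_norm_le (f w) (∑' y, N w y * f y)
    have h6 : 1 / ((n : ℝ) + 2) ≤ 1 / 2 := by
      apply one_div_le_one_div_of_le <;> linarith [Nat.cast_nonneg (α := ℝ) n]
    show 1 / 2 ≤ r w
    linarith
  choose S f hTS hf0 hf1 hfw hres using key
  let U : Ultrafilter (Finset ι × ℕ) := Ultrafilter.of atTop
  have hU : (U : Filter (Finset ι × ℕ)) ≤ atTop := Ultrafilter.of_le _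
  have hK : IsCompact (Set.pi Set.univ fun _ : ι => Metric.closedBall (0 : ℂ) 1) :=
    isCompact_univ_pi fun _ => isCompact_closedBall _ _
  obtain ⟨c, hcK, hc⟩ := hK.ultrafilter_le_nhds (U.map f) (by
    rw [Filter.le_principal_iff]
    refine Filter.mem_map.2 (Filter.univ_mem' fun p => ?_)
    simp only [Set.mem_preimage, Set.mem_pi, Metric.mem_closedBall, dist_zero_right]
    exact fun x _ => hf1 p x)
  have hc' : ∀ x, Tendsto (fun p => f p x) U (𝓝 (c x)) := tendsto_pi_nhds.1 hc
  have hc1 : ∀ x, ‖c x‖ ≤ 1 := fun x => by simpa using hcK x (Set.mem_univ x)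
  have hsm : ∀ x, Summable fun y => N x y * c y := fun x =>
    Summable.of_norm_bounded (h.summable x) fun y => by
      rw [norm_mul]; exact mul_le_of_le_one_right (norm_nonneg _) (hc1 y)
  refine ⟨c, ?_, hc1, fun x => ?_⟩
  · by_contra! hcon
    have h1 : ∀ᶠ p in (U : Filter _), ∀ w ∈ {x | 1 / 2 ≤ r x}, ‖f p w‖ < 1 := by
      rw [hW.eventually_all]
      intro w _
      have := (hc' w).norm
      rw [hcon w, norm_zero] at this
      exact this.eventually (gt_mem_nhds one_pos)
    obtain ⟨p, hp⟩ := h1.exists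
    obtain ⟨w, hw, hw1⟩ := hfw p
    exact absurd (hp w hw) (by rw [hw1]; exact lt_irrefl _)
  · have h1 : Tendsto (fun p => f p x - ∑' y, N x y * f p y) U (𝓝 (c x - ∑' y, N x y * c y)) := by
      refine (hc' x).sub (tendsto_tsum_of_dominated_convergence (h.summable x)
        (fun y => (hc' y).const_mul _) (Eventually.of_forall fun p y => ?_))
      rw [norm_mul]; exact mul_le_of_le_one_right (norm_nonneg _) (hf1 p y)
    have h2 : Tendsto (fun p : Finset ι × ℕ => 1 / ((p.2 : ℝ) + 2)) U (𝓝 0) := by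
      have h3 : Tendsto (fun p : Finset ι × ℕ => p.2) U atTop :=
        (show Tendsto (Prod.snd : Finset ι × ℕ → ℕ) atTop atTop by
          rw [← prod_atTop_atTop_eq]; exact tendsto_snd).mono_left hU
      have h4 : Tendsto (fun n : ℕ => 1 / ((n : ℝ) + 2)) atTop (𝓝 0) := by
        have := tendsto_one_div_add_atTop_nhds_zero_nat (𝕜 := ℝ)
        have h5 := this.comp (tendsto_add_atTop_nat 1)
        refine h5.congr fun n => ?_
        simp only [Function.comp]; push_cast; ring
      exact h4.comp h3
    have h3 : Tendsto (fun p => f p x - ∑' y, N x y * f p y) U (𝓝 0) := by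
      refine squeeze_zero_norm' ?_ h2
      filter_upwards [hU (eventually_ge_atTop (({x} : Finset ι), 0))] with p hp
      exact hres p x (hTS p (hp.1 (by simp)))
    have h4 := tendsto_nhds_unique h1 h3
    have := (hsm x).hasSum
    rwa [← sub_eq_zero.1 h4] at this

end InfiniteKernel

section DeterminantGrowth

open Filter Topology

lemma one_add_le_exp_rpow {t : ℝ} (ht : 0 ≤ t) :
    1 + t ≤ Real.exp (4 / 3 * t ^ (3 / 4 : ℝ)) := by
  have h1 : (1 : ℝ) ^ (4 / 3 : ℝ) + (t ^ (3 / 4 : ℝ)) ^ (4 / 3 : ℝ) ≤ (1 + t ^ (3 / 4 : ℝ)) ^ (4 / 3 : ℝ) :=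
    Real.add_rpow_le_rpow_add zero_le_one (by positivity) (by norm_num)
  rw [Real.one_rpow, ← Real.rpow_mul ht] at h1
  norm_num at h1
  refine h1.trans ?_
  rw [mul_comm, Real.exp_mul]
  refine Real.rpow_le_rpow (by positivity) ?_ (by norm_num)
  rw [add_comm]; exact Real.add_one_le_exp _

variable {ι : Type*} [DecidableEq ι]

lemma exists_growth_detI_smul {N : ι → ι → ℂ} {r : ι → ℝ} (h : RowBdd N r) (hr : Summable r)
    (hr' : Summable fun x => r x ^ (3 / 4 : ℝ)) :
    ∃ B : ℝ, 0 ≤ B ∧ ∀ μ : ℂ, ‖detI (fun x y => μ * N x y)‖ ≤ 1 * Real.exp (B * ‖μ‖ ^ (3 / 4 : ℝ)) := by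
  refine ⟨4 / 3 * ∑' x, r x ^ (3 / 4 : ℝ), ?_, fun μ => ?_⟩
  · exact mul_nonneg (by norm_num) (tsum_nonneg fun x => Real.rpow_nonneg (h.nonneg x) _)
  · refine le_of_tendsto (tendsto_detS (h.smul μ) (hr.mul_left ‖μ‖)).norm (Eventually.of_forall fun S => ?_)
    refine (norm_detS_le (h.smul μ) S).trans ?_
    calc ∏ x ∈ S, (1 + ‖μ‖ * r x) ≤ ∏ x ∈ S, Real.exp (4 / 3 * (‖μ‖ * r x) ^ (3 / 4 : ℝ)) :=
          Finset.prod_le_prod (fun x _ => by have := h.nonneg x; positivity)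
            fun x _ => one_add_le_exp_rpow (by have := h.nonneg x; positivity)
      _ = Real.exp (∑ x ∈ S, 4 / 3 * (‖μ‖ * r x) ^ (3 / 4 : ℝ)) := (Real.exp_sum _ _).symm
      _ ≤ 1 * Real.exp (4 / 3 * (∑' x, r x ^ (3 / 4 : ℝ)) * ‖μ‖ ^ (3 / 4 : ℝ)) := by
          rw [one_mul]
          refine Real.exp_le_exp.2 ?_
          have h1 : ∀ x ∈ S, 4 / 3 * (‖μ‖ * r x) ^ (3 / 4 : ℝ) = 4 / 3 * ‖μ‖ ^ (3 / 4 : ℝ) * r x ^ (3 / 4 : ℝ) := by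
            intro x _
            rw [Real.mul_rpow (norm_nonneg _) (h.nonneg x)]; ring
          rw [Finset.sum_congr rfl h1, ← Finset.mul_sum]
          have h2 := hr'.sum_le_tsum S fun x _ => Real.rpow_nonneg (h.nonneg x) _
          have h3 : 0 ≤ 4 / 3 * ‖μ‖ ^ (3 / 4 : ℝ) := by positivity
          nlinarith

/-- If the traces of powers of `N` are of the form `π q + c` with `q`, `c` algebraic and the Fredholm
determinant has finitely many zeros, then all the coefficients `q` vanish. -/
lemma pi_part_eq_zero_of_finite_zeros {N : ι → ι → ℂ} {r : ι → ℝ} (h : RowBdd N r) (hr : Summable r)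
    (hr' : Summable fun x => r x ^ (3 / 4 : ℝ)) {R : ℝ} (hR : ∀ x, r x ≤ R)
    {q c : ℕ → ℂ} (hq : ∀ n, IsAlgebraic ℚ (q n)) (hc : ∀ n, IsAlgebraic ℚ (c n))
    (hτ : ∀ n, infTr N n = Real.pi * q n + c n)
    (hfin : {μ : ℂ | detI (fun x y => μ * N x y) = 0}.Finite) (n : ℕ) : q n = 0 := by
  obtain ⟨B, hB, hgr⟩ := exists_growth_detI_smul h hr hr'
  obtain ⟨P, hP⟩ := exists_polynomial_of_growth _ (differentiable_detI_smul h hr) hfin 1 B one_pos hB hgr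
  have hE : ∀ n, detCoeff N n = P.coeff n := by
    intro n
    rw [detCoeff, funext hP, iteratedDeriv_polynomial_zero]
    field_simp [Nat.factorial_ne_zero]
  have := eq_zero_of_pi_expRec_vanish (fun n => q (n - 1)) (fun n => c (n - 1)) (detCoeff N)
    (fun n => hq _) (fun n => hc _) (detCoeff_zero h hr) (fun n => by
      rw [detCoeff_newton h hr hR]
      simp only [hτ, Nat.add_sub_cancel]) P.natDegree
    (fun n hn => by rw [hE]; exact Polynomial.coeff_eq_zero_of_natDegree_lt hn) n
  simpa using this

/-- If all traces of powers of `N` vanish then the Fredholm determinant is identically one. -/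
lemma detI_smul_eq_one_of_infTr_eq_zero {N : ι → ι → ℂ} {r : ι → ℝ} (h : RowBdd N r) (hr : Summable r)
    {R : ℝ} (hR : ∀ x, r x ≤ R) (hτ : ∀ n, infTr N n = 0) (μ : ℂ) :
    detI (fun x y => μ * N x y) = 1 := by
  have h0 : ∀ n, detCoeff N (n + 1) = 0 := by
    intro n
    have := detCoeff_newton h hr hR n
    simp only [hτ, zero_mul, Finset.sum_const_zero, neg_zero] at this
    exact (mul_eq_zero.1 this).resolve_left (by exact_mod_cast Nat.succ_ne_zero n)
  have h1 := Complex.hasSum_taylorSeries_of_entire (differentiable_detI_smul h hr) 0 μ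
  refine h1.unique ?_
  have h2 : ∀ n, (n.factorial : ℂ)⁻¹ • (μ - 0) ^ n • iteratedDeriv n (fun μ => detI (fun x y => μ * N x y)) 0 =
      if n = 0 then 1 else 0 := by
    intro n
    have e : (n.factorial : ℂ)⁻¹ • (μ - 0) ^ n • iteratedDeriv n (fun μ => detI (fun x y => μ * N x y)) 0 =
        μ ^ n * detCoeff N n := by
      simp only [smul_eq_mul, detCoeff, sub_zero]; ring
    rw [e]
    cases n with
    | zero => simp [detCoeff_zero h hr]
    | succ n => simp [h0 n]
  rw [funext h2]
  exact hasSum_ite_eq 0 1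

end DeterminantGrowth

section LatticeIndex

lemma omega_eq : ω = -1 / 2 + (Real.sqrt 3 / 2 : ℝ) * I := by
  have h : (2 * Real.pi * I / 3 : ℂ) = ((2 * Real.pi / 3 : ℝ) : ℂ) * I := by push_cast; ring
  have h2 : (2 * Real.pi / 3 : ℝ) = Real.pi - Real.pi / 3 := by ring
  rw [ω, h, Complex.exp_mul_I, ← Complex.ofReal_cos, ← Complex.ofReal_sin, h2, Real.cos_pi_sub, Real.sin_pi_sub,
    Real.cos_pi_div_three, Real.sin_pi_div_three]
  push_cast
  ring

lemma omega_re : ω.re = -1 / 2 := by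
  rw [omega_eq]; simp

lemma omega_im : ω.im = Real.sqrt 3 / 2 := by
  rw [omega_eq]; simp

lemma omega_sq : ω ^ 2 = -1 - ω := by
  have h3 : (Real.sqrt 3) ^ 2 = 3 := Real.sq_sqrt (by norm_num)
  apply Complex.ext
  · simp [pow_two, omega_re, omega_im]; nlinarith
  · simp [pow_two, omega_re, omega_im]; ring

lemma omega_cube : ω ^ 3 = 1 := by
  have := omega_sq
  linear_combination (ω - 1) * this

lemma omega_ne_zero : ω ≠ 0 := Complex.exp_ne_zero _

lemma omega_ne_one : ω ≠ 1 := by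
  intro h
  have := congrArg Complex.re h
  rw [omega_re] at this; norm_num at this

lemma norm_omega : ‖ω‖ = 1 := by
  have h := congrArg norm omega_cube
  rw [norm_pow, norm_one] at h
  exact (pow_eq_one_iff_of_nonneg (norm_nonneg _) (by norm_num)).1 h

lemma isAlgebraic_omega : IsAlgebraic ℚ ω := by
  refine ⟨Polynomial.X ^ 3 - 1, ?_, ?_⟩
  · exact (Polynomial.monic_X_pow_sub_C (1 : ℚ) (by norm_num)).ne_zero
  · simp [omega_cube]

/-- The lattice point with coordinates `x`. -/
def lpt (x : ℤ × ℤ) : ℂ := x.1 * ω + x.2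

/-- The residue class of a lattice point modulo `√-3`. -/
def cls (x : ℤ × ℤ) : ZMod 3 := ((x.1 + x.2 : ℤ) : ZMod 3)

/-- Rotation by `2π/3` in coordinates. -/
def rot (x : ℤ × ℤ) : ℤ × ℤ := (x.2 - x.1, -x.1)

lemma lpt_add (x y : ℤ × ℤ) : lpt (x + y) = lpt x + lpt y := by
  simp [lpt]; ring

lemma lpt_sub (x y : ℤ × ℤ) : lpt (x - y) = lpt x - lpt y := by
  simp [lpt]; ring

lemma lpt_neg (x : ℤ × ℤ) : lpt (-x) = -lpt x := by
  simp [lpt]; ring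

@[simp] lemma lpt_zero : lpt 0 = 0 := by simp [lpt]

lemma lpt_rot (x : ℤ × ℤ) : lpt (rot x) = ω * lpt x := by
  have := omega_sq
  simp only [lpt, rot]
  push_cast
  linear_combination -(x.1 : ℂ) * this

lemma cls_add (x y : ℤ × ℤ) : cls (x + y) = cls x + cls y := by
  simp [cls]; ring

lemma cls_sub (x y : ℤ × ℤ) : cls (x - y) = cls x - cls y := by
  simp [cls]; ring

lemma cls_neg (x : ℤ × ℤ) : cls (-x) = -cls x := by
  simp [cls]; ring

lemma cls_rot (x : ℤ × ℤ) : cls (rot x) = cls x := by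
  simp only [cls, rot]
  push_cast
  have h : (3 : ZMod 3) = 0 := by decide
  linear_combination -(x.1 : ZMod 3) * h

lemma rot_sub (x y : ℤ × ℤ) : rot (x - y) = rot x - rot y := by
  ext <;> simp only [rot, Prod.fst_sub, Prod.snd_sub] <;> ring

lemma rot_rot_rot (x : ℤ × ℤ) : rot (rot (rot x)) = x := by
  ext <;> simp only [rot] <;> ring

@[simp] lemma rot_zero : rot 0 = 0 := by simp [rot]

/-- Rotation as a permutation of the lattice. -/
def rotEquiv : Equiv.Perm (ℤ × ℤ) where
  toFun := rot
  invFun x := rot (rot x)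
  left_inv := rot_rot_rot
  right_inv := rot_rot_rot

lemma normSq_lpt (x : ℤ × ℤ) : ‖lpt x‖ ^ 2 = (x.1 : ℝ) ^ 2 - x.1 * x.2 + (x.2 : ℝ) ^ 2 := by
  have h3 : (Real.sqrt 3) ^ 2 = 3 := Real.sq_sqrt (by norm_num)
  rw [← Complex.normSq_eq_norm_sq, Complex.normSq_apply]
  simp [lpt, omega_re, omega_im]
  linear_combination (x.1 : ℝ) ^ 2 / 4 * h3

lemma sq_fst_le_normSq_lpt (x : ℤ × ℤ) : 3 / 4 * (x.1 : ℝ) ^ 2 ≤ ‖lpt x‖ ^ 2 := by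
  rw [normSq_lpt]; nlinarith [sq_nonneg ((x.1 : ℝ) - 2 * x.2)]

lemma sq_snd_le_normSq_lpt (x : ℤ × ℤ) : 3 / 4 * (x.2 : ℝ) ^ 2 ≤ ‖lpt x‖ ^ 2 := by
  rw [normSq_lpt]; nlinarith [sq_nonneg ((x.2 : ℝ) - 2 * x.1)]

lemma one_le_norm_lpt {x : ℤ × ℤ} (hx : x ≠ 0) : 1 ≤ ‖lpt x‖ := by
  have h1 : 1 ≤ x.1 ^ 2 - x.1 * x.2 + x.2 ^ 2 := by
    by_contra! h
    have h0 : 4 * (x.1 ^ 2 - x.1 * x.2 + x.2 ^ 2) = (2 * x.1 - x.2) ^ 2 + 3 * x.2 ^ 2 := by ring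
    have h2 : x.2 = 0 := by
      by_contra h2
      have : 1 ≤ x.2 ^ 2 := by have := sq_pos_of_ne_zero h2; omega
      nlinarith [sq_nonneg (2 * x.1 - x.2)]
    have h3 : x.1 = 0 := by
      by_contra h3
      have : 1 ≤ x.1 ^ 2 := by have := sq_pos_of_ne_zero h3; omega
      rw [h2] at h; nlinarith
    exact hx (Prod.ext h3 h2)
  have h2 : (1 : ℝ) ≤ ‖lpt x‖ ^ 2 := by
    rw [normSq_lpt]; exact_mod_cast h1
  nlinarith [norm_nonneg (lpt x)]

lemma lpt_eq_zero_iff {x : ℤ × ℤ} : lpt x = 0 ↔ x = 0 := by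
  refine ⟨fun h => ?_, fun h => by simp [h]⟩
  by_contra hx
  have := one_le_norm_lpt hx
  rw [h, norm_zero] at this; linarith

lemma lpt_injective : Function.Injective lpt := fun x y h => by
  have : lpt (x - y) = 0 := by rw [lpt_sub, h, sub_self]
  exact sub_eq_zero.1 (lpt_eq_zero_iff.1 this)

lemma norm_lpt_rot (x : ℤ × ℤ) : ‖lpt (rot x)‖ = ‖lpt x‖ := by
  rw [lpt_rot, norm_mul, norm_omega, one_mul]

lemma isAlgebraic_lpt (x : ℤ × ℤ) : IsAlgebraic ℚ (lpt x) :=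
  ((isAlgebraic_intCast x.1).mul isAlgebraic_omega).add (isAlgebraic_intCast x.2)

lemma ne_zero_of_cls {x : ℤ × ℤ} (h : cls x ≠ 0) : x ≠ 0 := by
  rintro rfl; exact h (by simp [cls])

lemma finite_norm_lpt_le (R : ℝ) : {x : ℤ × ℤ | ‖lpt x‖ ≤ R}.Finite := by
  obtain ⟨N, hN⟩ := exists_nat_gt (2 * R)
  refine ((Set.finite_Icc (-(N : ℤ)) N).prod (Set.finite_Icc (-(N : ℤ)) N)).subset fun x hx => ?_
  have hx' : ‖lpt x‖ ≤ R := hx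
  have hR : 0 ≤ R := (norm_nonneg _).trans hx'
  have h0 : ‖lpt x‖ ^ 2 ≤ R ^ 2 := pow_le_pow_left₀ (norm_nonneg _) hx' 2
  have h1 := sq_fst_le_normSq_lpt x
  have h2 := sq_snd_le_normSq_lpt x
  have a1 : |(x.1 : ℝ)| ≤ N := abs_le_of_sq_le_sq (by nlinarith) (by positivity)
  have a2 : |(x.2 : ℝ)| ≤ N := abs_le_of_sq_le_sq (by nlinarith) (by positivity)
  rw [abs_le] at a1 a2
  refine ⟨⟨?_, ?_⟩, ⟨?_, ?_⟩⟩ <;> [have := a1.1; have := a1.2; have := a2.1; have := a2.2] <;> exact_mod_cast this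

lemma summable_lpt_rpow {k : ℝ} (hk : 2 < k) : Summable fun x : ℤ × ℤ => (1 + ‖lpt x‖) ^ (-k) := by
  have h1 := EisensteinSeries.summable_one_div_norm_rpow hk
  have h2 := (finTwoArrowEquiv ℤ).symm.summable_iff.2 h1
  refine Summable.of_norm_bounded_eventually (h2.mul_left ((2 : ℝ) ^ k)) ?_
  have h0 : ∀ᶠ x : ℤ × ℤ in Filter.cofinite, x ≠ 0 := by
    simp [Filter.eventually_cofinite]
  filter_upwards [h0] with x hx
  have hl : 0 ≤ ‖lpt x‖ := norm_nonneg _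
  have h1 := sq_fst_le_normSq_lpt x
  have h2 := sq_snd_le_normSq_lpt x
  have hv : ‖(finTwoArrowEquiv ℤ).symm x‖ ≤ 2 * (1 + ‖lpt x‖) := by
    rw [pi_norm_le_iff_of_nonneg (by positivity)]
    intro i
    have a1 : |(x.1 : ℝ)| ≤ 2 * (1 + ‖lpt x‖) := abs_le_of_sq_le_sq (by nlinarith) (by positivity)
    have a2 : |(x.2 : ℝ)| ≤ 2 * (1 + ‖lpt x‖) := abs_le_of_sq_le_sq (by nlinarith) (by positivity)
    fin_cases i
    · simpa [finTwoArrowEquiv, Int.norm_eq_abs] using a1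
    · simpa [finTwoArrowEquiv, Int.norm_eq_abs] using a2
  have hv0 : 0 < ‖(finTwoArrowEquiv ℤ).symm x‖ := by
    rw [norm_pos_iff]
    intro h
    apply hx
    have := congrArg (finTwoArrowEquiv ℤ) h
    simpa [finTwoArrowEquiv, Prod.ext_iff] using this
  rw [Real.norm_of_nonneg (by positivity)]
  have h3 : (2 * (1 + ‖lpt x‖)) ^ (-k) ≤ ‖(finTwoArrowEquiv ℤ).symm x‖ ^ (-k) :=
    Real.rpow_le_rpow_of_nonpos hv0 hv (by linarith)
  rw [Real.mul_rpow (by norm_num) (by positivity)] at h3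
  have h4 : (2 : ℝ) ^ k * (2 : ℝ) ^ (-k) = 1 := by
    rw [← Real.rpow_add (by norm_num)]; simp
  calc (1 + ‖lpt x‖) ^ (-k) = 2 ^ k * (2 ^ (-k) * (1 + ‖lpt x‖) ^ (-k)) := by
        rw [← mul_assoc, h4, one_mul]
    _ ≤ _ := by
        apply mul_le_mul_of_nonneg_left h3 (by positivity)

end LatticeIndex

section LatticeOperator

variable (t : ℤ × ℤ →₀ ℂ) (w : ℤ × ℤ → ℂ)

/-- Convolution by `t` followed by multiplication by `w`. -/
def op : Module.End ℂ (ℤ × ℤ → ℂ) where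
  toFun f x := w x * ∑ d ∈ t.support, t d * f (x - d)
  map_add' f g := by
    ext x; simp only [Pi.add_apply, mul_add, Finset.sum_add_distrib]
  map_smul' c f := by
    ext x; simp only [Pi.smul_apply, smul_eq_mul, RingHom.id_apply, Finset.mul_sum]
    exact Finset.sum_congr rfl fun d _ => by ring

lemma op_apply (f : ℤ × ℤ → ℂ) (x : ℤ × ℤ) :
    op t w f x = w x * ∑ d ∈ t.support, t d * f (x - d) := rfl

lemma op_pow_succ_apply (m : ℕ) (f : ℤ × ℤ → ℂ) (x : ℤ × ℤ) :
    (op t w ^ (m + 1)) f x = w x * ∑ d ∈ t.support, t d * (op t w ^ m) f (x - d) := by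
  rw [pow_succ', Module.End.mul_apply, op_apply]

/-- Matrix entries of the powers of `op`. -/
def ent (m : ℕ) (x y : ℤ × ℤ) : ℂ := (op t w ^ m) (Pi.single y 1) x

lemma ent_zero (x y : ℤ × ℤ) : ent t w 0 x y = if x = y then 1 else 0 := by
  simp [ent, Pi.single_apply]

lemma ent_succ (m : ℕ) (x y : ℤ × ℤ) :
    ent t w (m + 1) x y = w x * ∑ d ∈ t.support, t d * ent t w m (x - d) y :=
  op_pow_succ_apply t w m _ x

/-- The `m`-fold sumset of the support of `t`. -/
def reach : ℕ → Finset (ℤ × ℤ)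
  | 0 => {0}
  | m + 1 => (t.support ×ˢ reach m).image fun q => q.1 + q.2

lemma add_mem_reach {m : ℕ} {d e : ℤ × ℤ} (hd : d ∈ t.support) (he : e ∈ reach t m) :
    d + e ∈ reach t (m + 1) :=
  Finset.mem_image.2 ⟨(d, e), Finset.mem_product.2 ⟨hd, he⟩, rfl⟩

lemma op_pow_congr (m : ℕ) (f g : ℤ × ℤ → ℂ) (x : ℤ × ℤ)
    (h : ∀ e ∈ reach t m, f (x - e) = g (x - e)) : (op t w ^ m) f x = (op t w ^ m) g x := by
  induction m generalizing x with
  | zero => simpa [reach] using h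
  | succ m ih =>
    rw [op_pow_succ_apply, op_pow_succ_apply]
    congr 1
    refine Finset.sum_congr rfl fun d hd => ?_
    rw [ih (x - d) fun e he => by
      rw [sub_sub]; exact h _ (add_mem_reach t hd he)]

lemma ent_eq_zero {m : ℕ} {x y : ℤ × ℤ} (h : x - y ∉ reach t m) : ent t w m x y = 0 := by
  have := op_pow_congr t w m (Pi.single y 1) 0 x fun e he => by
    rw [Pi.single_apply, if_neg, Pi.zero_apply]
    rintro rfl
    exact h (by simpa using he)
  rw [ent, this, map_zero, Pi.zero_apply]

lemma op_pow_apply_eq_sum (m : ℕ) (f : ℤ × ℤ → ℂ) (x : ℤ × ℤ) :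
    (op t w ^ m) f x = ∑ e ∈ reach t m, ent t w m x (x - e) * f (x - e) := by
  have := op_pow_congr t w m f (∑ e ∈ reach t m, f (x - e) • Pi.single (x - e) (1 : ℂ)) x
    fun e he => by
      rw [Finset.sum_apply, Finset.sum_eq_single e]
      · simp
      · intro b _ hb
        rw [Pi.smul_apply, Pi.single_apply, if_neg (by simpa using hb.symm), smul_zero]
      · exact fun h => absurd he h
  rw [this, map_sum, Finset.sum_apply]
  refine Finset.sum_congr rfl fun e _ => ?_
  rw [map_smul, Pi.smul_apply, smul_eq_mul, mul_comm]; rfl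

lemma hasSum_ent_mul (m : ℕ) (f : ℤ × ℤ → ℂ) (x : ℤ × ℤ) :
    HasSum (fun z => ent t w m x z * f z) ((op t w ^ m) f x) := by
  rw [op_pow_apply_eq_sum]
  have hinj : Function.Injective fun e : ℤ × ℤ => x - e := fun a b h => by simpa using h
  rw [← Finset.sum_image (s := reach t m) (g := fun e => x - e)
    (f := fun z => ent t w m x z * f z) (fun a _ b _ h => hinj h)]
  refine hasSum_sum_of_ne_finset_zero fun z hz => ?_
  rw [ent_eq_zero, zero_mul]
  intro h
  exact hz (Finset.mem_image.2 ⟨x - z, h, by simp⟩)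

lemma infPow_ent (m n : ℕ) (x y : ℤ × ℤ) :
    infPow (ent t w m) n x y = ent t w (m * (n + 1)) x y := by
  induction n generalizing x y with
  | zero => simp [infPow]
  | succ n ih =>
    rw [infPow]
    simp_rw [ih]
    have := (hasSum_ent_mul t w m ((op t w ^ (m * (n + 1))) (Pi.single y 1)) x).tsum_eq
    rw [← Module.End.mul_apply, ← pow_add] at this
    rw [show m * (n + 1 + 1) = m + m * (n + 1) by ring]
    exact this

lemma exists_rowBound {C₀ : ℝ} (hw : ∀ x, ‖w x‖ ≤ C₀ * (1 + ‖lpt x‖)⁻¹) (m : ℕ) :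
    ∃ C : ℝ, 0 ≤ C ∧ ∀ x, ∀ S : Finset (ℤ × ℤ),
      ∑ y ∈ S, ‖ent t w m x y‖ ≤ C * ((1 + ‖lpt x‖)⁻¹) ^ m := by
  have hC₀ : 0 ≤ C₀ := by
    have := (norm_nonneg _).trans (hw 0)
    simpa using this
  induction m with
  | zero =>
    refine ⟨1, zero_le_one, fun x S => ?_⟩
    simp only [ent_zero, pow_zero, mul_one]
    calc ∑ y ∈ S, ‖(if x = y then (1 : ℂ) else 0)‖ = ∑ y ∈ S, if x = y then (1 : ℝ) else 0 :=
          Finset.sum_congr rfl fun y _ => by split_ifs <;> simp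
      _ ≤ 1 := by rw [Finset.sum_ite_eq]; split_ifs <;> norm_num
  | succ m ih =>
    obtain ⟨C, hC, h⟩ := ih
    refine ⟨C₀ * ∑ d ∈ t.support, ‖t d‖ * (C * (1 + ‖lpt d‖) ^ m), by positivity, fun x S => ?_⟩
    have key : ∀ d, ((1 + ‖lpt (x - d)‖)⁻¹) ^ m ≤ (1 + ‖lpt d‖) ^ m * ((1 + ‖lpt x‖)⁻¹) ^ m := by
      intro d
      rw [← mul_pow]
      refine pow_le_pow_left₀ (by positivity) ?_ m
      rw [← div_eq_mul_inv, le_div_iff₀ (by positivity), inv_mul_le_iff₀ (by positivity)]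
      have h1 : ‖lpt x‖ ≤ ‖lpt (x - d)‖ + ‖lpt d‖ := by
        rw [show lpt x = lpt (x - d) + lpt d by rw [lpt_sub]; ring]
        exact norm_add_le _ _
      nlinarith [norm_nonneg (lpt (x - d)), norm_nonneg (lpt d)]
    calc ∑ y ∈ S, ‖ent t w (m + 1) x y‖
        ≤ ∑ y ∈ S, ‖w x‖ * ∑ d ∈ t.support, ‖t d‖ * ‖ent t w m (x - d) y‖ := by
          refine Finset.sum_le_sum fun y _ => ?_
          rw [ent_succ, norm_mul]
          refine mul_le_mul_of_nonneg_left ?_ (norm_nonneg _)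
          exact (norm_sum_le _ _).trans (Finset.sum_le_sum fun d _ => (norm_mul _ _).le)
      _ = ‖w x‖ * ∑ d ∈ t.support, ‖t d‖ * ∑ y ∈ S, ‖ent t w m (x - d) y‖ := by
          rw [← Finset.mul_sum, Finset.sum_comm]
          simp_rw [Finset.mul_sum]
      _ ≤ (C₀ * (1 + ‖lpt x‖)⁻¹) * ∑ d ∈ t.support,
            ‖t d‖ * (C * ((1 + ‖lpt d‖) ^ m * ((1 + ‖lpt x‖)⁻¹) ^ m)) := by
          refine mul_le_mul (hw x) ?_ (by positivity) (by positivity)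
          refine Finset.sum_le_sum fun d _ => mul_le_mul_of_nonneg_left ?_ (norm_nonneg _)
          exact (h (x - d) S).trans (mul_le_mul_of_nonneg_left (key d) hC)
      _ = _ := by
          rw [Finset.mul_sum, Finset.mul_sum, Finset.sum_mul]
          exact Finset.sum_congr rfl fun d _ => by ring

/-- Rotation about the lattice point `p`. -/
def rotAt (p x : ℤ × ℤ) : ℤ × ℤ := p + rot (x - p)

variable {t w}

lemma rot_mem_support (ht : ∀ d, t (rot d) = ω * t d) {d : ℤ × ℤ} :
    rot d ∈ t.support ↔ d ∈ t.support := by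
  simp [ht, omega_ne_zero]

lemma sum_support_rot (ht : ∀ d, t (rot d) = ω * t d) (g : ℤ × ℤ → ℂ) :
    ∑ d ∈ t.support, t d * g (rot d) = ω⁻¹ * ∑ d ∈ t.support, t d * g d := by
  have h : ∑ d ∈ t.support, t (rot d) * g (rot d) = ∑ d ∈ t.support, t d * g d :=
    Finset.sum_equiv rotEquiv (fun d => (rot_mem_support ht).symm) (fun d _ => rfl)
  rw [← h, Finset.mul_sum]
  refine Finset.sum_congr rfl fun d _ => ?_
  rw [ht]
  field_simp [omega_ne_zero]

lemma op_comp_rotAt (ht : ∀ d, t (rot d) = ω * t d) (p : ℤ × ℤ)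
    (hw : ∀ x, w (rotAt p x) = ω⁻¹ * w x) (f : ℤ × ℤ → ℂ) :
    op t w (f ∘ rotAt p) = (op t w f) ∘ rotAt p := by
  ext x
  have h : ∀ d, rotAt p (x - d) = rotAt p x - rot d := fun d => by
    rw [rotAt, rotAt, show x - d - p = (x - p) - d by abel, rot_sub]; abel
  simp only [op_apply, Function.comp_apply, h, hw]
  rw [sum_support_rot ht fun e => f (rotAt p x - e)]
  ring

lemma op_pow_comp_rotAt (ht : ∀ d, t (rot d) = ω * t d) (p : ℤ × ℤ)
    (hw : ∀ x, w (rotAt p x) = ω⁻¹ * w x) (m : ℕ) (f : ℤ × ℤ → ℂ) :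
    (op t w ^ m) (f ∘ rotAt p) = ((op t w ^ m) f) ∘ rotAt p := by
  induction m with
  | zero => rfl
  | succ m ih => rw [pow_succ', Module.End.mul_apply, ih, op_comp_rotAt ht p hw]; rfl

/-- The resolvent weight, supported on the nonzero classes. -/
def wt (κ : ℂ) (x : ℤ × ℤ) : ℂ := if cls x = 0 then 0 else (lpt x + κ)⁻¹

lemma wt_add_of_cls {e : ℤ × ℤ} (he : cls e = 0) (κ : ℂ) (x : ℤ × ℤ) :
    wt κ (x + e) = wt (κ + lpt e) x := by
  rw [wt, wt, cls_add, he, add_zero, lpt_add]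
  congr 2; ring

lemma cls_rotAt (p x : ℤ × ℤ) : cls (rotAt p x) = cls x := by
  rw [rotAt, cls_add, cls_rot, cls_sub]; ring

lemma wt_rotAt (p x : ℤ × ℤ) : wt (-lpt p) (rotAt p x) = ω⁻¹ * wt (-lpt p) x := by
  rw [wt, wt, cls_rotAt]
  split_ifs
  · simp
  · rw [rotAt, lpt_add, lpt_rot, lpt_sub, ← mul_inv]
    congr 1; ring

lemma ent_wt_add {e : ℤ × ℤ} (he : cls e = 0) (κ : ℂ) (m : ℕ) (x y : ℤ × ℤ) :
    ent t (wt κ) m (x + e) (y + e) = ent t (wt (κ + lpt e)) m x y := by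
  induction m generalizing x with
  | zero => simp [ent_zero]
  | succ m ih =>
    rw [ent_succ, ent_succ, wt_add_of_cls he]
    congr 1
    refine Finset.sum_congr rfl fun d _ => ?_
    rw [show x + e - d = (x - d) + e by abel, ih]

lemma norm_wt_zero_le (x : ℤ × ℤ) : ‖wt 0 x‖ ≤ 2 * (1 + ‖lpt x‖)⁻¹ := by
  rw [wt]
  split_ifs with h
  · rw [norm_zero]; positivity
  · have := one_le_norm_lpt (ne_zero_of_cls h)
    rw [add_zero, norm_inv, ← div_eq_mul_inv, le_div_iff₀ (by positivity),
      inv_mul_le_iff₀ (by positivity)]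
    linarith

end LatticeOperator

section PoleCancellation

open Filter Topology Asymptotics

lemma pow_eq_pow_add_sum_telescope {R : Type*} [Ring R] (T A : R) (m : ℕ) :
    T ^ m = A ^ m + ∑ j ∈ Finset.range m, A ^ j * (T - A) * T ^ (m - 1 - j) := by
  induction m with
  | zero => simp
  | succ m ih =>
    have h : ∑ j ∈ Finset.range m, A ^ j * (T - A) * T ^ (m + 1 - 1 - j)
        = (∑ j ∈ Finset.range m, A ^ j * (T - A) * T ^ (m - 1 - j)) * T := by
      rw [Finset.sum_mul]
      refine Finset.sum_congr rfl fun j hj => ?_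
      have := Finset.mem_range.1 hj
      rw [show m + 1 - 1 - j = (m - 1 - j) + 1 by omega, pow_succ]
      simp only [mul_assoc]
    rw [Finset.sum_range_succ, h, pow_succ T m, ih, add_mul, pow_succ A m]
    simp only [add_tsub_cancel_right, Nat.sub_self, pow_zero, mul_one]
    noncomm_ring

variable (t : ℤ × ℤ →₀ ℂ) (p : ℤ × ℤ)

/-- The convolution functional at `p`. -/
def phiAt : (ℤ × ℤ → ℂ) →ₗ[ℂ] ℂ where
  toFun f := ∑ d ∈ t.support, t d * f (p - d)
  map_add' f g := by simp only [Pi.add_apply, mul_add, Finset.sum_add_distrib]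
  map_smul' c f := by
    simp only [Pi.smul_apply, smul_eq_mul, RingHom.id_apply, Finset.mul_sum]
    exact Finset.sum_congr rfl fun d _ => by ring

/-- The weight with its value at `p` removed. -/
def wtOff (κ : ℂ) : ℤ × ℤ → ℂ := Function.update (wt κ) p 0

variable {t p}

lemma op_wt_sub_op_wtOff (hp : cls p ≠ 0) (κ : ℂ) (f : ℤ × ℤ → ℂ) :
    (op t (wt κ) - op t (wtOff p κ)) f = ((lpt p + κ)⁻¹ * phiAt t p f) • Pi.single p 1 := by
  ext x
  rw [LinearMap.sub_apply, Pi.sub_apply, op_apply, op_apply, Pi.smul_apply, wtOff]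
  by_cases hx : x = p
  · subst hx
    simp [wt, hp, phiAt]
  · simp [hx]

lemma differentiableAt_wtOff (x : ℤ × ℤ) :
    DifferentiableAt ℂ (fun κ => wtOff p κ x) (-lpt p) := by
  by_cases hx : x = p
  · subst hx; simp [wtOff]
  · simp only [wtOff, Function.update_of_ne hx, wt]
    split_ifs
    · fun_prop
    · have : lpt x + -lpt p ≠ 0 := by
        rw [← sub_eq_add_neg, sub_ne_zero]
        exact fun h => hx (lpt_injective h)
      fun_prop (disch := assumption)

lemma differentiableAt_op_wtOff_pow (m : ℕ) (f : ℤ × ℤ → ℂ) (x : ℤ × ℤ) :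
    DifferentiableAt ℂ (fun κ => (op t (wtOff p κ) ^ m) f x) (-lpt p) := by
  induction m generalizing x with
  | zero => simp
  | succ m ih =>
    simp only [op_pow_succ_apply]
    exact (differentiableAt_wtOff x).mul
      (DifferentiableAt.fun_sum fun d _ => (ih (x - d)).const_mul (t d))

lemma phiAt_eq_zero_of_comp_rotAt (ht : ∀ d, t (rot d) = ω * t d) {f : ℤ × ℤ → ℂ}
    (hf : f ∘ rotAt p = f) : phiAt t p f = 0 := by
  have h1 : phiAt t p (f ∘ rotAt p) = ω⁻¹ * phiAt t p f := by
    have h : ∀ d, rotAt p (p - d) = p - rot d := fun d => by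
      rw [rotAt, show p - d - p = 0 - d by abel, rot_sub, rot_zero]; abel
    simp only [phiAt, LinearMap.coe_mk, AddHom.coe_mk, Function.comp_apply, h]
    exact sum_support_rot ht fun e => f (p - e)
  rw [hf] at h1
  have h2 : (ω - 1) * phiAt t p f = 0 := by
    have : ω * phiAt t p f = phiAt t p f := by
      nth_rewrite 1 [h1]; rw [mul_inv_cancel_left₀ omega_ne_zero]
    rw [sub_mul, this]; ring
  exact (mul_eq_zero.1 h2).resolve_left (sub_ne_zero.2 omega_ne_one)

lemma wtOff_center : wtOff p (-lpt p) = wt (-lpt p) := by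
  rw [wtOff, Function.update_eq_self_iff]
  simp [wt]

lemma single_comp_rotAt : (Pi.single p 1 : ℤ × ℤ → ℂ) ∘ rotAt p = Pi.single p 1 := by
  ext x
  have : rotAt p x = p ↔ x = p := by
    rw [rotAt, add_eq_left]
    constructor
    · intro h
      have h2 : rot (rot (rot (x - p))) = 0 := by rw [h]; simp
      rw [rot_rot_rot] at h2
      exact sub_eq_zero.1 h2
    · rintro rfl; simp
  simp only [Function.comp_apply, Pi.single_apply, this]

lemma phiAt_center (ht : ∀ d, t (rot d) = ω * t d) (i : ℕ) :
    phiAt t p ((op t (wtOff p (-lpt p)) ^ i) (Pi.single p 1)) = 0 := by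
  apply phiAt_eq_zero_of_comp_rotAt ht
  rw [wtOff_center, ← op_pow_comp_rotAt ht p (wt_rotAt p), single_comp_rotAt]

lemma isBigO_phiAt_zero (ht : ∀ d, t (rot d) = ω * t d) (i : ℕ) :
    (fun κ => (lpt p + κ)⁻¹ * phiAt t p ((op t (wtOff p κ) ^ i) (Pi.single p 1)))
      =O[𝓝[≠] (-lpt p)] (fun _ => (1 : ℂ)) := by
  have hd : DifferentiableAt ℂ
      (fun κ => phiAt t p ((op t (wtOff p κ) ^ i) (Pi.single p 1))) (-lpt p) :=
    DifferentiableAt.fun_sum fun d _ =>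
      (differentiableAt_op_wtOff_pow i _ (p - d)).const_mul (t d)
  have h1 := (hd.isBigO_sub).mono (nhdsWithin_le_nhds (s := {-lpt p}ᶜ))
  simp only [phiAt_center ht i, sub_zero] at h1
  have h2 := (isBigO_refl (fun κ : ℂ => (lpt p + κ)⁻¹) (𝓝[≠] (-lpt p))).mul h1
  refine h2.trans (isBigO_of_le _ fun κ => ?_)
  rw [show κ - -lpt p = lpt p + κ by ring]
  by_cases h : lpt p + κ = 0
  · simp [h]
  · simp [h]

lemma isBigO_phiAt (hp : cls p ≠ 0) (ht : ∀ d, t (rot d) = ω * t d) (k i : ℕ) :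
    (fun κ => (lpt p + κ)⁻¹ *
      phiAt t p ((op t (wt κ) ^ k) ((op t (wtOff p κ) ^ i) (Pi.single p 1))))
      =O[𝓝[≠] (-lpt p)] (fun _ => (1 : ℂ)) := by
  induction k generalizing i with
  | zero => simpa using isBigO_phiAt_zero ht i
  | succ k ih =>
    have h0 := (isBigO_phiAt_zero (p := p) ht i).mul (ih 0)
    simp only [mul_one, pow_zero, Module.End.one_apply] at h0
    have h := (ih (i + 1)).add h0
    refine h.congr_left fun κ => ?_
    set g := (op t (wtOff p κ) ^ i) (Pi.single p 1) with hg
    have e : op t (wt κ) g = (op t (wtOff p κ) ^ (i + 1)) (Pi.single p 1)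
        + ((lpt p + κ)⁻¹ * phiAt t p g) • Pi.single p 1 := by
      rw [← op_wt_sub_op_wtOff hp, LinearMap.sub_apply, pow_succ', Module.End.mul_apply, ← hg]
      abel
    rw [pow_succ (op t (wt κ)) k, Module.End.mul_apply, e, map_add, map_add, map_smul, map_smul, smul_eq_mul]
    ring

/-- Sums of diagonal entries over a neighbourhood of `p` have no pole at `-lpt p`. -/
lemma isBigO_sum_ent (hp : cls p ≠ 0) (ht : ∀ d, t (rot d) = ω * t d) (m : ℕ)
    (X : Finset (ℤ × ℤ)) (hX : ∀ j < m, ∀ x, x - p ∈ reach t j → x ∈ X) :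
    (fun κ => ∑ x ∈ X, ent t (wt κ) m x x) =O[𝓝[≠] (-lpt p)] (fun _ => (1 : ℂ)) := by
  have h1 : (fun κ => ∑ x ∈ X, ent t (wtOff p κ) m x x)
      =O[𝓝[≠] (-lpt p)] (fun _ => (1 : ℂ)) := by
    refine IsBigO.fun_sum fun x _ => ?_
    exact ((differentiableAt_op_wtOff_pow m _ x).continuousAt.isBigO_one ℂ).mono
      nhdsWithin_le_nhds
  have h2 : (fun κ => ∑ j ∈ Finset.range m, (lpt p + κ)⁻¹ *
      phiAt t p ((op t (wt κ) ^ (m - 1 - j)) ((op t (wtOff p κ) ^ j) (Pi.single p 1))))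
      =O[𝓝[≠] (-lpt p)] (fun _ => (1 : ℂ)) :=
    IsBigO.fun_sum fun j _ => isBigO_phiAt hp ht _ j
  refine (h1.add h2).congr_left fun κ => ?_
  have h3 : ∀ x, ent t (wt κ) m x x = ent t (wtOff p κ) m x x + ∑ j ∈ Finset.range m,
      (lpt p + κ)⁻¹ * phiAt t p ((op t (wt κ) ^ (m - 1 - j)) (Pi.single x 1)) *
        (op t (wtOff p κ) ^ j) (Pi.single p 1) x := by
    intro x
    rw [ent, pow_eq_pow_add_sum_telescope (op t (wt κ)) (op t (wtOff p κ)) m]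
    rw [LinearMap.add_apply, Pi.add_apply, LinearMap.sum_apply, Finset.sum_apply]
    congr 1
    refine Finset.sum_congr rfl fun j _ => ?_
    rw [Module.End.mul_apply, Module.End.mul_apply, op_wt_sub_op_wtOff hp, map_smul,
      Pi.smul_apply, smul_eq_mul]
  simp only [h3, Finset.sum_add_distrib]
  congr 1
  rw [Finset.sum_comm]
  refine Finset.sum_congr rfl fun j hj => ?_
  simp only [mul_assoc]
  rw [← Finset.mul_sum]
  congr 1
  set g := (op t (wtOff p κ) ^ j) (Pi.single p 1) with hg
  have h4 : g = ∑ x ∈ X, g x • Pi.single x (1 : ℂ) := by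
    ext y
    rw [Finset.sum_apply]
    by_cases hy : y ∈ X
    · rw [Finset.sum_eq_single y]
      · simp
      · intro b _ hb
        rw [Pi.smul_apply, Pi.single_apply, if_neg hb.symm, smul_zero]
      · exact fun h => absurd hy h
    · rw [Finset.sum_eq_zero]
      · exact ent_eq_zero t _ fun h => hy (hX j (Finset.mem_range.1 hj) y h)
      · intro b hb
        rw [Pi.smul_apply, Pi.single_apply, if_neg, smul_zero]
        rintro rfl; exact hy hb
  nth_rewrite 1 [h4]
  rw [map_sum, map_sum]
  refine Finset.sum_congr rfl fun x _ => ?_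
  rw [map_smul, map_smul, smul_eq_mul, mul_comm]

end PoleCancellation

section PartialFractions

lemma isAlgebraic_finsetSum {ι : Type*} (s : Finset ι) {f : ι → ℂ}
    (hf : ∀ i, IsAlgebraic ℚ (f i)) : IsAlgebraic ℚ (∑ i ∈ s, f i) :=
  mem_algebraicClosure_iff.1
    ((algebraicClosure ℚ ℂ).sum_mem fun i _ => mem_algebraicClosure_iff.2 (hf i))

/-- The parameters avoiding all poles. -/
abbrev Good : Type := {κ : ℂ // ∀ p : ℤ × ℤ, cls p ≠ 0 → lpt p + κ ≠ 0}

/-- Index set of the elementary fractions. -/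
abbrev PFIndex : Type := {p : ℤ × ℤ // cls p ≠ 0} × ℕ

/-- Elementary fractions. -/
def elemFrac (q : PFIndex) (κ : Good) : ℂ := ((lpt q.1.1 + κ.1) ^ (q.2 + 1))⁻¹

/-- Combinations of elementary fractions with algebraic coefficients. -/
def fracSpan : Submodule (algebraicClosure ℚ ℂ) (Good → ℂ) :=
  Submodule.span (algebraicClosure ℚ ℂ) (Set.range elemFrac)

lemma elemFrac_mem (q : PFIndex) : elemFrac q ∈ fracSpan :=
  Submodule.subset_span ⟨q, rfl⟩

lemma smul_mem_fracSpan {a : ℂ} (ha : IsAlgebraic ℚ a) {f : Good → ℂ} (hf : f ∈ fracSpan) :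
    (fun κ => a * f κ) ∈ fracSpan :=
  fracSpan.smul_mem (⟨a, ha.isIntegral⟩ : algebraicClosure ℚ ℂ) hf

lemma elemFrac_mul_inv_mem (p : {p : ℤ × ℤ // cls p ≠ 0}) (q : PFIndex) :
    (fun κ : Good => elemFrac q κ * (lpt p.1 + κ.1)⁻¹) ∈ fracSpan := by
  obtain ⟨p', j⟩ := q
  by_cases h : p' = p
  · subst h
    have : (fun κ : Good => elemFrac (p', j) κ * (lpt p'.1 + κ.1)⁻¹) = elemFrac (p', j + 1) := by
      ext κ
      rw [elemFrac, elemFrac, ← mul_inv, ← pow_succ]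
    rw [this]; exact elemFrac_mem _
  · have hne : lpt p.1 - lpt p'.1 ≠ 0 := by
      rw [sub_ne_zero]; exact fun e => h (Subtype.ext (lpt_injective e).symm)
    have halg : IsAlgebraic ℚ (lpt p.1 - lpt p'.1)⁻¹ :=
      ((isAlgebraic_lpt _).sub (isAlgebraic_lpt _)).inv
    induction j with
    | zero =>
      have : (fun κ : Good => elemFrac (p', 0) κ * (lpt p.1 + κ.1)⁻¹)
          = fun κ => (lpt p.1 - lpt p'.1)⁻¹ * (elemFrac (p', 0) - elemFrac (p, 0)) κ := by
        ext κ
        have h1 := κ.2 p'.1 p'.2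
        have h2 := κ.2 p.1 p.2
        simp only [elemFrac, Pi.sub_apply, zero_add, pow_one]
        field_simp
        ring
      rw [this]
      exact smul_mem_fracSpan halg (fracSpan.sub_mem (elemFrac_mem _) (elemFrac_mem _))
    | succ j ih =>
      have : (fun κ : Good => elemFrac (p', j + 1) κ * (lpt p.1 + κ.1)⁻¹)
          = fun κ => (lpt p.1 - lpt p'.1)⁻¹ * (elemFrac (p', j + 1) -
            fun κ : Good => elemFrac (p', j) κ * (lpt p.1 + κ.1)⁻¹) κ := by
        ext κ
        have h1 := κ.2 p'.1 p'.2
        have h2 := κ.2 p.1 p.2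
        simp only [elemFrac, Pi.sub_apply]
        rw [pow_succ (lpt p'.1 + κ.1) (j + 1)]
        field_simp
        ring
      rw [this]
      exact smul_mem_fracSpan halg (fracSpan.sub_mem (elemFrac_mem _) ih)

lemma mul_inv_mem_fracSpan (p : {p : ℤ × ℤ // cls p ≠ 0}) {f : Good → ℂ} (hf : f ∈ fracSpan) :
    (fun κ : Good => f κ * (lpt p.1 + κ.1)⁻¹) ∈ fracSpan := by
  induction hf using Submodule.span_induction with
  | mem f hf => obtain ⟨q, rfl⟩ := hf; exact elemFrac_mul_inv_mem p q
  | zero => simp only [Pi.zero_apply, zero_mul]; exact fracSpan.zero_mem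
  | add f g _ _ hf hg => simpa [add_mul] using! fracSpan.add_mem hf hg
  | smul a f _ hf =>
    have := fracSpan.smul_mem a hf
    convert this using 2 with κ
    simp [Algebra.smul_def, mul_assoc]

variable {t : ℤ × ℤ →₀ ℂ}

lemma ent_mem_fracSpan (halg : ∀ d, IsAlgebraic ℚ (t d)) (m : ℕ) (x y : ℤ × ℤ) :
    (fun κ : Good => ent t (wt κ.1) (m + 1) x y) ∈ fracSpan := by
  have hsum : ∀ F : ℤ × ℤ → Good → ℂ, (∀ d, F d ∈ fracSpan) →
      (fun κ : Good => ∑ d ∈ t.support, F d κ) ∈ fracSpan := fun F hF => by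
    have := fracSpan.sum_mem (t := t.support) fun d _ => hF d
    convert this using 1
    ext κ; simp
  by_cases hx : cls x = 0
  · have : (fun κ : Good => ent t (wt κ.1) (m + 1) x y) = 0 := by
      ext κ; simp [ent_succ, wt, hx]
    rw [this]; exact fracSpan.zero_mem
  induction m generalizing x with
  | zero =>
    have : (fun κ : Good => ent t (wt κ.1) (0 + 1) x y) = fun κ : Good =>
        (∑ d ∈ t.support, t d * if x - d = y then 1 else 0) * elemFrac (⟨x, hx⟩, 0) κ := by
      ext κ
      simp [ent_succ, ent_zero, wt, hx, elemFrac, mul_comm]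
    rw [this]
    refine smul_mem_fracSpan ?_ (elemFrac_mem _)
    refine isAlgebraic_finsetSum _ fun d => (halg d).mul ?_
    split_ifs
    · exact isAlgebraic_one
    · exact isAlgebraic_zero
  | succ m ih =>
    have : (fun κ : Good => ent t (wt κ.1) (m + 1 + 1) x y) = fun κ : Good =>
        (∑ d ∈ t.support, t d * ent t (wt κ.1) (m + 1) (x - d) y) * (lpt x + κ.1)⁻¹ := by
      ext κ
      rw [ent_succ, wt, if_neg hx, mul_comm]
    rw [this]
    refine mul_inv_mem_fracSpan ⟨x, hx⟩ (f := fun κ : Good =>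
      ∑ d ∈ t.support, t d * ent t (wt κ.1) (m + 1) (x - d) y) (hsum _ fun d => ?_)
    refine smul_mem_fracSpan (halg d) ?_
    by_cases hxd : cls (x - d) = 0
    · have : (fun κ : Good => ent t (wt κ.1) (m + 1) (x - d) y) = 0 := by
        ext κ; simp [ent_succ, wt, hxd]
      rw [this]; exact fracSpan.zero_mem
    · exact ih (x - d) hxd

lemma exists_partialFraction (halg : ∀ d, IsAlgebraic ℚ (t d)) (m : ℕ) (S : Finset (ℤ × ℤ)) :
    ∃ c : PFIndex →₀ ℂ, (∀ q, IsAlgebraic ℚ (c q)) ∧ ∀ κ : Good,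
      ∑ x ∈ S, ent t (wt κ.1) (m + 1) x x = ∑ q ∈ c.support, c q * elemFrac q κ := by
  have h : (∑ x ∈ S, fun κ : Good => ent t (wt κ.1) (m + 1) x x) ∈ fracSpan :=
    fracSpan.sum_mem fun x _ => ent_mem_fracSpan halg m x x
  obtain ⟨c, hc⟩ := Finsupp.mem_span_range_iff_exists_finsupp.1 h
  refine ⟨c.mapRange (fun a : algebraicClosure ℚ ℂ => (a : ℂ)) rfl, fun q => ?_, fun κ => ?_⟩
  · rw [Finsupp.mapRange_apply]
    exact isAlgebraic_iff_isIntegral.2 (c q).2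
  · have h1 := congrFun hc κ
    rw [Finset.sum_apply] at h1
    rw [← h1, Finsupp.sum, Finset.sum_apply]
    symm
    rw [Finset.sum_subset (Finsupp.support_mapRange (f := fun a : algebraicClosure ℚ ℂ => (a : ℂ))
      (hf := rfl) (g := c)) fun q _ hq => by rw [Finsupp.notMem_support_iff.1 hq, zero_mul]]
    refine Finset.sum_congr rfl fun q _ => ?_
    simp [Algebra.smul_def]

end PartialFractions

section Residues

open Filter Topology Asymptotics

/-- Residue modulo `3`. -/
def r3 (x : ℤ × ℤ) : ℤ × ℤ := (x.1 % 3, x.2 % 3)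

/-- Quotient by `3`. -/
def q3 (x : ℤ × ℤ) : ℤ × ℤ := (x.1 / 3, x.2 / 3)

/-- Multiplication by `3`. -/
def tri (e : ℤ × ℤ) : ℤ × ℤ := (3 * e.1, 3 * e.2)

/-- Representatives modulo `3`. -/
def blk : Finset (ℤ × ℤ) := Finset.Ico 0 3 ×ˢ Finset.Ico 0 3

lemma r3_add_tri_q3 (x : ℤ × ℤ) : r3 x + tri (q3 x) = x := by
  ext <;> simp only [r3, tri, q3, Prod.fst_add, Prod.snd_add] <;> omega

lemma r3_mem_blk (x : ℤ × ℤ) : r3 x ∈ blk := by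
  simp only [r3, blk, Finset.mem_product, Finset.mem_Ico]; omega

lemma q3_add_tri {x : ℤ × ℤ} (hx : x ∈ blk) (e : ℤ × ℤ) : q3 (x + tri e) = e := by
  simp only [blk, Finset.mem_product, Finset.mem_Ico] at hx
  ext <;> simp only [tri, q3, Prod.fst_add, Prod.snd_add] <;> omega

lemma r3_add_tri {x : ℤ × ℤ} (hx : x ∈ blk) (e : ℤ × ℤ) : r3 (x + tri e) = x := by
  simp only [blk, Finset.mem_product, Finset.mem_Ico] at hx
  ext <;> simp only [tri, r3, Prod.fst_add, Prod.snd_add] <;> omega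

lemma cls_tri (e : ℤ × ℤ) : cls (tri e) = 0 := by
  have h : (3 : ZMod 3) = 0 := by decide
  simp [cls, tri, h]

lemma cls_r3 (x : ℤ × ℤ) : cls (r3 x) = cls x := by
  nth_rewrite 2 [← r3_add_tri_q3 x]
  rw [cls_add, cls_tri, add_zero]

lemma lpt_tri (e : ℤ × ℤ) : lpt (tri e) = 3 * lpt e := by
  simp [lpt, tri]; ring

/-- The lattice as blocks of residues. -/
def blkEquiv : (ℤ × ℤ) × blk ≃ ℤ × ℤ where
  toFun q := q.2.1 + tri q.1
  invFun x := (q3 x, ⟨r3 x, r3_mem_blk x⟩)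
  left_inv q := by
    ext1
    · exact q3_add_tri q.2.2 q.1
    · exact Subtype.ext (r3_add_tri q.2.2 q.1)
  right_inv x := r3_add_tri_q3 x

/-- Translation of admissible parameters. -/
def Good.shift (κ : Good) (e : ℤ × ℤ) : Good :=
  ⟨κ.1 + lpt (tri e), fun p hp => by
    have := κ.2 (p + tri e) (by rwa [cls_add, cls_tri, add_zero])
    rw [lpt_add] at this
    rwa [add_comm κ.1, ← add_assoc]⟩

lemma elemFrac_shift (q : PFIndex) (κ : Good) (e : ℤ × ℤ) :
    elemFrac q (κ.shift e) = ((lpt (q.1.1 + tri e) + κ.1) ^ (q.2 + 1))⁻¹ := by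
  rw [elemFrac, Good.shift, lpt_add]
  congr 2; ring

lemma eventually_good (a : ℤ × ℤ) : ∀ᶠ κ in 𝓝[≠] (-lpt a), ∀ p, cls p ≠ 0 → lpt p + κ ≠ 0 := by
  have h1 : ∀ᶠ κ in 𝓝[≠] (-lpt a), κ ∈ Metric.ball (-lpt a) 1 :=
    mem_nhdsWithin_of_mem_nhds (Metric.ball_mem_nhds _ one_pos)
  filter_upwards [h1, self_mem_nhdsWithin] with κ hκ hne p _ h0
  have hκ' : κ = -lpt p := by linear_combination h0
  by_cases hpa : p = a
  · exact hne (by rw [hκ', hpa]; rfl)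
  · rw [Metric.mem_ball, dist_eq_norm, hκ', show -lpt p - -lpt a = lpt (a - p) by
      rw [lpt_sub]; ring] at hκ
    have := one_le_norm_lpt (sub_ne_zero.2 (Ne.symm hpa))
    linarith

variable {t : ℤ × ℤ →₀ ℂ}

lemma sum_coeff_eq_zero (ht : ∀ d, t (rot d) = ω * t d) (m : ℕ) {c : PFIndex →₀ ℂ}
    (hc : ∀ κ : Good, ∑ x ∈ blk, ent t (wt κ.1) (m + 1) x x
      = ∑ q ∈ c.support, c q * elemFrac q κ) (a : ℤ × ℤ) (j : ℕ) :
    ∑ q ∈ c.support with r3 q.1.1 = a ∧ q.2 = j, c q = 0 := by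
  by_cases hex : ∃ q ∈ c.support, r3 q.1.1 = a
  swap
  · rw [Finset.filter_false_of_mem, Finset.sum_empty]
    exact fun q hq h => hex ⟨q, hq, h.1⟩
  obtain ⟨q₀, -, hq₀⟩ := hex
  have ha : cls a ≠ 0 := by rw [← hq₀, cls_r3]; exact q₀.1.2
  set X₀ : Finset (ℤ × ℤ) :=
    (Finset.range (m + 1)).biUnion fun j => (reach t j).image fun e => a + e with hX₀
  set E : Finset (ℤ × ℤ) := X₀.image q3 ∪ c.support.image fun q => -q3 q.1.1 with hE
  have hinj : ∀ y ∈ E ×ˢ blk, ∀ z ∈ E ×ˢ blk, y.2 + tri y.1 = z.2 + tri z.1 → y = z := by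
    intro y hy z hz h
    have hy2 := (Finset.mem_product.1 hy).2
    have hz2 := (Finset.mem_product.1 hz).2
    refine Prod.ext ?_ ?_
    · rw [← q3_add_tri hy2 y.1, h, q3_add_tri hz2]
    · rw [← r3_add_tri hy2 y.1, h, r3_add_tri hz2]
  have h1 := isBigO_sum_ent ha ht (m + 1) ((E ×ˢ blk).image fun y => y.2 + tri y.1) (by
    intro j hj x hx
    refine Finset.mem_image.2 ⟨(q3 x, r3 x), Finset.mem_product.2 ⟨?_, r3_mem_blk x⟩,
      r3_add_tri_q3 x⟩
    refine Finset.mem_union_left _ (Finset.mem_image_of_mem _ ?_)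
    exact Finset.mem_biUnion.2 ⟨j, Finset.mem_range.2 hj,
      Finset.mem_image.2 ⟨x - a, hx, by abel⟩⟩)
  set P : Polynomial ℂ := ∑ q ∈ c.support with r3 q.1.1 = a,
    Polynomial.C (c q) * Polynomial.X ^ (q.2 + 1) with hP
  have hreg : (fun κ => ∑ q ∈ c.support, c q * ∑ e ∈ E with q.1.1 + tri e ≠ a,
      ((lpt (q.1.1 + tri e) + κ) ^ (q.2 + 1))⁻¹) =O[𝓝[≠] (-lpt a)] (fun _ => (1 : ℂ)) := by
    refine IsBigO.mono (Tendsto.isBigO_one ℂ (c := ∑ q ∈ c.support, c q * ∑ e ∈ E with q.1.1 + tri e ≠ a,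
      ((lpt (q.1.1 + tri e) + -lpt a) ^ (q.2 + 1))⁻¹) ?_) nhdsWithin_le_nhds
    refine tendsto_finsetSum _ fun q _ => Tendsto.const_mul _ (tendsto_finsetSum _ fun e he => ?_)
    have hne : lpt (q.1.1 + tri e) + -lpt a ≠ 0 := by
      rw [← sub_eq_add_neg, sub_ne_zero]
      exact fun h => (Finset.mem_filter.1 he).2 (lpt_injective h)
    exact ContinuousAt.inv₀ (by fun_prop) (pow_ne_zero _ hne)
  have hPO : (fun κ => P.eval ((lpt a + κ)⁻¹)) =O[𝓝[≠] (-lpt a)] (fun _ => (1 : ℂ)) := by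
    refine (h1.sub hreg).congr' ?_ EventuallyEq.rfl
    filter_upwards [eventually_good a] with κ hκ
    rw [Finset.sum_image hinj, Finset.sum_product]
    have h2 : ∀ e ∈ E, ∑ x ∈ blk, ent t (wt κ) (m + 1) (x + tri e) (x + tri e)
        = ∑ q ∈ c.support, c q * ((lpt (q.1.1 + tri e) + κ) ^ (q.2 + 1))⁻¹ := by
      intro e _
      have h5 := hc (Good.shift ⟨κ, hκ⟩ e)
      simp only [elemFrac_shift] at h5
      rw [← h5]
      refine Finset.sum_congr rfl fun x _ => ?_
      rw [ent_wt_add (cls_tri e)]; rfl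
    rw [Finset.sum_congr rfl h2, Finset.sum_comm, ← Finset.sum_sub_distrib, hP,
      Polynomial.eval_finsetSum, Finset.sum_filter]
    refine Finset.sum_congr rfl fun q hq => ?_
    rw [← Finset.mul_sum, ← mul_sub,
      ← Finset.sum_filter_add_sum_filter_not E (fun e => q.1.1 + tri e ≠ a), add_sub_cancel_left]
    have h3 : ∀ e, ¬ q.1.1 + tri e ≠ a → r3 q.1.1 = a ∧ e = -q3 q.1.1 := by
      intro e he
      push Not at he
      have hb : a ∈ blk := by rw [← hq₀]; exact r3_mem_blk _
      have h4 : q.1.1 = a + tri (-e) := by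
        rw [← he]; ext <;> simp [tri]
      have h5 : e = -q3 q.1.1 := by rw [h4, q3_add_tri hb, neg_neg]
      exact ⟨by rw [h4, r3_add_tri hb], h5⟩
    split_ifs with hqa
    · rw [Finset.sum_eq_single (-q3 q.1.1)]
      · have h6 : q.1.1 + tri (-q3 q.1.1) = a := by
          nth_rewrite 1 [← r3_add_tri_q3 q.1.1]
          rw [hqa]; ext <;> simp [tri]
        rw [h6]; simp
      · intro e he hne
        exact absurd (h3 e (Finset.mem_filter.1 he).2).2 hne
      · intro hn
        refine absurd (Finset.mem_filter.2 ⟨?_, ?_⟩) hn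
        · exact Finset.mem_union_right _ (Finset.mem_image.2 ⟨q, hq, rfl⟩)
        · push Not
          nth_rewrite 1 [← r3_add_tri_q3 q.1.1]
          rw [hqa]; ext <;> simp [tri]
    · rw [Finset.filter_false_of_mem, Finset.sum_empty, mul_zero]
      exact fun e _ he => hqa (h3 e he).1
  have htop : Tendsto (fun κ => ‖(lpt a + κ)⁻¹‖) (𝓝[≠] (-lpt a)) atTop := by
    have h := tendsto_norm_inv_nhdsNE_zero_atTop (α := ℂ)
    refine h.comp (tendsto_nhdsWithin_iff.2 ⟨?_, ?_⟩)
    · have : ContinuousAt (fun κ => lpt a + κ) (-lpt a) := by fun_prop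
      have h := this.tendsto
      rw [add_neg_cancel] at h
      exact h.mono_left nhdsWithin_le_nhds
    · filter_upwards [self_mem_nhdsWithin] with κ hκ h0
      exact hκ (eq_neg_of_add_eq_zero_right h0)
  have hdeg : ¬ 0 < P.degree := by
    intro hd
    have h2 := P.tendsto_norm_atTop hd htop
    have h3 := (isBigO_one_iff ℂ).1 hPO
    exact not_isBoundedUnder_of_tendsto_atTop h2 h3
  have hcoeff : P.coeff (j + 1) = 0 := by
    refine Polynomial.coeff_eq_zero_of_degree_lt ((not_lt.1 hdeg).trans_lt ?_)
    exact_mod_cast Nat.succ_pos j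
  rw [hP, Polynomial.finsetSum_coeff] at hcoeff
  rw [← hcoeff, ← Finset.filter_filter, Finset.sum_filter]
  refine Finset.sum_congr rfl fun q _ => ?_
  rw [Polynomial.coeff_C_mul, Polynomial.coeff_X_pow]
  by_cases h : q.2 = j
  · simp [h]
  · rw [if_neg h, if_neg (by omega), mul_zero]

end Residues

section RowSums

open Filter Topology

/-- Symmetric sums of `(z + 3m)^{-(j+1)}` over the integers. -/
def rowSum (j : ℕ) (z : ℂ) : ℂ :=
  if j = 0 then Real.pi / 3 * cot (Real.pi * (z / 3)) else ∑' m : ℤ, ((z + 3 * m) ^ (j + 1))⁻¹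

lemma summable_row {j : ℕ} (hj : j ≠ 0) (z : ℂ) :
    Summable fun m : ℤ => ((z + 3 * m) ^ (j + 1))⁻¹ := by
  have h := (EisensteinSeries.linear_right_summable (z / 3) 1 (k := (j + 1 : ℕ))
    (by have := Nat.pos_of_ne_zero hj; push_cast; omega)).mul_left (((3 : ℂ) ^ (j + 1))⁻¹)
  refine h.congr fun m => ?_
  rw [zpow_natCast, ← mul_inv, ← mul_pow]
  congr 2
  push_cast; ring

lemma tendsto_rowSum (j : ℕ) {z : ℂ} (hz : ∀ m : ℤ, z + 3 * m ≠ 0) :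
    Tendsto (fun N : ℕ => ∑ m ∈ Finset.Icc (-N : ℤ) N, ((z + 3 * m) ^ (j + 1))⁻¹) atTop
      (𝓝 (rowSum j z)) := by
  by_cases hj : j = 0
  · subst hj
    rw [rowSum, if_pos rfl]
    have hx : z / 3 ∈ integerComplement := by
      rintro ⟨n, hn⟩
      exact hz (-n) (by push_cast; linear_combination -3 * hn)
    have h1 := ((tendsto_logDeriv_euler_cot_sub hx).add_const (1 / (z / 3))).const_mul (1 / 3 : ℂ)
    rw [show (1 / 3 : ℂ) * (Real.pi * cot (Real.pi * (z / 3)) - 1 / (z / 3) + 1 / (z / 3))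
      = Real.pi / 3 * cot (Real.pi * (z / 3)) by ring] at h1
    refine h1.congr fun N => ?_
    induction N with
    | zero => simp; ring
    | succ N ih =>
      have h2 := Finset.sum_Icc_succ_eq_add_endpoints
        (fun m : ℤ => ((z + 3 * m) ^ (0 + 1))⁻¹) (N := N)
      rw [Nat.cast_succ, h2, ← ih, Finset.sum_range_succ, cotTerm]
      have e : ∀ y : ℂ, (3 * y)⁻¹ = 1 / 3 * (1 / y) := fun y => by
        rw [mul_inv]; ring
      push_cast
      rw [pow_one, pow_one, show z + 3 * ((N : ℂ) + 1) = 3 * (z / 3 + (N + 1)) by ring,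
        show z + 3 * (-((N : ℂ) + 1)) = 3 * (z / 3 - (N + 1)) by ring, e, e]
      ring
  · rw [rowSum, if_neg hj]
    exact (summable_row hj z).hasSum.comp Finset.tendsto_Icc_neg

lemma rowSum_add (j : ℕ) (z : ℂ) (k : ℤ) : rowSum j (z + 3 * k) = rowSum j z := by
  rw [rowSum, rowSum]
  split_ifs
  · rw [cot_pi_eq_exp_ratio, cot_pi_eq_exp_ratio]
    have : exp (2 * Real.pi * I * ((z + 3 * k) / 3)) = exp (2 * Real.pi * I * (z / 3)) := by
      rw [show 2 * Real.pi * I * ((z + 3 * k) / 3) = 2 * Real.pi * I * (z / 3) +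
        k * (2 * Real.pi * I) by ring, exp_add, exp_int_mul_two_pi_mul_I, mul_one]
    rw [this]
  · rw [← (Equiv.addLeft k).tsum_eq (fun m : ℤ => ((z + 3 * m) ^ (j + 1))⁻¹)]
    refine tsum_congr fun m => ?_
    rw [Equiv.coe_addLeft]
    push_cast
    congr 2; ring

/-- Limits of `rowSum` in the upper half plane; the limits in the lower one are opposite. -/
def rowLim (j : ℕ) : ℂ := if j = 0 then -(Real.pi / 3 * I) else 0

lemma tendsto_cot_of_im_atTop {α : Type*} {l : Filter α} {f : α → ℂ}
    (hf : Tendsto (fun n => (f n).im) l atTop) :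
    Tendsto (fun n => cot (Real.pi * f n)) l (𝓝 (-I)) := by
  have h1 : Tendsto (fun n => exp (2 * Real.pi * I * f n)) l (𝓝 0) := by
    rw [Complex.tendsto_exp_nhds_zero_iff]
    have h2 := hf.const_mul_atTop_of_neg (r := -(2 * Real.pi)) (by linarith [Real.pi_pos])
    refine h2.congr fun n => ?_
    simp
  have h3 : Tendsto (fun n => (exp (2 * Real.pi * I * f n) + 1) /
      (I * (1 - exp (2 * Real.pi * I * f n)))) l (𝓝 ((0 + 1) / (I * (1 - 0)))) :=
    (h1.add_const 1).div ((h1.const_sub 1).const_mul I) (by simp)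
  rw [show (0 + 1 : ℂ) / (I * (1 - 0)) = -I by simp] at h3
  exact h3.congr fun n => (cot_pi_eq_exp_ratio _).symm

lemma tendsto_rowSum_zero {α : Type*} {l : Filter α} [l.IsCountablyGenerated] {f : α → ℂ}
    {j : ℕ} (hj : j ≠ 0) (hf : Tendsto (fun n => |(f n).im|) l atTop) :
    Tendsto (fun n => rowSum j (f n)) l (𝓝 0) := by
  set g : α → ℂ := fun n => f n + 3 * ((-⌊(f n).re / 3⌋ : ℤ) : ℂ) with hg
  have him : ∀ n, (g n).im = (f n).im := fun n => by simp [hg]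
  have hre : ∀ n, 0 ≤ (g n).re ∧ (g n).re < 3 := fun n => by
    have h1 := Int.floor_le ((f n).re / 3)
    have h2 := Int.lt_floor_add_one ((f n).re / 3)
    have : (g n).re = (f n).re - 3 * ⌊(f n).re / 3⌋ := by simp [hg]; ring
    rw [this]
    constructor <;> linarith
  have hfg : ∀ n, rowSum j (f n) = ∑' m : ℤ, ((g n + 3 * m) ^ (j + 1))⁻¹ := fun n => by
    rw [← rowSum_add j (f n) (-⌊(f n).re / 3⌋), rowSum, if_neg hj]
  simp_rw [hfg]
  rw [← tsum_zero (β := ℤ) (α := ℂ)]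
  refine tendsto_tsum_of_dominated_convergence
    (bound := fun m : ℤ => 1 / (m : ℝ) ^ 2 + if m = 0 then 1 else 0) ?_ ?_ ?_
  · exact (Real.summable_one_div_int_pow.2 one_lt_two).add
      (summable_of_ne_finset_zero (s := {0}) fun m hm => if_neg (by simpa using hm))
  · intro m
    have h1 : Tendsto (fun n => ‖g n + 3 * m‖) l atTop := by
      refine tendsto_atTop_mono (fun n => ?_) hf
      have := abs_im_le_norm (g n + 3 * m)
      rw [add_im, him] at this
      simpa using this
    rw [tendsto_zero_iff_norm_tendsto_zero]
    simp_rw [norm_inv, norm_pow]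
    exact ((tendsto_pow_atTop (by omega)).comp h1).inv_tendsto_atTop
  · filter_upwards [hf.eventually_ge_atTop 1] with n hn m
    have h1 : 1 ≤ ‖g n + 3 * m‖ := by
      have := abs_im_le_norm (g n + 3 * m)
      rw [add_im, him] at this
      refine hn.trans ?_
      simpa using this
    have h2 : |(m : ℝ)| ≤ ‖g n + 3 * m‖ := by
      have h3 := abs_re_le_norm (g n + 3 * m)
      have h4 : (g n + 3 * m).re = (g n).re + 3 * m := by simp
      rw [h4] at h3
      obtain ⟨h5, h6⟩ := hre n
      rcases le_or_gt 0 m with hm | hm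
      · have : (0 : ℝ) ≤ m := by exact_mod_cast hm
        rw [abs_of_nonneg this]
        linarith [le_abs_self ((g n).re + 3 * m)]
      · rcases eq_or_ne m (-1) with rfl | hm1
        · simpa using h1
        · have : (m : ℝ) ≤ -2 := by
            have : m ≤ -2 := by omega
            exact_mod_cast this
          rw [abs_of_neg (by linarith)]
          linarith [neg_le_abs ((g n).re + 3 * m)]
    have h7 : ‖((g n + 3 * m) ^ (j + 1))⁻¹‖ ≤ (‖g n + 3 * m‖ ^ 2)⁻¹ := by
      rw [norm_inv, norm_pow]
      exact inv_anti₀ (by positivity) (pow_le_pow_right₀ h1 (by omega))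
    refine h7.trans ?_
    rcases eq_or_ne m 0 with rfl | hm
    · simpa using inv_le_one_of_one_le₀ (one_le_pow₀ (n := 2) h1)
    · rw [if_neg hm, add_zero, one_div, ← sq_abs (m : ℝ)]
      have : (0 : ℝ) < |(m : ℝ)| := abs_pos.2 (by exact_mod_cast hm)
      exact inv_anti₀ (by positivity) (pow_le_pow_left₀ this.le h2 2)

lemma tendsto_rowSum_rowLim {α : Type*} {l : Filter α} [l.IsCountablyGenerated] {f : α → ℂ}
    (j : ℕ) (hf : Tendsto (fun n => (f n).im) l atTop) :
    Tendsto (fun n => rowSum j (f n)) l (𝓝 (rowLim j)) := by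
  by_cases hj : j = 0
  · subst hj
    have h1 : Tendsto (fun n => (f n / 3).im) l atTop := by
      refine (hf.atTop_div_const (r := 3) (by norm_num)).congr fun n => ?_
      simp
    have h2 := (tendsto_cot_of_im_atTop h1).const_mul (Real.pi / 3 : ℂ)
    rw [mul_neg] at h2
    simpa only [rowSum, rowLim, if_true] using h2
  · rw [rowLim, if_neg hj]
    exact tendsto_rowSum_zero hj (tendsto_abs_atTop_atTop.comp hf)

lemma tendsto_rowSum_neg_rowLim {α : Type*} {l : Filter α} [l.IsCountablyGenerated] {f : α → ℂ}
    (j : ℕ) (hf : Tendsto (fun n => (f n).im) l atBot) :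
    Tendsto (fun n => rowSum j (f n)) l (𝓝 (-rowLim j)) := by
  by_cases hj : j = 0
  · subst hj
    have h0 : Tendsto (fun n => (-f n).im) l atTop := by
      simp_rw [neg_im]
      exact tendsto_neg_atBot_atTop.comp hf
    refine (tendsto_rowSum_rowLim 0 h0).neg.congr fun n => ?_
    rw [rowSum, rowSum, if_pos rfl, if_pos rfl, neg_div, mul_neg]
    simp [Complex.cot, div_neg]
  · rw [rowLim, if_neg hj, neg_zero]
    exact tendsto_rowSum_zero hj (tendsto_abs_atBot_atTop.comp hf)

/-- Telescoping sums of a two-sided sequence with limits at both ends. -/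
lemma tendsto_sum_sub_shift {f : ℤ → ℂ} {a b : ℂ} (ha : Tendsto f atTop (𝓝 a))
    (hb : Tendsto f atBot (𝓝 b)) (k : ℤ) :
    Tendsto (fun N : ℕ => ∑ n ∈ Finset.Ico (-N : ℤ) N, (f (n + k) - f n)) atTop
      (𝓝 (k * (a - b))) := by
  have key : ∀ i : ℤ, Tendsto (fun N : ℕ => ∑ n ∈ Finset.Ico (-N : ℤ) N,
      (f (n + (i + 1)) - f (n + i))) atTop (𝓝 (a - b)) := fun i => by
    have h1 : Tendsto (fun N : ℕ => f ((N : ℤ) + i)) atTop (𝓝 a) :=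
      ha.comp (tendsto_atTop_add_const_right _ _ tendsto_natCast_atTop_atTop)
    have h2 : Tendsto (fun N : ℕ => f (-(N : ℤ) + i)) atTop (𝓝 b) :=
      hb.comp (tendsto_atBot_add_const_right _ _
        (tendsto_neg_atTop_atBot.comp tendsto_natCast_atTop_atTop))
    refine (h1.sub h2).congr fun N => ?_
    have h3 := Finset.sum_Ico_int_sub N (fun n => f (n + i))
    rw [← neg_sub, ← h3, ← Finset.sum_neg_distrib]
    refine Finset.sum_congr rfl fun n _ => ?_
    rw [neg_sub]
    congr 2; ring
  induction k using Int.induction_on with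
  | zero => simp
  | succ i ih =>
    have := ih.add (key i)
    refine (this.congr fun N => ?_).trans_eq ?_
    · rw [← Finset.sum_add_distrib]
      exact Finset.sum_congr rfl fun n _ => by ring
    · push_cast; ring_nf
  | pred i ih =>
    have := ih.sub (key (-i - 1))
    refine (this.congr fun N => ?_).trans_eq ?_
    · rw [← Finset.sum_sub_distrib]
      refine Finset.sum_congr rfl fun n _ => ?_
      rw [sub_add_cancel]; ring
    · push_cast; ring_nf

end RowSums

section TraceFormula

open Filter Topology

variable {t : ℤ × ℤ →₀ ℂ}

lemma lpt_ne_zero_of_cls {x : ℤ × ℤ} (h : cls x ≠ 0) : lpt x ≠ 0 :=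
  mt lpt_eq_zero_iff.1 (ne_zero_of_cls h)

/-- The unperturbed parameter. -/
def Good.zero : Good := ⟨0, fun p hp => by
  rw [add_zero]; exact lpt_ne_zero_of_cls hp⟩

/-- The limit `rowLim` divided by `π`. -/
def rowLimCoeff (j : ℕ) : ℂ := if j = 0 then -(I / 3) else 0

lemma rowLim_eq (j : ℕ) : rowLim j = Real.pi * rowLimCoeff j := by
  rw [rowLim, rowLimCoeff]
  split_ifs
  · ring
  · ring

lemma isAlgebraic_I : IsAlgebraic ℚ I := by
  have h : IsAlgebraic ℚ (I ^ 2) := by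
    rw [I_sq]; exact isAlgebraic_one.neg
  exact h.of_pow two_pos

lemma isAlgebraic_rowLimCoeff (j : ℕ) : IsAlgebraic ℚ (rowLimCoeff j) := by
  rw [rowLimCoeff]
  split_ifs
  · rw [div_eq_mul_inv]
    have h3 : IsAlgebraic ℚ (3 : ℂ) := by exact_mod_cast isAlgebraic_natCast (R := ℚ) (A := ℂ) 3
    exact (isAlgebraic_I.mul h3.inv).neg
  · exact isAlgebraic_zero

/-- The row sum through `a + nω`, as a function of the row. -/
def rowFun (a : ℤ × ℤ) (j : ℕ) (n : ℤ) : ℂ := rowSum j (lpt a + 3 * ω * n)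

lemma im_rowFun_arg (a : ℤ × ℤ) (n : ℤ) :
    (lpt a + 3 * ω * n).im = (lpt a).im + 3 * (Real.sqrt 3 / 2) * n := by
  simp [omega_im]

lemma tendsto_rowFun_atTop (a : ℤ × ℤ) (j : ℕ) :
    Tendsto (rowFun a j) atTop (𝓝 (rowLim j)) := by
  refine tendsto_rowSum_rowLim j ?_
  simp_rw [im_rowFun_arg]
  exact tendsto_atTop_add_const_left _ _
    ((tendsto_intCast_atTop_atTop (R := ℝ)).const_mul_atTop (by positivity))

lemma tendsto_rowFun_atBot (a : ℤ × ℤ) (j : ℕ) :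
    Tendsto (rowFun a j) atBot (𝓝 (-rowLim j)) := by
  refine tendsto_rowSum_neg_rowLim j ?_
  simp_rw [im_rowFun_arg]
  refine tendsto_atBot_add_const_left _ _ ?_
  exact ((tendsto_intCast_atBot_iff (R := ℝ)).2 tendsto_id).const_mul_atBot (by positivity)

lemma rowFun_r3 (p : ℤ × ℤ) (j : ℕ) (n : ℤ) :
    rowSum j (lpt p + 3 * ω * n) = rowFun (r3 p) j (n + (q3 p).1) := by
  rw [rowFun, ← rowSum_add j (lpt (r3 p) + 3 * ω * (n + (q3 p).1 : ℤ)) (q3 p).2]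
  have h : lpt p = lpt (r3 p) + 3 * lpt (q3 p) := by
    rw [← lpt_tri, ← lpt_add, r3_add_tri_q3]
  rw [h]
  congr 1
  push_cast; simp only [lpt]; ring

lemma summable_diag_ent (t : ℤ × ℤ →₀ ℂ) {M : ℕ} (hM : 3 ≤ M) :
    Summable fun x => ent t (wt 0) M x x := by
  obtain ⟨C, -, hC⟩ := exists_rowBound t (wt 0) (C₀ := 2) norm_wt_zero_le M
  have hs := (summable_lpt_rpow (k := (M : ℝ)) (by
    have : (3 : ℝ) ≤ M := by exact_mod_cast hM
    linarith)).mul_left C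
  refine Summable.of_norm_bounded hs fun x => ?_
  have := hC x {x}
  rw [Finset.sum_singleton] at this
  refine this.trans_eq ?_
  rw [Real.rpow_neg (by positivity), Real.rpow_natCast, inv_pow]

/-- The traces of the powers of the unperturbed operator are `π` times algebraic numbers. -/
lemma exists_infTr_ent_eq (ht : ∀ d, t (rot d) = ω * t d) (halg : ∀ d, IsAlgebraic ℚ (t d))
    (n : ℕ) : ∃ q, IsAlgebraic ℚ q ∧ infTr (ent t (wt 0) 4) n = Real.pi * q := by
  obtain ⟨c, hcalg, hc⟩ := exists_partialFraction halg (4 * n + 3) blk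
  have hzero := sum_coeff_eq_zero ht (4 * n + 3) hc
  have hsum : Summable fun x => ent t (wt 0) (4 * n + 3 + 1) x x :=
    summable_diag_ent t (by omega)
  set G : ℤ × ℤ → ℂ := fun e => ∑ q ∈ c.support, c q * ((lpt (q.1.1 + tri e)) ^ (q.2 + 1))⁻¹
    with hG
  have hGe : ∀ e, ∑ x : blk, ent t (wt 0) (4 * n + 3 + 1) (x.1 + tri e) (x.1 + tri e) = G e := by
    intro e
    have h1 := hc (Good.zero.shift e)
    have h2 : (Good.zero.shift e).1 = 0 + lpt (tri e) := rfl
    rw [h2] at h1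
    simp_rw [ent_wt_add (cls_tri e), elemFrac_shift] at h1 ⊢
    rw [Finset.sum_coe_sort blk fun x => ent t (wt (0 + lpt (tri e))) (4 * n + 3 + 1) x x, h1]
    simp [hG, Good.zero]
  have hsum' := (blkEquiv.summable_iff (f := fun x => ent t (wt 0) (4 * n + 3 + 1) x x)).2 hsum
  have hτ : infTr (ent t (wt 0) 4) n = ∑' e, G e := by
    rw [infTr]
    simp_rw [infPow_ent]
    rw [show 4 * (n + 1) = 4 * n + 3 + 1 by ring, ← blkEquiv.tsum_eq]
    refine hsum'.tsum_prod.trans ?_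
    refine tsum_congr fun e => ?_
    rw [tsum_fintype, ← hGe]
    rfl
  have hGs : Summable G := by
    refine hsum'.prod.congr fun e => ?_
    rw [tsum_fintype, ← hGe]
    rfl
  set H : ℤ → ℂ := fun e => ∑ q ∈ c.support, c q * rowSum q.2 (lpt q.1.1 + 3 * ω * e) with hH
  have hGH : ∀ e₁, ∑' e₂, G (e₁, e₂) = H e₁ := by
    intro e₁
    have h1 := (hGs.prod_factor e₁).hasSum.comp Finset.tendsto_Icc_neg
    refine tendsto_nhds_unique h1 ?_
    have h2 : Tendsto (fun N : ℕ => ∑ q ∈ c.support, c q * ∑ m ∈ Finset.Icc (-N : ℤ) N,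
        ((lpt q.1.1 + 3 * ω * e₁ + 3 * m) ^ (q.2 + 1))⁻¹) atTop (𝓝 (H e₁)) := by
      refine tendsto_finsetSum _ fun q _ => (tendsto_rowSum q.2 fun m h0 => ?_).const_mul _
      refine lpt_ne_zero_of_cls (x := q.1.1 + tri (e₁, m)) ?_ ?_
      · rw [cls_add, cls_tri, add_zero]; exact q.1.2
      · rw [← h0, lpt_add, lpt_tri]; simp only [lpt]; ring
    refine h2.congr fun N => ?_
    simp only [Function.comp, hG, Finset.mul_sum]
    rw [Finset.sum_comm]
    refine Finset.sum_congr rfl fun m _ => Finset.sum_congr rfl fun q _ => ?_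
    rw [lpt_add, lpt_tri, show lpt q.1.1 + 3 * ω * e₁ + 3 * m = lpt q.1.1 + 3 * lpt (e₁, m) by
      simp only [lpt]; ring]
  have hHs : Summable H := hGs.prod.congr hGH
  have hτ' : infTr (ent t (wt 0) 4) n = ∑' e, H e := by
    rw [hτ, hGs.tsum_prod]
    exact tsum_congr hGH
  have hH' : ∀ e, H e = ∑ q ∈ c.support,
      c q * (rowFun (r3 q.1.1) q.2 (e + (q3 q.1.1).1) - rowFun (r3 q.1.1) q.2 e) := by
    intro e
    have h0 : ∑ q ∈ c.support, c q * rowFun (r3 q.1.1) q.2 e = 0 := by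
      rw [← Finset.sum_fiberwise_of_maps_to (g := fun q : PFIndex => (r3 q.1.1, q.2))
        (t := c.support.image fun q : PFIndex => (r3 q.1.1, q.2))
        (fun q hq => Finset.mem_image_of_mem _ hq)]
      refine Finset.sum_eq_zero fun b _ => ?_
      have := congrArg (· * rowFun b.1 b.2 e) (hzero b.1 b.2)
      simp only [zero_mul, Finset.sum_mul] at this
      rw [← this]
      refine Finset.sum_congr ?_ fun q hq => ?_
      · ext q
        simp only [Finset.mem_filter, Prod.ext_iff]
      · obtain ⟨-, h1, h2⟩ := Finset.mem_filter.1 hq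
        rw [h1, h2]
    simp_rw [mul_sub, Finset.sum_sub_distrib]
    rw [h0, sub_zero]
    exact Finset.sum_congr rfl fun q _ => by rw [rowFun_r3]
  refine ⟨∑ q ∈ c.support, c q * ((q3 q.1.1).1 * (2 * rowLimCoeff q.2)),
    isAlgebraic_finsetSum _ fun q => (hcalg q).mul ((isAlgebraic_intCast _).mul
      (IsAlgebraic.mul (by exact_mod_cast isAlgebraic_natCast (R := ℚ) (A := ℂ) 2)
        (isAlgebraic_rowLimCoeff _))), ?_⟩
  rw [hτ']
  refine tendsto_nhds_unique (hHs.hasSum.comp Finset.tendsto_Ico_neg) ?_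
  have h3 : Tendsto (fun N : ℕ => ∑ q ∈ c.support, c q * ∑ e ∈ Finset.Ico (-N : ℤ) N,
      (rowFun (r3 q.1.1) q.2 (e + (q3 q.1.1).1) - rowFun (r3 q.1.1) q.2 e)) atTop
      (𝓝 (∑ q ∈ c.support, c q * ((q3 q.1.1).1 * (rowLim q.2 - -rowLim q.2)))) :=
    tendsto_finsetSum _ fun q _ => (tendsto_sum_sub_shift (tendsto_rowFun_atTop _ _)
      (tendsto_rowFun_atBot _ _) _).const_mul _
  refine (h3.congr fun N => ?_).trans_eq ?_
  · simp only [Function.comp, hH', Finset.mul_sum]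
    rw [Finset.sum_comm]
  · rw [Finset.mul_sum]
    congr 1
    refine Finset.sum_congr rfl fun q _ => ?_
    rw [rowLim_eq]; ring

end TraceFormula

section Equivariant

open Filter Topology

variable {t : ℤ × ℤ →₀ ℂ}

/-- The projection onto sequences with `f (rot x) = ω⁻¹ f x`. -/
def rotProj : Module.End ℂ (ℤ × ℤ → ℂ) where
  toFun f x := (f x + ω * f (rot x) + ω ^ 2 * f (rot (rot x))) / 3
  map_add' f g := by ext x; simp only [Pi.add_apply]; ring
  map_smul' c f := by ext x; simp only [Pi.smul_apply, smul_eq_mul, RingHom.id_apply]; ring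

lemma rotProj_apply (f : ℤ × ℤ → ℂ) (x : ℤ × ℤ) :
    rotProj f x = (f x + ω * f (rot x) + ω ^ 2 * f (rot (rot x))) / 3 := rfl

lemma rotProj_rot (f : ℤ × ℤ → ℂ) (x : ℤ × ℤ) : rotProj f (rot x) = ω⁻¹ * rotProj f x := by
  rw [rotProj_apply, rotProj_apply, rot_rot_rot]
  field_simp [omega_ne_zero]
  linear_combination f x * omega_cube

lemma rotProj_eq_self {f : ℤ × ℤ → ℂ} (hf : ∀ x, f (rot x) = ω⁻¹ * f x) : rotProj f = f := by
  ext x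
  rw [rotProj_apply, hf (rot x), hf x]
  field_simp [omega_ne_zero]
  ring

lemma rotAt_zero : rotAt 0 = rot := by
  ext x <;> simp [rotAt]

lemma op_pow_comp_rot (ht : ∀ d, t (rot d) = ω * t d) (m : ℕ) (f : ℤ × ℤ → ℂ) :
    (op t (wt 0) ^ m) (f ∘ rot) = ((op t (wt 0) ^ m) f) ∘ rot := by
  have h : ∀ x, wt 0 (rotAt 0 x) = ω⁻¹ * wt 0 x := fun x => by
    simpa using wt_rotAt 0 x
  simpa only [rotAt_zero] using op_pow_comp_rotAt ht 0 h m f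

lemma op_pow_rotProj (ht : ∀ d, t (rot d) = ω * t d) (m : ℕ) (f : ℤ × ℤ → ℂ) :
    (op t (wt 0) ^ m) (rotProj f) = rotProj ((op t (wt 0) ^ m) f) := by
  have h : ∀ g : ℤ × ℤ → ℂ, rotProj g = (3⁻¹ : ℂ) • (g + ω • (g ∘ rot) + ω ^ 2 • ((g ∘ rot) ∘ rot)) :=
    fun g => by ext x; simp [rotProj_apply]; ring
  rw [h, h, map_smul, map_add, map_add, map_smul, map_smul, op_pow_comp_rot ht, op_pow_comp_rot ht,
    op_pow_comp_rot ht]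

/-- Matrix entries of the equivariant part of the powers of the unperturbed operator. -/
def entRot (t : ℤ × ℤ →₀ ℂ) (m : ℕ) (x y : ℤ × ℤ) : ℂ := rotProj (fun z => ent t (wt 0) m z y) x

lemma entRot_eq (m : ℕ) (x y : ℤ × ℤ) : entRot t m x y = (ent t (wt 0) m x y +
    ω * ent t (wt 0) m (rot x) y + ω ^ 2 * ent t (wt 0) m (rot (rot x)) y) / 3 := rfl

lemma hasSum_entRot_mul (m : ℕ) (f : ℤ × ℤ → ℂ) (x : ℤ × ℤ) :
    HasSum (fun z => entRot t m x z * f z) (rotProj ((op t (wt 0) ^ m) f) x) := by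
  have h := (((hasSum_ent_mul t (wt 0) m f x).add ((hasSum_ent_mul t (wt 0) m f (rot x)).mul_left
    ω)).add ((hasSum_ent_mul t (wt 0) m f (rot (rot x))).mul_left (ω ^ 2))).div_const 3
  refine h.congr_fun fun z => ?_
  rw [entRot_eq]; ring

lemma infPow_entRot (ht : ∀ d, t (rot d) = ω * t d) (m n : ℕ) (x y : ℤ × ℤ) :
    infPow (entRot t m) n x y = entRot t (m * (n + 1)) x y := by
  induction n generalizing x y with
  | zero => simp [infPow]
  | succ n ih =>
    rw [infPow]
    simp_rw [ih]
    have := (hasSum_entRot_mul (t := t) m (fun z => entRot t (m * (n + 1)) z y) x).tsum_eq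
    rw [this]
    have h1 : (fun z => entRot t (m * (n + 1)) z y)
        = rotProj ((op t (wt 0) ^ (m * (n + 1))) (Pi.single y 1)) := rfl
    rw [h1, op_pow_rotProj ht, rotProj_eq_self (rotProj_rot _),
      ← Module.End.mul_apply (op t (wt 0) ^ m), ← pow_add,
      show m + m * (n + 1) = m * (n + 1 + 1) by ring]
    rfl

lemma isAlgebraic_ent (halg : ∀ d, IsAlgebraic ℚ (t d)) (m : ℕ) (x y : ℤ × ℤ) :
    IsAlgebraic ℚ (ent t (wt 0) m x y) := by
  induction m generalizing x with
  | zero =>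
    rw [ent_zero]
    split_ifs
    exacts [isAlgebraic_one, isAlgebraic_zero]
  | succ m ih =>
    rw [ent_succ]
    refine IsAlgebraic.mul ?_ (isAlgebraic_finsetSum _ fun d => (halg d).mul (ih _))
    rw [wt]
    split_ifs
    · exact isAlgebraic_zero
    · rw [add_zero]; exact (isAlgebraic_lpt x).inv

/-- The trace of a power of the operator against a fixed-point-free rotation is a finite sum. -/
lemma summable_and_isAlgebraic_tsum_ent (halg : ∀ d, IsAlgebraic ℚ (t d)) (m : ℕ)
    {ρ : ℤ × ℤ → ℤ × ℤ} (hρ : Function.Injective fun x => ρ x - x) :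
    Summable (fun x => ent t (wt 0) m (ρ x) x) ∧
      IsAlgebraic ℚ (∑' x, ent t (wt 0) m (ρ x) x) := by
  have hz : ∀ x ∉ (reach t m).preimage (fun x => ρ x - x) hρ.injOn,
      ent t (wt 0) m (ρ x) x = 0 := fun x hx =>
    ent_eq_zero t (wt 0) fun h => hx (Finset.mem_preimage.2 h)
  refine ⟨summable_of_ne_finset_zero hz, ?_⟩
  rw [tsum_eq_sum hz]
  exact isAlgebraic_finsetSum _ fun x => isAlgebraic_ent halg m _ _

lemma injective_rot_sub : Function.Injective fun x => rot x - x := by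
  intro x y h
  simp only [rot, Prod.ext_iff, Prod.fst_sub, Prod.snd_sub] at h
  ext <;> omega

lemma injective_rot_rot_sub : Function.Injective fun x => rot (rot x) - x := by
  intro x y h
  simp only [rot, Prod.ext_iff, Prod.fst_sub, Prod.snd_sub] at h
  ext <;> omega

lemma exists_infTr_entRot_eq (ht : ∀ d, t (rot d) = ω * t d) (halg : ∀ d, IsAlgebraic ℚ (t d))
    (n : ℕ) : ∃ c, IsAlgebraic ℚ c ∧ infTr (entRot t 4) n = infTr (ent t (wt 0) 4) n / 3 + c := by
  obtain ⟨h1, h1'⟩ := summable_and_isAlgebraic_tsum_ent halg (4 * (n + 1)) injective_rot_sub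
  obtain ⟨h2, h2'⟩ := summable_and_isAlgebraic_tsum_ent halg (4 * (n + 1)) injective_rot_rot_sub
  have h0 := summable_diag_ent t (M := 4 * (n + 1)) (by omega)
  refine ⟨(ω * ∑' x, ent t (wt 0) (4 * (n + 1)) (rot x) x +
    ω ^ 2 * ∑' x, ent t (wt 0) (4 * (n + 1)) (rot (rot x)) x) / 3, ?_, ?_⟩
  · rw [div_eq_mul_inv]
    have h3 : IsAlgebraic ℚ (3 : ℂ) := by exact_mod_cast isAlgebraic_natCast (R := ℚ) (A := ℂ) 3
    exact ((isAlgebraic_omega.mul h1').add ((isAlgebraic_omega.pow 2).mul h2')).mul h3.inv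
  · simp_rw [infTr, infPow_entRot ht, infPow_ent]
    have h := (((h0.hasSum.add (h1.hasSum.mul_left ω)).add
      (h2.hasSum.mul_left (ω ^ 2))).div_const 3).tsum_eq
    rw [← add_div, ← add_assoc, ← h]
    rfl

/-- Bounded sequences with `f (rot x) = ω⁻¹ f x`. -/
def rotBdd : Submodule ℂ (ℤ × ℤ → ℂ) where
  carrier := {f | (∃ C, ∀ x, ‖f x‖ ≤ C) ∧ ∀ x, f (rot x) = ω⁻¹ * f x}
  add_mem' := by
    rintro f g ⟨⟨C, hC⟩, hf⟩ ⟨⟨D, hD⟩, hg⟩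
    refine ⟨⟨C + D, fun x => (norm_add_le _ _).trans (add_le_add (hC x) (hD x))⟩, fun x => ?_⟩
    rw [Pi.add_apply, Pi.add_apply, hf, hg]; ring
  zero_mem' := ⟨⟨0, fun x => by simp⟩, fun x => by simp⟩
  smul_mem' := by
    rintro c f ⟨⟨C, hC⟩, hf⟩
    refine ⟨⟨‖c‖ * C, fun x => ?_⟩, fun x => ?_⟩
    · rw [Pi.smul_apply, norm_smul]; exact mul_le_mul_of_nonneg_left (hC x) (norm_nonneg c)
    · rw [Pi.smul_apply, Pi.smul_apply, hf, smul_eq_mul, smul_eq_mul]; ring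

lemma op_mem_rotBdd (ht : ∀ d, t (rot d) = ω * t d) {f : ℤ × ℤ → ℂ} (hf : f ∈ rotBdd) :
    op t (wt 0) f ∈ rotBdd := by
  obtain ⟨⟨C, hC⟩, hf⟩ := hf
  refine ⟨⟨2 * ∑ d ∈ t.support, ‖t d‖ * C, fun x => ?_⟩, fun x => ?_⟩
  · rw [op_apply, norm_mul]
    refine mul_le_mul ((norm_wt_zero_le x).trans ?_) ?_ (norm_nonneg _) (by norm_num)
    · have : (1 + ‖lpt x‖)⁻¹ ≤ 1 := inv_le_one_of_one_le₀ (by linarith [norm_nonneg (lpt x)])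
      linarith
    · refine (norm_sum_le _ _).trans (Finset.sum_le_sum fun d _ => ?_)
      rw [norm_mul]
      exact mul_le_mul_of_nonneg_left (hC _) (norm_nonneg _)
  · have h := op_pow_rotProj ht 1 f
    rw [pow_one, rotProj_eq_self hf] at h
    rw [h, rotProj_rot]

/-- An operator whose fourth power fixes a nonzero vector has an eigenvalue of order four. -/
lemma exists_eigenvector_of_pow_four {E : Type*} [AddCommGroup E] [Module ℂ E] (V : Submodule ℂ E)
    (A : Module.End ℂ E) (hV : ∀ f ∈ V, A f ∈ V) {c : E} (hc : c ∈ V) (hc0 : c ≠ 0)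
    (h : A (A (A (A c))) = c) : ∃ γ : ℂ, γ ^ 4 = 1 ∧ ∃ f ∈ V, f ≠ 0 ∧ A f = γ • f := by
  by_cases h1 : A c - c = 0
  · exact ⟨1, one_pow 4, c, hc, hc0, by rw [one_smul]; exact sub_eq_zero.1 h1⟩
  have m1 : A c - c ∈ V := V.sub_mem (hV _ hc) hc
  by_cases h2 : A (A c - c) + (A c - c) = 0
  · exact ⟨-1, by norm_num, _, m1, h1, by rw [neg_smul, one_smul]; exact eq_neg_of_add_eq_zero_left h2⟩
  have m2 : A (A c - c) + (A c - c) ∈ V := V.add_mem (hV _ m1) m1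
  have e2 : A (A c - c) + (A c - c) = A (A c) - c := by rw [map_sub]; abel
  rw [e2] at h2 m2
  by_cases h3 : A (A (A c) - c) - I • (A (A c) - c) = 0
  · exact ⟨I, I_pow_four, _, m2, h2, sub_eq_zero.1 h3⟩
  refine ⟨-I, by rw [neg_pow, I_pow_four]; norm_num, _, V.sub_mem (hV _ m2) (V.smul_mem I m2), h3, ?_⟩
  have hI : I • I • (A (A c) - c) = -(A (A c) - c) := by
    rw [smul_smul, I_mul_I, neg_smul, one_smul]
  rw [map_sub, map_smul, smul_sub, neg_smul, neg_smul, hI, map_sub, map_sub, h]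
  abel

/-- If the unperturbed operator has a bounded eigenvector, then it has infinitely many eigenvalues
with equivariant bounded eigenvectors. -/
theorem infinite_equivariant_eigenvalues (ht : ∀ d, t (rot d) = ω * t d)
    (htalg : ∀ d, IsAlgebraic ℚ (t d)) {α₀ : ℂ} {f : ℤ × ℤ → ℂ} (hf0 : f ≠ 0) {C₀ : ℝ}
    (hfb : ∀ x, ‖f x‖ ≤ C₀) (hf : f = α₀ • op t (wt 0) f) :
    {α : ℂ | ∃ c ∈ rotBdd, c ≠ 0 ∧ c = α • op t (wt 0) c}.Infinite := by
  intro hfin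
  obtain ⟨C, hC0, hC⟩ := exists_rowBound t (wt 0) (C₀ := 2) norm_wt_zero_le 4
  set r : ℤ × ℤ → ℝ := fun x => C * ((1 + ‖lpt x‖)⁻¹) ^ 4 with hr
  have hB : RowBdd (ent t (wt 0) 4) r := hC
  have hrR : ∀ x, r x ≤ C := fun x => by
    have : (1 + ‖lpt x‖)⁻¹ ≤ 1 := inv_le_one_of_one_le₀ (by linarith [norm_nonneg (lpt x)])
    exact mul_le_of_le_one_right hC0 (pow_le_one₀ (by positivity) this)
  have hrs : Summable r := by
    refine ((summable_lpt_rpow (k := 4) (by norm_num)).mul_left C).congr fun x => ?_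
    simp only [hr]
    rw [Real.rpow_neg (by positivity), inv_pow]
    norm_cast
  have hrs' : Summable fun x => r x ^ (3 / 4 : ℝ) := by
    refine ((summable_lpt_rpow (k := 3) (by norm_num)).mul_left (C ^ (3 / 4 : ℝ))).congr fun x => ?_
    have hp : (0 : ℝ) ≤ 1 + ‖lpt x‖ := by positivity
    rw [hr, Real.mul_rpow hC0 (by positivity), inv_pow, Real.inv_rpow (by positivity),
      ← Real.rpow_natCast, ← Real.rpow_mul hp, Real.rpow_neg hp]
    norm_num
  have hB1 : RowBdd (entRot t 4) r := by
    intro x T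
    have hb : ∀ y ∈ T, ‖entRot t 4 x y‖ ≤ (‖ent t (wt 0) 4 x y‖ + ‖ent t (wt 0) 4 (rot x) y‖ +
        ‖ent t (wt 0) 4 (rot (rot x)) y‖) / 3 := by
      intro y _
      rw [entRot_eq, norm_div]
      have h3 : ‖(3 : ℂ)‖ = 3 := by norm_num
      rw [h3]
      gcongr
      refine (norm_add₃_le ..).trans_eq ?_
      rw [norm_mul, norm_mul, norm_pow, norm_omega]; ring
    refine (Finset.sum_le_sum hb).trans ?_
    rw [← Finset.sum_div, Finset.sum_add_distrib, Finset.sum_add_distrib]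
    have h1 := hB x T
    have h2 := hB (rot x) T
    have h3 := hB (rot (rot x)) T
    have e2 : r (rot x) = r x := by simp only [hr, norm_lpt_rot]
    have e3 : r (rot (rot x)) = r x := by simp only [hr, norm_lpt_rot]
    linarith
  have hzeros : {μ : ℂ | detI (fun x y => μ * entRot t 4 x y) = 0}.Finite := by
    refine (hfin.image (· ^ 4)).subset fun μ hμ => ?_
    obtain ⟨c, ⟨w, hw⟩, hcb, hc⟩ := exists_fixed_of_detI_eq_zero (hB1.smul μ) (hrs.mul_left _) hμ
    have hc' : c = μ • rotProj ((op t (wt 0) ^ 4) c) := by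
      ext x
      refine (hc x).unique ?_
      have h := (hasSum_entRot_mul (t := t) 4 c x).mul_left μ
      simp_rw [← mul_assoc] at h
      exact h
    have hcr : ∀ x, c (rot x) = ω⁻¹ * c x := fun x => by
      rw [hc', Pi.smul_apply, Pi.smul_apply, rotProj_rot, smul_eq_mul, smul_eq_mul]; ring
    rw [← op_pow_rotProj ht, rotProj_eq_self hcr] at hc'
    obtain ⟨β, hβ⟩ := IsAlgClosed.exists_pow_nat_eq μ (n := 4) (by norm_num)
    have hcm : c ∈ rotBdd := ⟨⟨1, hcb⟩, hcr⟩
    obtain ⟨γ, hγ, g, hgm, hg0, hg⟩ := exists_eigenvector_of_pow_four rotBdd (β • op t (wt 0))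
      (fun f hf => rotBdd.smul_mem β (op_mem_rotBdd ht hf)) hcm (fun h => hw (by rw [h]; rfl)) (by
        have : ((β • op t (wt 0)) ^ 4) c = c := by
          rw [smul_pow, hβ]; exact hc'.symm
        simpa only [pow_succ, pow_zero, one_mul, Module.End.mul_apply] using this)
    have hγ0 : γ ≠ 0 := by rintro rfl; norm_num at hγ
    refine ⟨γ⁻¹ * β, ⟨g, hgm, hg0, ?_⟩, ?_⟩
    · rw [mul_smul]
      have : β • op t (wt 0) g = γ • g := hg
      rw [this, smul_smul, inv_mul_cancel₀ hγ0, one_smul]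
    · simp only [mul_pow, inv_pow, hγ, hβ, inv_one, one_mul]
  choose q hq hτ using fun n => exists_infTr_ent_eq ht htalg n
  choose c hc hτc using fun n => exists_infTr_entRot_eq ht htalg n
  have h3 : IsAlgebraic ℚ (3 : ℂ) := by exact_mod_cast isAlgebraic_natCast (R := ℚ) (A := ℂ) 3
  have hq0 := pi_part_eq_zero_of_finite_zeros hB1 hrs hrs' hrR (q := fun n => q n * 3⁻¹)
    (fun n => (hq n).mul h3.inv) hc (fun n => by rw [hτc, hτ]; ring) hzeros
  have hτ0 : ∀ n, infTr (ent t (wt 0) 4) n = 0 := fun n => by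
    have := hq0 n
    have : q n = 0 := by simpa using this
    rw [hτ, this, mul_zero]
  have h1 := detI_smul_eq_one_of_infTr_eq_zero hB hrs hrR hτ0 (α₀ ^ 4)
  obtain ⟨w, hw⟩ := Function.ne_iff.1 hf0
  have hf4 : f = α₀ ^ 4 • (op t (wt 0) ^ 4) f := by
    have hs : ((α₀ • op t (wt 0)) ^ 4) f = f := by
      have : (α₀ • op t (wt 0)) f = f := hf.symm
      simp only [pow_succ, pow_zero, one_mul, Module.End.mul_apply, this]
    rw [smul_pow] at hs
    exact hs.symm
  have h0 := detI_eq_zero_of_fixed (hB.smul (α₀ ^ 4)) (hrs.mul_left _) hfb (fun x => by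
    have h := (hasSum_ent_mul t (wt 0) 4 f x).mul_left (α₀ ^ 4)
    have e : α₀ ^ 4 * ((op t (wt 0) ^ 4) f) x = f x := (congrFun hf4 x).symm
    rw [e] at h
    simpa only [mul_assoc] using h) hw
  rw [h1] at h0
  exact one_ne_zero h0

end Equivariant

section DbarCalculus

lemma pair_eq (p z : ℂ) : pair p z = p.re * z.re + p.im * z.im := by
  simp [pair]

lemma pair_add_left (p q z : ℂ) : pair (p + q) z = pair p z + pair q z := by
  simp [pair_eq]; ring

lemma pair_add_right (p z w : ℂ) : pair p (z + w) = pair p z + pair p w := by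
  simp [pair_eq]; ring

lemma pair_comm (p z : ℂ) : pair p z = pair z p := by
  simp [pair_eq]; ring

/-- The real linear form `z ↦ ⟨p, z⟩`. -/
def pairL (p : ℂ) : ℂ →L[ℝ] ℝ := p.re • reCLM + p.im • imCLM

lemma pairL_apply (p z : ℂ) : pairL p z = pair p z := by
  simp [pairL, pair_eq]

lemma norm_pairL_le (p : ℂ) : ‖pairL p‖ ≤ 2 * ‖p‖ := by
  refine ContinuousLinearMap.opNorm_le_bound _ (by positivity) fun z => ?_
  rw [pairL_apply, pair_eq, Real.norm_eq_abs]
  have h1 := abs_re_le_norm p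
  have h2 := abs_im_le_norm p
  have h3 := abs_re_le_norm z
  have h4 := abs_im_le_norm z
  calc |p.re * z.re + p.im * z.im| ≤ |p.re| * |z.re| + |p.im| * |z.im| := by
        rw [← abs_mul, ← abs_mul]; exact abs_add_le _ _
    _ ≤ ‖p‖ * ‖z‖ + ‖p‖ * ‖z‖ := by gcongr
    _ = 2 * ‖p‖ * ‖z‖ := by ring

lemma Dbar_of_hasFDerivAt {f : ℂ → ℂ} {f' : ℂ →L[ℝ] ℂ} {z : ℂ} (h : HasFDerivAt f f' z) :
    Dbar f z = -I * f' 1 + f' I := by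
  rw [Dbar, h.fderiv, one_div, Complex.inv_I]
  linear_combination (-(f' I)) * Complex.I_sq

lemma Dbar_mul {f g : ℂ → ℂ} {z : ℂ} (hf : DifferentiableAt ℝ f z)
    (hg : DifferentiableAt ℝ g z) :
    Dbar (fun w => f w * g w) z = Dbar f z * g z + f z * Dbar g z := by
  rw [show (fun w => f w * g w) = f * g from rfl,
    Dbar_of_hasFDerivAt (hf.hasFDerivAt.mul hg.hasFDerivAt), Dbar_of_hasFDerivAt hf.hasFDerivAt,
    Dbar_of_hasFDerivAt hg.hasFDerivAt]
  simp
  ring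

lemma Dbar_add {f g : ℂ → ℂ} {z : ℂ} (hf : DifferentiableAt ℝ f z)
    (hg : DifferentiableAt ℝ g z) :
    Dbar (fun w => f w + g w) z = Dbar f z + Dbar g z := by
  rw [show (fun w => f w + g w) = f + g from rfl,
    Dbar_of_hasFDerivAt (hf.hasFDerivAt.add hg.hasFDerivAt), Dbar_of_hasFDerivAt hf.hasFDerivAt,
    Dbar_of_hasFDerivAt hg.hasFDerivAt]
  simp
  ring

lemma Dbar_const_mul {f : ℂ → ℂ} {z : ℂ} (c : ℂ) (hf : DifferentiableAt ℝ f z) :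
    Dbar (fun w => c * f w) z = c * Dbar f z := by
  rw [Dbar_of_hasFDerivAt (hf.hasFDerivAt.const_mul c), Dbar_of_hasFDerivAt hf.hasFDerivAt]
  simp
  ring

lemma Dbar_eq_zero_of_differentiableAt {f : ℂ → ℂ} {z : ℂ} (hf : DifferentiableAt ℂ f z) :
    Dbar f z = 0 := by
  rw [Dbar_of_hasFDerivAt hf.hasDerivAt.complexToReal_fderiv]
  simp
  ring

lemma Dbar_congr {f g : ℂ → ℂ} {z : ℂ} (h : f =ᶠ[nhds z] g) : Dbar f z = Dbar g z := by
  rw [Dbar, Dbar, h.fderiv_eq]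

lemma hasFDerivAt_exp_pair (p z : ℂ) :
    HasFDerivAt (fun w => exp (I * (pair p w : ℂ)))
      ((exp (I * (pair p z : ℂ)) * I) • ofRealCLM.comp (pairL p)) z := by
  have h : HasFDerivAt (fun w => I * ((ofRealCLM.comp (pairL p)) w))
      (I • ofRealCLM.comp (pairL p)) z :=
    (ofRealCLM.comp (pairL p)).hasFDerivAt.const_mul I
  have := h.cexp
  simp only [ContinuousLinearMap.comp_apply, pairL_apply, ofRealCLM_apply, smul_smul] at this
  exact this

lemma Dbar_exp_pair (p z : ℂ) :
    Dbar (fun w => exp (I * (pair p w : ℂ))) z = p * exp (I * (pair p z : ℂ)) := by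
  rw [Dbar_of_hasFDerivAt (hasFDerivAt_exp_pair p z)]
  simp [pairL_apply, pair_eq]
  generalize exp (I * (p.re * z.re + p.im * z.im)) = e
  linear_combination (-(p.re * e)) * Complex.I_sq + e * re_add_im p

lemma contDiff_exp_pair (p : ℂ) {n : WithTop ℕ∞} :
    ContDiff ℝ n (fun w => exp (I * (pair p w : ℂ))) := by
  have : ContDiff ℝ n (fun w => exp (I * ((ofRealCLM.comp (pairL p)) w))) := by fun_prop
  simpa only [ContinuousLinearMap.comp_apply, pairL_apply, ofRealCLM_apply] using this

end DbarCalculus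

section Characters

/-- The plane wave with frequency `K · lpt x`. -/
def chi (x : ℤ × ℤ) (z : ℂ) : ℂ := exp (I * (pair (K * lpt x) z : ℂ))

lemma K_re : K.re = 4 * Real.pi / 3 := by
  have : K = ((4 * Real.pi / 3 : ℝ) : ℂ) := by rw [K]; push_cast; ring
  rw [this, ofReal_re]

lemma K_im : K.im = 0 := by
  have : K = ((4 * Real.pi / 3 : ℝ) : ℂ) := by rw [K]; push_cast; ring
  rw [this, ofReal_im]

lemma K_ne_zero : K ≠ 0 := by
  intro h
  have := congrArg re h
  rw [K_re, zero_re] at this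
  have := Real.pi_pos
  linarith

lemma chi_add_left (x y : ℤ × ℤ) (z : ℂ) : chi (x + y) z = chi x z * chi y z := by
  simp only [chi, lpt_add, mul_add, pair_add_left]
  rw [← exp_add]; push_cast; ring_nf

lemma chi_add_right (x : ℤ × ℤ) (z w : ℂ) : chi x (z + w) = chi x z * chi x w := by
  simp only [chi, pair_add_right]
  rw [← exp_add]; push_cast; ring_nf

@[simp] lemma chi_zero_left (z : ℂ) : chi 0 z = 1 := by
  simp [chi, pair_eq]

@[simp] lemma chi_zero_right (x : ℤ × ℤ) : chi x 0 = 1 := by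
  simp [chi, pair_eq]

lemma chi_neg_left (x : ℤ × ℤ) (z : ℂ) : chi (-x) z = chi x (-z) := by
  simp [chi, pair_eq, lpt_neg]
  ring_nf

lemma norm_chi (x : ℤ × ℤ) (z : ℂ) : ‖chi x z‖ = 1 := by
  rw [chi, mul_comm, norm_exp_ofReal_mul_I]

lemma chi_ne_zero (x : ℤ × ℤ) (z : ℂ) : chi x z ≠ 0 := exp_ne_zero _

lemma contDiff_chi (x : ℤ × ℤ) {n : WithTop ℕ∞} : ContDiff ℝ n (chi x) := contDiff_exp_pair _

lemma continuous_chi (x : ℤ × ℤ) : Continuous (chi x) := (contDiff_chi x (n := 0)).continuous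

lemma differentiable_chi (x : ℤ × ℤ) : Differentiable ℝ (chi x) :=
  (contDiff_chi x (n := 1)).differentiable one_ne_zero

lemma Dbar_chi (x : ℤ × ℤ) (z : ℂ) : Dbar (chi x) z = K * lpt x * chi x z :=
  Dbar_exp_pair _ z

lemma lpt_re (x : ℤ × ℤ) : (lpt x).re = x.2 - x.1 / 2 := by
  simp [lpt, omega_re, omega_im]; ring

lemma lpt_im (x : ℤ × ℤ) : (lpt x).im = x.1 * (Real.sqrt 3 / 2) := by
  simp [lpt, omega_re, omega_im]

lemma chi_omega_mul (x : ℤ × ℤ) (z : ℂ) : chi x (ω * z) = chi (rot (rot x)) z := by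
  have h3 : (Real.sqrt 3) ^ 2 = 3 := Real.sq_sqrt (by norm_num)
  have : pair (K * lpt x) (ω * z) = pair (K * lpt (rot (rot x))) z := by
    simp only [pair_eq, mul_re, mul_im, lpt_re, lpt_im, K_re, K_im, omega_re, omega_im, rot]
    push_cast
    linear_combination (x.1 * Real.pi * z.re / 3) * h3
  rw [chi, this, chi]

/-- The point of the plane with lattice coordinates `(s, t)`. -/
def tor (s t : ℝ) : ℂ := s * ω + t

lemma pair_tor (x : ℤ × ℤ) (s t : ℝ) :
    pair (K * lpt x) (tor s t) =
      2 * Real.pi / 3 * (s * (2 * x.1 - x.2) + t * (2 * x.2 - x.1)) := by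
  have h3 : (Real.sqrt 3) ^ 2 = 3 := Real.sq_sqrt (by norm_num)
  simp only [pair_eq, tor, mul_re, mul_im, add_re, add_im, lpt_re, lpt_im, K_re, K_im, omega_re,
    omega_im, ofReal_re, ofReal_im]
  linear_combination (x.1 * s * Real.pi / 3) * h3

lemma tor_intCast (m n : ℤ) : tor m n = m * ω + n := by simp [tor]

lemma chi_lattice_of_cls_zero {x : ℤ × ℤ} (hx : cls x = 0) {γ : ℂ} (hγ : γ ∈ Λ) : chi x γ = 1 := by
  obtain ⟨m, n, rfl⟩ := hγ
  rw [← tor_intCast, chi, pair_tor]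
  obtain ⟨j, hj⟩ := (ZMod.intCast_zmod_eq_zero_iff_dvd _ 3).1 hx
  have h : x.1 = 3 * j - x.2 := by push_cast at hj; linarith
  rw [show I * ((2 * Real.pi / 3 * (m * (2 * x.1 - x.2) + n * (2 * x.2 - x.1)) : ℝ) : ℂ)
    = ((m * (2 * j - x.2) + n * (x.2 - j) : ℤ) : ℂ) * (2 * Real.pi * I) by
      rw [h]; push_cast; ring]
  exact exp_int_mul_two_pi_mul_I _

/-- The Floquet multiplier of the class-one plane waves. -/
lemma chi_lattice_of_cls_one {x : ℤ × ℤ} (hx : cls x = 1) {γ : ℂ} (hγ : γ ∈ Λ) :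
    chi x γ = exp (I * (pair γ K : ℂ)) := by
  have h0 : cls (x - (0, 1)) = 0 := by
    rw [cls_sub, hx]; simp [cls]
  have := chi_add_left (x - (0, 1)) (0, 1) γ
  rw [sub_add_cancel, chi_lattice_of_cls_zero h0 hγ, one_mul] at this
  rw [this, chi, pair_comm]
  simp [lpt]

lemma chi_lattice_of_cls_two {x : ℤ × ℤ} (hx : cls x = 2) {γ : ℂ} (hγ : γ ∈ Λ) :
    chi x γ = exp (-I * (pair γ K : ℂ)) := by
  have h1 : cls (-x) = 1 := by rw [cls_neg, hx]; decide
  have h2 := chi_lattice_of_cls_one h1 hγ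
  have h3 := chi_add_left x (-x) γ
  rw [add_neg_cancel, chi_zero_left, h2] at h3
  rw [neg_mul, exp_neg]
  exact eq_inv_of_mul_eq_one_left h3.symm

end Characters

section Potential

/-- The plane wave `chi x` as a multiplicative character of the plane. -/
def chiHom (x : ℤ × ℤ) : Multiplicative ℂ →* ℂ where
  toFun z := chi x z.toAdd
  map_one' := by simp
  map_mul' z w := by simp [chi_add_right]

lemma chiHom_injective : Function.Injective chiHom := fun x y h => by
  have : chi x = chi y := funext fun z => DFunLike.congr_fun h (Multiplicative.ofAdd z)
  have h2 : Dbar (chi x) 0 = Dbar (chi y) 0 := by rw [this]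
  rw [Dbar_chi, Dbar_chi, chi_zero_right, chi_zero_right, mul_one, mul_one] at h2
  exact lpt_injective (mul_left_cancel₀ K_ne_zero h2)

/-- The trigonometric polynomial with Fourier coefficients `b`. -/
def trig (b : ℤ × ℤ →₀ ℂ) (z : ℂ) : ℂ := b.sum fun d a => a * chi d z

lemma trig_smul (r : ℂ) (b : ℤ × ℤ →₀ ℂ) (z : ℂ) : trig (r • b) z = r * trig b z := by
  rw [trig, Finsupp.sum_smul_index' (fun _ => zero_mul _), trig, Finsupp.mul_sum]
  simp only [smul_eq_mul, mul_assoc]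

lemma trig_sum {ι : Type*} (s : Finset ι) (b : ι → ℤ × ℤ →₀ ℂ) (z : ℂ) :
    trig (∑ i ∈ s, b i) z = ∑ i ∈ s, trig (b i) z :=
  (Finsupp.sum_finsetSum_index (fun _ => zero_mul _) fun _ _ _ => add_mul _ _ _).symm

lemma trig_single (d : ℤ × ℤ) (a z : ℂ) : trig (Finsupp.single d a) z = a * chi d z :=
  Finsupp.sum_single_index (zero_mul _)

lemma trig_mapDomain (f : ℤ × ℤ → ℤ × ℤ) (b : ℤ × ℤ →₀ ℂ) (z : ℂ) :
    trig (b.mapDomain f) z = b.sum fun d a => a * chi (f d) z :=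
  Finsupp.sum_mapDomain_index (fun _ => zero_mul _) fun _ _ _ => add_mul _ _ _

lemma trig_injective {b c : ℤ × ℤ →₀ ℂ} (h : ∀ z, trig b z = trig c z) : b = c := by
  have hl := (linearIndependent_monoidHom (Multiplicative ℂ) ℂ).comp chiHom chiHom_injective
  refine hl ?_
  ext z
  have := h z.toAdd
  simpa [Finsupp.linearCombination_apply, Finsupp.sum, trig, chiHom, Finset.sum_apply] using this

lemma contDiff_trig (b : ℤ × ℤ →₀ ℂ) {n : WithTop ℕ∞} : ContDiff ℝ n (trig b) :=
  ContDiff.sum fun d _ => contDiff_const.mul (contDiff_chi d)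

lemma trig_neg (b : ℤ × ℤ →₀ ℂ) (z : ℂ) : trig b (-z) = trig (b.mapDomain Neg.neg) z := by
  rw [trig_mapDomain]
  simp only [chi_neg_left, trig]

lemma mapDomain_neg_apply (b : ℤ × ℤ →₀ ℂ) (d : ℤ × ℤ) : b.mapDomain Neg.neg d = b (-d) := by
  conv_lhs => rw [← neg_neg d]
  exact Finsupp.mapDomain_apply neg_injective _ _

lemma trig_omega_mul (b : ℤ × ℤ →₀ ℂ) (z : ℂ) :
    trig b (ω * z) = trig (b.mapDomain fun d => rot (rot d)) z := by
  rw [trig_mapDomain]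
  simp only [chi_omega_mul, trig]

lemma apply_rot_of_trig_omega_mul {b : ℤ × ℤ →₀ ℂ} (h : ∀ z, trig b (ω * z) = ω * trig b z)
    (d : ℤ × ℤ) : b (rot d) = ω * b d := by
  have hm : (b.mapDomain fun d => rot (rot d)) = ω • b := trig_injective fun z => by
    rw [← trig_omega_mul, trig_smul, h]
  have hinj : Function.Injective fun d => rot (rot d) :=
    rotEquiv.injective.comp rotEquiv.injective
  have := DFunLike.congr_fun hm (rot (rot (rot d)))
  rwa [Finsupp.mapDomain_apply (f := fun d => rot (rot d)) hinj, rot_rot_rot] at this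

lemma exists_lpt_of_mem_Λdual {p : ℂ} (hp : p ∈ Λdual) :
    ∃ d : ℤ × ℤ, cls d = 1 ∧ p + K = K * lpt d := by
  obtain ⟨m, n, rfl⟩ := hp
  refine ⟨(2 * n - m, n - 2 * m + 1), ?_, ?_⟩
  · have : (2 * n - m) + (n - 2 * m + 1) = 3 * (n - m) + 1 := by ring
    simp only [cls, this]
    push_cast
    rw [show (3 : ZMod 3) = 0 from rfl, zero_mul, zero_add]
  · have h3 : ((Real.sqrt 3 : ℝ) : ℂ) ^ 2 = 3 := by
      exact_mod_cast congrArg ((↑) : ℝ → ℂ) (Real.sq_sqrt (show (0 : ℝ) ≤ 3 by norm_num))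
    have h0 : ((Real.sqrt 3 : ℝ) : ℂ) ≠ 0 := by
      intro h; rw [h] at h3; norm_num at h3
    have hi : I * (Real.sqrt 3 : ℝ) = 1 + 2 * ω := by rw [omega_eq]; push_cast; ring
    have e : 4 * Real.pi * I / (Real.sqrt 3 : ℝ) = K * (1 + 2 * ω) := by
      rw [← hi, K, div_eq_iff h0]; linear_combination (-(4 * Real.pi / 3) * I) * h3
    rw [e]
    simp only [lpt]
    push_cast
    linear_combination (2 * K * m) * omega_sq

lemma isAlgebraic_sqrt_three : IsAlgebraic ℚ ((Real.sqrt 3 : ℝ) : ℂ) := by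
  refine IsAlgebraic.of_pow (n := 2) two_pos ?_
  have h3 : ((Real.sqrt 3 : ℝ) : ℂ) ^ 2 = ((3 : ℕ) : ℂ) := by
    exact_mod_cast congrArg ((↑) : ℝ → ℂ) (Real.sq_sqrt (show (0 : ℝ) ≤ 3 by norm_num))
  rw [h3]
  exact isAlgebraic_natCast 3

lemma isAlgebraic_inv_K_mul {c : ℂ} (hc : InPiQomega c) : IsAlgebraic ℚ (K⁻¹ * c) := by
  obtain ⟨q, hq, rfl⟩ := hc
  have hqa : IsAlgebraic ℚ q := by
    have hle : Subfield.closure {ω / (Real.sqrt 3 : ℂ)} ≤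
        (algebraicClosure ℚ ℂ).toSubfield := by
      rw [Subfield.closure_le, Set.singleton_subset_iff]
      change _ ∈ algebraicClosure ℚ ℂ
      rw [mem_algebraicClosure_iff, div_eq_mul_inv]
      exact isAlgebraic_omega.mul isAlgebraic_sqrt_three.inv
    exact mem_algebraicClosure_iff.1 (hle hq)
  have hpi : (Real.pi : ℂ) ≠ 0 := by exact_mod_cast Real.pi_ne_zero
  have : K⁻¹ * (Real.pi * q) = ((3 : ℕ) : ℂ) * ((4 : ℕ) : ℂ)⁻¹ * q := by
    rw [K]; push_cast; field_simp
  rw [this]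
  exact ((isAlgebraic_natCast 3).mul (isAlgebraic_natCast 4).inv).mul hqa

/-- The convolution kernel attached to a potential. -/
def hop (b : ℤ × ℤ →₀ ℂ) : ℤ × ℤ →₀ ℂ := K⁻¹ • (b + b.mapDomain Neg.neg)

lemma hop_apply (b : ℤ × ℤ →₀ ℂ) (d : ℤ × ℤ) : hop b d = K⁻¹ * b d + K⁻¹ * b (-d) := by
  simp [hop, mapDomain_neg_apply]

/-- The convolution `∑ b_d f(x - d)`. -/
def convol (b : ℤ × ℤ →₀ ℂ) (f : ℤ × ℤ → ℂ) (x : ℤ × ℤ) : ℂ := b.sum fun d a => a * f (x - d)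

lemma convol_hop (b : ℤ × ℤ →₀ ℂ) (f : ℤ × ℤ → ℂ) (x : ℤ × ℤ) :
    K * convol (hop b) f x = convol b f x + convol (b.mapDomain Neg.neg) f x := by
  rw [convol, hop, Finsupp.sum_smul_index' (fun _ => zero_mul _), Finsupp.mul_sum,
    convol, convol, ← Finsupp.sum_add_index' (fun _ => zero_mul _) fun _ _ _ => add_mul _ _ _]
  refine Finsupp.sum_congr fun d _ => ?_
  rw [smul_eq_mul, ← mul_assoc, ← mul_assoc, mul_inv_cancel₀ K_ne_zero, one_mul]

theorem exists_trig_coefficients {S : Finset ℂ} (hS : ↑S ⊆ Λdual) {a : ℂ → ℂ}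
    (ha : ∀ p ∈ S, InPiQomega (a p)) {U : ℂ → ℂ}
    (hUdef : ∀ z : ℂ, U z = ∑ p ∈ S, a p * exp (I * (pair (p + K) z : ℂ)))
    (hrot : ∀ z : ℂ, U (ω * z) = ω * U z) :
    ∃ b : ℤ × ℤ →₀ ℂ, U = trig b ∧ (∀ d, b d ≠ 0 → cls d = 1) ∧
      (∀ d, hop b (rot d) = ω * hop b d) ∧ ∀ d, IsAlgebraic ℚ (hop b d) := by
  choose! idx hidx1 hidx using fun p (hp : p ∈ S) => exists_lpt_of_mem_Λdual (hS hp)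
  set b : ℤ × ℤ →₀ ℂ := ∑ p ∈ S, Finsupp.single (idx p) (a p) with hb
  have hU : U = trig b := funext fun z => by
    rw [hUdef, hb, trig_sum]
    refine Finset.sum_congr rfl fun p hp => ?_
    rw [trig_single, chi, hidx p hp]
  have hbrot := apply_rot_of_trig_omega_mul (b := b) (by rw [← hU]; exact hrot)
  have hba : ∀ d, b d = ∑ p ∈ S, if idx p = d then a p else 0 := fun d => by
    rw [hb, Finsupp.finsetSum_apply]
    exact Finset.sum_congr rfl fun p _ => by rw [Finsupp.single_apply]
  refine ⟨b, hU, fun d hd => ?_, fun d => ?_, fun d => ?_⟩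
  · rw [hba] at hd
    obtain ⟨p, hp, h⟩ := Finset.exists_ne_zero_of_sum_ne_zero hd
    have : idx p = d := by
      by_contra hne
      exact h (if_neg hne)
    rw [← this]; exact hidx1 p hp
  · have : -rot d = rot (-d) := by ext <;> simp [rot]; ring
    rw [hop_apply, hop_apply, this, hbrot, hbrot]; ring
  · have key : ∀ d, IsAlgebraic ℚ (K⁻¹ * b d) := fun d => by
      rw [hba, Finset.mul_sum]
      refine mem_algebraicClosure_iff.1
        ((algebraicClosure ℚ ℂ).sum_mem fun p hp => mem_algebraicClosure_iff.2 ?_)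
      split_ifs
      · exact isAlgebraic_inv_K_mul (ha p hp)
      · rw [mul_zero]; exact isAlgebraic_zero
    rw [hop_apply]
    exact (key d).add (key (-d))

end Potential

section FourierUniqueness

lemma eq_zero_of_periodic_of_fourier_eq_zero {g : ℝ → ℂ} (hg : Continuous g)
    (hp : ∀ t, g (t + 1) = g t)
    (h : ∀ n : ℤ, ∫ t in (0 : ℝ)..1, g t * exp (-(2 * Real.pi * I * n * t)) = 0) (t : ℝ) :
    g t = 0 := by
  have hper : Function.Periodic g 1 := hp
  let G : C(AddCircle (1 : ℝ), ℂ) := ⟨hper.lift, by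
    refine continuous_coinduced_dom.2 ?_
    exact hg⟩
  have hG : ∀ t : ℝ, G (t : AddCircle (1 : ℝ)) = g t := fun t => hper.lift_coe t
  have hc : ∀ n : ℤ, fourierCoeff G n = 0 := fun n => by
    rw [fourierCoeff_eq_intervalIntegral _ n 0, zero_add]
    simp only [hG, fourier_coe_apply, smul_eq_mul]
    rw [← h n]
    simp only [one_div, inv_one, one_smul]
    refine intervalIntegral.integral_congr fun t _ => ?_
    rw [mul_comm]
    congr 2
    push_cast
    ring
  have hs := has_pointwise_sum_fourier_series_of_summable (f := G)
    (by rw [show fourierCoeff G = 0 from funext hc]; exact summable_zero) (t : AddCircle (1 : ℝ))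
  simp only [hc, zero_smul] at hs
  rw [← hG]
  exact hs.unique hasSum_zero

/-- The Fourier coefficient of frequency `x` over the fundamental cell. -/
def coef (x : ℤ × ℤ) (f : ℂ → ℂ) : ℂ :=
  ∫ s in (0 : ℝ)..1, ∫ t in (0 : ℝ)..1, f (tor s t) * chi (-x) (tor s t)

lemma continuous_tor : Continuous fun p : ℝ × ℝ => tor p.1 p.2 := by
  unfold tor; fun_prop

lemma tor_add_one_left (s t : ℝ) : tor (s + 1) t = tor s t + ω := by
  simp [tor]; ring

lemma tor_add_one_right (s t : ℝ) : tor s (t + 1) = tor s t + 1 := by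
  simp [tor]; ring

lemma omega_mem_Λ : ω ∈ Λ := ⟨1, 0, by simp⟩

lemma one_mem_Λ : (1 : ℂ) ∈ Λ := ⟨0, 1, by simp⟩

lemma exists_tor (z : ℂ) : ∃ s t : ℝ, z = tor s t := by
  have h0 : Real.sqrt 3 ≠ 0 := by positivity
  have h3 : (Real.sqrt 3) ^ 2 = 3 := Real.sq_sqrt (by norm_num)
  refine ⟨2 / Real.sqrt 3 * z.im, z.re + Real.sqrt 3 / 3 * z.im, ?_⟩
  apply Complex.ext
  · simp [tor, omega_re, omega_im]; field_simp; linear_combination (-z.im) * h3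
  · simp [tor, omega_re, omega_im]; field_simp

lemma chi_neg_tor (a b : ℤ) (s t : ℝ) :
    chi (-(2 * a + b, a + 2 * b)) (tor s t) =
      exp (-(2 * Real.pi * I * a * s)) * exp (-(2 * Real.pi * I * b * t)) := by
  rw [chi, pair_tor, ← exp_add]
  congr 1
  push_cast [Prod.fst_neg, Prod.snd_neg]
  ring

lemma cls_two_mul_add (a b : ℤ) : cls (2 * a + b, a + 2 * b) = 0 := by
  simp only [cls]
  rw [show (2 * a + b + (a + 2 * b) : ℤ) = 3 * (a + b) by ring]
  push_cast
  rw [show (3 : ZMod 3) = 0 from rfl, zero_mul]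

theorem eq_zero_of_coef_eq_zero {f : ℂ → ℂ} (hf : Continuous f) (x : ℤ × ℤ)
    (hp : ∀ γ ∈ Λ, ∀ z, f (z + γ) = chi x γ * f z)
    (h : ∀ y, cls y = cls x → coef y f = 0) (z : ℂ) : f z = 0 := by
  set G : ℂ → ℂ := fun z => f z * chi (-x) z with hG
  have hGc : Continuous G := hf.mul (continuous_chi _)
  have hGp : ∀ γ ∈ Λ, ∀ z, G (z + γ) = G z := fun γ hγ z => by
    have h1 := chi_add_left x (-x) γ
    rw [add_neg_cancel, chi_zero_left] at h1
    simp only [hG, hp γ hγ, chi_add_right]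
    linear_combination (-(f z * chi (-x) z)) * h1
  have hGc2 : Continuous fun p : ℝ × ℝ => G (tor p.1 p.2) := hGc.comp continuous_tor
  have hcoef : ∀ a b : ℤ, ∫ s in (0 : ℝ)..1, (∫ t in (0 : ℝ)..1,
      G (tor s t) * exp (-(2 * Real.pi * I * b * t))) * exp (-(2 * Real.pi * I * a * s)) = 0 :=
    fun a b => by
      rw [← h (x + (2 * a + b, a + 2 * b)) (by rw [cls_add, cls_two_mul_add, add_zero]), coef]
      refine intervalIntegral.integral_congr fun s _ => ?_
      rw [← intervalIntegral.integral_mul_const]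
      refine intervalIntegral.integral_congr fun t _ => ?_
      simp only [hG]
      rw [neg_add, chi_add_left, chi_neg_tor]
      ring
  have hinner : ∀ (b : ℤ) (s : ℝ), ∫ t in (0 : ℝ)..1,
      G (tor s t) * exp (-(2 * Real.pi * I * b * t)) = 0 := fun b => by
    refine eq_zero_of_periodic_of_fourier_eq_zero ?_ (fun s => ?_) (fun a => hcoef a b)
    · refine intervalIntegral.continuous_parametric_intervalIntegral_of_continuous' ?_ 0 1
      exact hGc2.mul (by fun_prop)
    · simp only [tor_add_one_left, hGp ω omega_mem_Λ]
  obtain ⟨s, t, rfl⟩ := exists_tor z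
  have : G (tor s t) = 0 := by
    refine eq_zero_of_periodic_of_fourier_eq_zero (g := fun t => G (tor s t)) ?_ (fun t => ?_)
      (fun b => hinner b s) t
    · exact hGc2.comp (by fun_prop : Continuous fun t : ℝ => (s, t))
    · simp only [tor_add_one_right, hGp 1 one_mem_Λ]
  exact (mul_eq_zero.1 this).resolve_right (chi_ne_zero _ _)

lemma coef_congr {f g : ℂ → ℂ} (h : ∀ z, f z = g z) (x : ℤ × ℤ) : coef x f = coef x g := by
  rw [funext h]

lemma continuous_coef_integrand {f : ℂ → ℂ} (hf : Continuous f) (x : ℤ × ℤ) :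
    Continuous fun p : ℝ × ℝ => f (tor p.1 p.2) * chi (-x) (tor p.1 p.2) :=
  (hf.comp continuous_tor).mul ((continuous_chi _).comp continuous_tor)

lemma coef_add {f g : ℂ → ℂ} (hf : Continuous f) (hg : Continuous g) (x : ℤ × ℤ) :
    coef x (fun z => f z + g z) = coef x f + coef x g := by
  have hF := continuous_coef_integrand hf x
  have hH := continuous_coef_integrand hg x
  have hs : ∀ s : ℝ, Continuous fun t : ℝ => (s, t) := fun s => by fun_prop
  rw [coef, coef, coef, ← intervalIntegral.integral_add
    (intervalIntegral.continuous_parametric_intervalIntegral_of_continuous' hF 0 1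
      |>.intervalIntegrable _ _)
    (intervalIntegral.continuous_parametric_intervalIntegral_of_continuous' hH 0 1
      |>.intervalIntegrable _ _)]
  refine intervalIntegral.integral_congr fun s _ => ?_
  simp only [add_mul]
  exact intervalIntegral.integral_add ((hF.comp (hs s)).intervalIntegrable _ _)
    ((hH.comp (hs s)).intervalIntegrable _ _)

lemma coef_const_mul (c : ℂ) (f : ℂ → ℂ) (x : ℤ × ℤ) :
    coef x (fun z => c * f z) = c * coef x f := by
  simp only [coef, mul_assoc, intervalIntegral.integral_const_mul]

lemma coef_sum {ι : Type*} (s : Finset ι) {f : ι → ℂ → ℂ} (hf : ∀ i, Continuous (f i))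
    (x : ℤ × ℤ) : coef x (fun z => ∑ i ∈ s, f i z) = ∑ i ∈ s, coef x (f i) := by
  classical
  induction s using Finset.induction_on with
  | empty => simp [coef]
  | insert i s hi ih =>
    simp only [Finset.sum_insert hi]
    rw [coef_add (hf i) (continuous_finsetSum _ fun j _ => hf j), ih]

lemma coef_chi_mul (d x : ℤ × ℤ) (f : ℂ → ℂ) :
    coef x (fun z => chi d z * f z) = coef (x - d) f := by
  unfold coef
  refine intervalIntegral.integral_congr fun s _ => ?_
  refine intervalIntegral.integral_congr fun t _ => ?_
  simp only
  rw [neg_sub, sub_eq_add_neg, chi_add_left]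
  ring

lemma norm_coef_le {f : ℂ → ℂ} {C : ℝ} (hC : ∀ z, ‖f z‖ ≤ C) (x : ℤ × ℤ) : ‖coef x f‖ ≤ C := by
  have h1 : ∀ s : ℝ, ‖∫ t in (0 : ℝ)..1, f (tor s t) * chi (-x) (tor s t)‖ ≤ C := fun s => by
    have := intervalIntegral.norm_integral_le_of_norm_le_const (a := 0) (b := 1) (C := C)
      (f := fun t : ℝ => f (tor s t) * chi (-x) (tor s t))
      (fun t _ => by rw [norm_mul, norm_chi, mul_one]; exact hC _)
    simpa using this
  have := intervalIntegral.norm_integral_le_of_norm_le_const (a := 0) (b := 1) (C := C)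
    (fun s _ => h1 s)
  simpa [coef] using this

lemma exists_bound_of_floquet {f : ℂ → ℂ} (hf : Continuous f) (x : ℤ × ℤ)
    (hp : ∀ γ ∈ Λ, ∀ z, f (z + γ) = chi x γ * f z) : ∃ C, ∀ z, ‖f z‖ ≤ C := by
  obtain ⟨C, hC⟩ := (isCompact_Icc (a := (0 : ℝ)) (b := 1)).prod
    (isCompact_Icc (a := (0 : ℝ)) (b := 1)) |>.exists_bound_of_continuousOn
    (hf.comp continuous_tor).continuousOn
  refine ⟨C, fun z => ?_⟩
  obtain ⟨s, t, rfl⟩ := exists_tor z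
  have e : tor s t = tor (Int.fract s) (Int.fract t) + (⌊s⌋ * ω + ⌊t⌋) := by
    have h1 : ((Int.fract s : ℝ) : ℂ) + (⌊s⌋ : ℂ) = s := by exact_mod_cast Int.fract_add_floor s
    have h2 : ((Int.fract t : ℝ) : ℂ) + (⌊t⌋ : ℂ) = t := by exact_mod_cast Int.fract_add_floor t
    simp only [tor]
    linear_combination (-ω) * h1 - h2
  rw [e, hp _ ⟨_, _, rfl⟩, norm_mul, norm_chi, one_mul]
  exact hC (Int.fract s, Int.fract t)
    ⟨⟨Int.fract_nonneg _, (Int.fract_lt_one _).le⟩, ⟨Int.fract_nonneg _, (Int.fract_lt_one _).le⟩⟩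

end FourierUniqueness

section IntegrationByParts

/-- The lattice parametrisation as a continuous linear map. -/
def torL : ℝ × ℝ →L[ℝ] ℂ :=
  (ContinuousLinearMap.fst ℝ ℝ ℝ).smulRight ω + (ContinuousLinearMap.snd ℝ ℝ ℝ).smulRight 1

lemma torL_apply (p : ℝ × ℝ) : torL p = tor p.1 p.2 := by
  simp [torL, tor]

lemma tor_notMem_Λ {s t : ℝ} (h0 : 0 < s) (h1 : s < 1) : tor s t ∉ Λ := by
  rintro ⟨m, n, h⟩
  have h2 := congrArg Complex.im h
  simp [tor, omega_im] at h2
  rw [h2] at h0 h1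
  have h3 : (0 : ℤ) < m := by exact_mod_cast h0
  have h4 : m < (1 : ℤ) := by exact_mod_cast h1
  omega

lemma Dbar_eq_tor {h : ℂ → ℂ} {h' : ℂ →L[ℝ] ℂ} {z : ℂ} (hh : HasFDerivAt h h' z) :
    Dbar h z = (2 / Real.sqrt 3 : ℝ) * h' ω + ((1 / Real.sqrt 3 : ℝ) - I) * h' 1 := by
  have h0 : Real.sqrt 3 ≠ 0 := by positivity
  have e : ω = (-1 / 2 : ℝ) • (1 : ℂ) + (Real.sqrt 3 / 2 : ℝ) • I := by
    rw [omega_eq]; simp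
  rw [Dbar_of_hasFDerivAt hh, e, map_add, map_smul, map_smul]
  simp only [real_smul]
  have h1 : ((2 / Real.sqrt 3 : ℝ) : ℂ) * ((Real.sqrt 3 / 2 : ℝ) : ℂ) = 1 := by
    rw [← ofReal_mul]; field_simp; simp
  have h2 : ((2 / Real.sqrt 3 : ℝ) : ℂ) * ((-1 / 2 : ℝ) : ℂ) = -((1 / Real.sqrt 3 : ℝ) : ℂ) := by
    rw [← ofReal_mul, ← ofReal_neg]; congr 1; field_simp
  linear_combination (-(h' I)) * h1 - h' 1 * h2

theorem integral_Dbar_eq_zero {h g : ℂ → ℂ} (hc : Continuous h) (gc : Continuous g)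
    (hp : ∀ γ ∈ Λ, ∀ z, h (z + γ) = h z) (hd : ∀ z ∉ Λ, DifferentiableAt ℝ h z)
    (hD : ∀ z ∉ Λ, Dbar h z = g z) :
    ∫ s in (0 : ℝ)..1, ∫ t in (0 : ℝ)..1, g (tor s t) = 0 := by
  classical
  set A : ℂ := ((2 / Real.sqrt 3 : ℝ) : ℂ)
  set B : ℂ := ((1 / Real.sqrt 3 : ℝ) : ℂ) - I
  set Q : Set (ℝ × ℝ) := Set.Ioo 0 1 ×ˢ Set.Ioo 0 1
  set F' : ℝ × ℝ → ℝ × ℝ →L[ℝ] ℂ := fun p => if p ∈ Q then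
    A • (fderiv ℝ h (tor p.1 p.2)).comp torL
    else (ContinuousLinearMap.fst ℝ ℝ ℝ).smulRight (g (tor p.1 p.2)) with hF'
  set G' : ℝ × ℝ → ℝ × ℝ →L[ℝ] ℂ := fun p => if p ∈ Q then
    B • (fderiv ℝ h (tor p.1 p.2)).comp torL else 0 with hG'
  have hcomp : Continuous fun p : ℝ × ℝ => h (tor p.1 p.2) := hc.comp continuous_tor
  have hQ : ∀ p ∈ Q, HasFDerivAt (fun p : ℝ × ℝ => h (tor p.1 p.2))
      ((fderiv ℝ h (tor p.1 p.2)).comp torL) p := fun p hp => by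
    have h1 : HasFDerivAt h (fderiv ℝ h (tor p.1 p.2)) (torL p) := by
      rw [torL_apply]
      exact (hd _ (tor_notMem_Λ hp.1.1 hp.1.2)).hasFDerivAt
    have := h1.comp p torL.hasFDerivAt
    exact this.congr_of_eventuallyEq (Filter.Eventually.of_forall fun q => by
      simp only [Function.comp_apply, torL_apply])
  have hsum : ∀ p, F' p (1, 0) + G' p (0, 1) = g (tor p.1 p.2) := fun p => by
    by_cases hp : p ∈ Q
    · have h1 : tor p.1 p.2 ∉ Λ := tor_notMem_Λ hp.1.1 hp.1.2
      simp only [hF', hG', if_pos hp, smul_apply,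
        ContinuousLinearMap.comp_apply, smul_eq_mul]
      rw [← hD _ h1, Dbar_eq_tor (hd _ h1).hasFDerivAt, torL_apply, torL_apply]
      simp [tor, A, B]
    · simp [hF', hG', if_neg hp]
  have key := integral2_divergence_prod_of_hasFDerivAt_off_countable
    (fun p => A * h (tor p.1 p.2)) (fun p => B * h (tor p.1 p.2)) F' G' 0 0 1 1 ∅
    Set.countable_empty (continuous_const.mul hcomp).continuousOn
    (continuous_const.mul hcomp).continuousOn
    (fun p hp => by
      have hp' : p ∈ Q := by simpa [Q] using hp
      simp only [hF', if_pos hp']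
      exact (hQ p hp').const_mul A)
    (fun p hp => by
      have hp' : p ∈ Q := by simpa [Q] using hp
      simp only [hG', if_pos hp']
      exact (hQ p hp').const_mul B)
    (by
      simp only [hsum]
      exact (gc.comp continuous_tor).continuousOn.integrableOn_compact
        (isCompact_uIcc.prod isCompact_uIcc))
  simp only [hsum] at key
  rw [key]
  have h1 : ∀ s, h (tor s 1) = h (tor s 0) := fun s => by
    have := tor_add_one_right s 0
    rw [zero_add] at this
    rw [this, hp _ one_mem_Λ]
  have h2 : ∀ t, h (tor 1 t) = h (tor 0 t) := fun t => by
    have := tor_add_one_left 0 t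
    rw [zero_add] at this
    rw [this, hp _ omega_mem_Λ]
  simp only [h1, h2]
  ring

theorem coef_Dbar {v g : ℂ → ℂ} (hc : Continuous v) (gc : Continuous g) (x : ℤ × ℤ)
    (hp : ∀ γ ∈ Λ, ∀ z, v (z + γ) = chi x γ * v z) (hd : ∀ z ∉ Λ, DifferentiableAt ℝ v z)
    (hD : ∀ z ∉ Λ, Dbar v z = g z) : coef x g = K * lpt x * coef x v := by
  have h := integral_Dbar_eq_zero (h := fun z => v z * chi (-x) z)
    (g := fun z => g z * chi (-x) z + (-(K * lpt x)) * (v z * chi (-x) z))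
    (hc.mul (continuous_chi _)) ((gc.mul (continuous_chi _)).add
      (continuous_const.mul (hc.mul (continuous_chi _))))
    (fun γ hγ z => by
      have h1 := chi_add_left x (-x) γ
      rw [add_neg_cancel, chi_zero_left] at h1
      simp only [hp γ hγ, chi_add_right]
      linear_combination (-(v z * chi (-x) z)) * h1)
    (fun z hz => (hd z hz).mul (differentiable_chi _ z))
    (fun z hz => by
      rw [Dbar_mul (hd z hz) (differentiable_chi _ z), hD z hz, Dbar_chi, lpt_neg]
      ring)
  have h2 : coef x (fun z => g z + (-(K * lpt x)) * v z) = 0 := by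
    rw [← h, coef]
    simp only [add_mul, mul_assoc]
  rw [coef_add (g := fun z => -(K * lpt x) * v z) gc (continuous_const.mul hc),
    coef_const_mul] at h2
  linear_combination h2

end IntegrationByParts

section FourierSide

/-- Kernel elements that may fail to be differentiable at the lattice points. -/
structure WeakKer (b : ℤ × ℤ →₀ ℂ) (α k : ℂ) (v₁ v₂ : ℂ → ℂ) : Prop where
  cont₁ : Continuous v₁
  cont₂ : Continuous v₂
  diff₁ : ∀ z ∉ Λ, DifferentiableAt ℝ v₁ z
  diff₂ : ∀ z ∉ Λ, DifferentiableAt ℝ v₂ z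
  eq₁ : ∀ z ∉ Λ, Dbar v₁ z + k * v₁ z + α * trig b z * v₂ z = 0
  eq₂ : ∀ z ∉ Λ, Dbar v₂ z + k * v₂ z + α * trig b (-z) * v₁ z = 0
  per₁ : ∀ γ ∈ Λ, ∀ z, v₁ (z + γ) = exp (-I * (pair γ K : ℂ)) * v₁ z
  per₂ : ∀ γ ∈ Λ, ∀ z, v₂ (z + γ) = exp (I * (pair γ K : ℂ)) * v₂ z

/-- The kernel equations in Fourier space. -/
structure FourierKer (b : ℤ × ℤ →₀ ℂ) (α κ : ℂ) (c : ℤ × ℤ → ℂ) : Prop where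
  zero : ∀ x, cls x = 0 → c x = 0
  eqn : ∀ x, cls x ≠ 0 → (lpt x + κ) * c x + α * convol (hop b) c x = 0

/-- The combined Fourier coefficients of a pair of functions. -/
def pairCoef (v₁ v₂ : ℂ → ℂ) (x : ℤ × ℤ) : ℂ :=
  if cls x = 2 then coef x v₁ else if cls x = 1 then coef x v₂ else 0

variable {b : ℤ × ℤ →₀ ℂ} {α k κ : ℂ} {v₁ v₂ : ℂ → ℂ}

lemma coef_trig_mul (b : ℤ × ℤ →₀ ℂ) {v : ℂ → ℂ} (hv : Continuous v) (x : ℤ × ℤ) :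
    coef x (fun z => trig b z * v z) = convol b (fun y => coef y v) x := by
  have : ∀ z, trig b z * v z = ∑ d ∈ b.support, b d * (chi d z * v z) := fun z => by
    rw [trig, Finsupp.sum, Finset.sum_mul]
    simp only [mul_assoc]
  rw [coef_congr this, coef_sum (f := fun d z => b d * (chi d z * v z)) _ fun d =>
    continuous_const.mul ((continuous_chi d).mul hv)]
  simp only [coef_const_mul, coef_chi_mul]
  rfl

lemma convol_congr {b : ℤ × ℤ →₀ ℂ} {f g : ℤ × ℤ → ℂ} {x : ℤ × ℤ}
    (h : ∀ d, b d ≠ 0 → f (x - d) = g (x - d)) : convol b f x = convol b g x :=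
  Finsupp.sum_congr fun d hd => by rw [h d (Finsupp.mem_support_iff.1 hd)]

lemma convol_eq_zero {b : ℤ × ℤ →₀ ℂ} {f : ℤ × ℤ → ℂ} {x : ℤ × ℤ}
    (h : ∀ d, b d ≠ 0 → f (x - d) = 0) : convol b f x = 0 :=
  Finset.sum_eq_zero fun d hd => by
    simp only [h d (Finsupp.mem_support_iff.1 hd), mul_zero]

lemma cls_of_mapDomain_neg (hb : ∀ d, b d ≠ 0 → cls d = 1) (d : ℤ × ℤ)
    (hd : b.mapDomain Neg.neg d ≠ 0) : cls d = 2 := by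
  rw [mapDomain_neg_apply] at hd
  have h := hb _ hd
  rw [cls_neg] at h
  rw [← neg_neg (cls d), h]
  decide

lemma convol_hop_of_cls_two (hb : ∀ d, b d ≠ 0 → cls d = 1) {c : ℤ × ℤ → ℂ}
    (hc : ∀ x, cls x = 0 → c x = 0) {x : ℤ × ℤ} (hx : cls x = 2) :
    K * convol (hop b) c x = convol b c x := by
  rw [convol_hop, add_eq_left]
  refine convol_eq_zero fun d hd => hc _ ?_
  rw [cls_sub, cls_of_mapDomain_neg hb d hd, hx, sub_self]

lemma convol_hop_of_cls_one (hb : ∀ d, b d ≠ 0 → cls d = 1) {c : ℤ × ℤ → ℂ}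
    (hc : ∀ x, cls x = 0 → c x = 0) {x : ℤ × ℤ} (hx : cls x = 1) :
    K * convol (hop b) c x = convol (b.mapDomain Neg.neg) c x := by
  rw [convol_hop, add_eq_right]
  refine convol_eq_zero fun d hd => hc _ ?_
  rw [cls_sub, hb d hd, hx, sub_self]

lemma ne_two_of_eq_one {x : ZMod 3} (h : x = 1) : x ≠ 2 := by subst h; decide

lemma pairCoef_of_cls_two {x : ℤ × ℤ} (hx : cls x = 2) : pairCoef v₁ v₂ x = coef x v₁ := if_pos hx

lemma pairCoef_of_cls_one {x : ℤ × ℤ} (hx : cls x = 1) : pairCoef v₁ v₂ x = coef x v₂ := by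
  rw [pairCoef, if_neg (ne_two_of_eq_one hx), if_pos hx]

lemma pairCoef_of_cls_zero {x : ℤ × ℤ} (hx : cls x = 0) : pairCoef v₁ v₂ x = 0 := by
  rw [pairCoef, if_neg, if_neg] <;> rw [hx] <;> decide

lemma WeakKer.floquet₁ (h : WeakKer b α k v₁ v₂) {x : ℤ × ℤ} (hx : cls x = 2) :
    ∀ γ ∈ Λ, ∀ z, v₁ (z + γ) = chi x γ * v₁ z := fun γ hγ z => by
  rw [chi_lattice_of_cls_two hx hγ]; exact h.per₁ γ hγ z

lemma WeakKer.floquet₂ (h : WeakKer b α k v₁ v₂) {x : ℤ × ℤ} (hx : cls x = 1) :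
    ∀ γ ∈ Λ, ∀ z, v₂ (z + γ) = chi x γ * v₂ z := fun γ hγ z => by
  rw [chi_lattice_of_cls_one hx hγ]; exact h.per₂ γ hγ z

lemma cls_eq_one_or_two {x : ZMod 3} (hx : x ≠ 0) : x = 1 ∨ x = 2 := by
  revert x; decide

theorem WeakKer.fourierKer (hb : ∀ d, b d ≠ 0 → cls d = 1) (h : WeakKer b α (K * κ) v₁ v₂) :
    FourierKer b α κ (pairCoef v₁ v₂) := by
  have h0 : ∀ x, cls x = 0 → pairCoef v₁ v₂ x = 0 := fun x hx => pairCoef_of_cls_zero hx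
  refine ⟨h0, fun x hx => ?_⟩
  have hU : Continuous (trig b) := (contDiff_trig b (n := 0)).continuous
  have hU' : Continuous (trig (b.mapDomain Neg.neg)) := (contDiff_trig _ (n := 0)).continuous
  refine mul_left_cancel₀ K_ne_zero ?_
  rcases cls_eq_one_or_two hx with hx | hx
  · have h1 := coef_Dbar (g := fun z => (-(K * κ)) * v₂ z +
      (-α) * (trig (b.mapDomain Neg.neg) z * v₁ z)) h.cont₂
      ((continuous_const.mul h.cont₂).add (continuous_const.mul (hU'.mul h.cont₁))) x
      (h.floquet₂ hx) h.diff₂ (fun z hz => by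
        rw [← trig_neg]; linear_combination h.eq₂ z hz)
    rw [coef_add (f := fun z => (-(K * κ)) * v₂ z) (g := fun z =>
      (-α) * (trig (b.mapDomain Neg.neg) z * v₁ z)) (continuous_const.mul h.cont₂)
      (continuous_const.mul (hU'.mul h.cont₁)), coef_const_mul, coef_const_mul,
      coef_trig_mul _ h.cont₁] at h1
    have h2 := convol_hop_of_cls_one hb h0 hx
    rw [convol_congr (b := b.mapDomain Neg.neg) (g := fun y => coef y v₁) fun d hd => pairCoef_of_cls_two (by
      rw [cls_sub, hx, cls_of_mapDomain_neg hb d hd]; decide)] at h2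
    rw [pairCoef_of_cls_one hx]
    linear_combination α * h2 - h1
  · have h1 := coef_Dbar (g := fun z => (-(K * κ)) * v₁ z +
      (-α) * (trig b z * v₂ z)) h.cont₁
      ((continuous_const.mul h.cont₁).add (continuous_const.mul (hU.mul h.cont₂))) x
      (h.floquet₁ hx) h.diff₁ (fun z hz => by linear_combination h.eq₁ z hz)
    rw [coef_add (f := fun z => (-(K * κ)) * v₁ z) (g := fun z =>
      (-α) * (trig b z * v₂ z)) (continuous_const.mul h.cont₁)
      (continuous_const.mul (hU.mul h.cont₂)), coef_const_mul, coef_const_mul,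
      coef_trig_mul _ h.cont₂] at h1
    have h2 := convol_hop_of_cls_two hb h0 hx
    rw [convol_congr (b := b) (g := fun y => coef y v₂) fun d hd => pairCoef_of_cls_one (by
      rw [cls_sub, hx, hb d hd]; decide)] at h2
    rw [pairCoef_of_cls_two hx]
    linear_combination α * h2 - h1

lemma WeakKer.exists_bound (h : WeakKer b α k v₁ v₂) : ∃ C, ∀ x, ‖pairCoef v₁ v₂ x‖ ≤ C := by
  obtain ⟨C₁, h1⟩ := exists_bound_of_floquet h.cont₁ (1, 1) (h.floquet₁ (by decide))
  obtain ⟨C₂, h2⟩ := exists_bound_of_floquet h.cont₂ (0, 1) (h.floquet₂ (by decide))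
  have hC1 : 0 ≤ C₁ := (norm_nonneg _).trans (h1 0)
  have hC2 : 0 ≤ C₂ := (norm_nonneg _).trans (h2 0)
  refine ⟨C₁ + C₂, fun x => ?_⟩
  have e1 := norm_coef_le h1 x
  have e2 := norm_coef_le h2 x
  unfold pairCoef
  split_ifs
  · linarith
  · linarith
  · rw [norm_zero]; linarith

/-- A pair is determined by its combined Fourier coefficients. -/
theorem eq_of_pairCoef_eq {w₁ w₂ : ℂ → ℂ} {α' k' : ℂ} (hv : WeakKer b α k v₁ v₂)
    (hw : WeakKer b α' k' w₁ w₂) (h : ∀ x, pairCoef v₁ v₂ x = pairCoef w₁ w₂ x) :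
    v₁ = w₁ ∧ v₂ = w₂ := by
  have sub : ∀ {f g : ℂ → ℂ} (x : ℤ × ℤ), Continuous f → Continuous g →
      (∀ γ ∈ Λ, ∀ z, f (z + γ) = chi x γ * f z) → (∀ γ ∈ Λ, ∀ z, g (z + γ) = chi x γ * g z) →
      (∀ y, cls y = cls x → coef y f = coef y g) → f = g := by
    intro f g x hf hg pf pg hfg
    funext z
    have := eq_zero_of_coef_eq_zero (f := fun z => f z + (-1) * g z)
      (hf.add (continuous_const.mul hg)) x (fun γ hγ z => by rw [pf γ hγ, pg γ hγ]; ring)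
      (fun y hy => by
        rw [coef_add (g := fun z => (-1) * g z) hf (continuous_const.mul hg), coef_const_mul,
          hfg y hy]; ring) z
    linear_combination this
  constructor
  · refine sub (1, 1) hv.cont₁ hw.cont₁ (hv.floquet₁ (by decide)) (hw.floquet₁ (by decide))
      fun y hy => ?_
    have hy2 : cls y = 2 := hy.trans (by decide)
    have := h y
    rwa [pairCoef_of_cls_two hy2, pairCoef_of_cls_two hy2] at this
  · refine sub (0, 1) hv.cont₂ hw.cont₂ (hv.floquet₂ (by decide)) (hw.floquet₂ (by decide))
      fun y hy => ?_
    have hy2 : cls y = 1 := hy.trans (by decide)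
    have := h y
    rwa [pairCoef_of_cls_one hy2, pairCoef_of_cls_one hy2] at this

end FourierSide

section Synthesis

open Filter Topology

/-- Rapid decay on the lattice. -/
def RapidDecay (c : ℤ × ℤ → ℂ) : Prop := ∀ n : ℕ, ∃ C, ∀ x, ‖c x‖ * (1 + ‖lpt x‖) ^ n ≤ C

lemma RapidDecay.summable {c : ℤ × ℤ → ℂ} (hc : RapidDecay c) (n : ℕ) :
    Summable fun x => ‖c x‖ * (1 + ‖lpt x‖) ^ n := by
  obtain ⟨C, hC⟩ := hc (n + 3)
  refine Summable.of_nonneg_of_le (fun x => by positivity) (fun x => ?_)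
    ((summable_lpt_rpow (k := 3) (by norm_num)).mul_left C)
  have h0 : 0 < 1 + ‖lpt x‖ := by positivity
  rw [Real.rpow_neg h0.le, ← div_eq_mul_inv, le_div_iff₀ (by positivity)]
  have : (1 + ‖lpt x‖) ^ (3 : ℝ) = (1 + ‖lpt x‖) ^ (3 : ℕ) := by
    exact_mod_cast Real.rpow_natCast (1 + ‖lpt x‖) 3
  rw [this, mul_assoc, ← pow_add]
  exact hC x

lemma RapidDecay.summable_norm {c : ℤ × ℤ → ℂ} (hc : RapidDecay c) : Summable fun x => ‖c x‖ := by
  simpa using hc.summable 0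

lemma RapidDecay.mono {c c' : ℤ × ℤ → ℂ} (hc : RapidDecay c) (h : ∀ x, ‖c' x‖ ≤ ‖c x‖) :
    RapidDecay c' := fun n => by
  obtain ⟨C, hC⟩ := hc n
  exact ⟨C, fun x => (mul_le_mul_of_nonneg_right (h x) (by positivity)).trans (hC x)⟩

lemma exists_convol_bound (t : ℤ × ℤ →₀ ℂ) {c : ℤ × ℤ → ℂ} {C : ℝ} {n : ℕ}
    (hC : ∀ x, ‖c x‖ * (1 + ‖lpt x‖) ^ n ≤ C) :
    ∃ T : ℝ, 0 ≤ T ∧ ∀ x, ‖convol t c x‖ * (1 + ‖lpt x‖) ^ n ≤ T * C := by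
  refine ⟨∑ d ∈ t.support, ‖t d‖ * (1 + ‖lpt d‖) ^ n,
    Finset.sum_nonneg fun d _ => by positivity, fun x => ?_⟩
  rw [convol, Finsupp.sum]
  refine (mul_le_mul_of_nonneg_right (norm_sum_le _ _) (by positivity)).trans ?_
  rw [Finset.sum_mul, Finset.sum_mul]
  refine Finset.sum_le_sum fun d _ => ?_
  have h1 : 1 + ‖lpt x‖ ≤ (1 + ‖lpt d‖) * (1 + ‖lpt (x - d)‖) := by
    have : ‖lpt x‖ ≤ ‖lpt d‖ + ‖lpt (x - d)‖ := by
      rw [lpt_sub]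
      simpa using norm_add_le (lpt d) (lpt x - lpt d)
    nlinarith [norm_nonneg (lpt d), norm_nonneg (lpt (x - d))]
  have h2 := pow_le_pow_left₀ (by positivity) h1 n
  rw [norm_mul]
  calc ‖t d‖ * ‖c (x - d)‖ * (1 + ‖lpt x‖) ^ n
      ≤ ‖t d‖ * ‖c (x - d)‖ * ((1 + ‖lpt d‖) * (1 + ‖lpt (x - d)‖)) ^ n :=
        mul_le_mul_of_nonneg_left h2 (by positivity)
    _ = ‖t d‖ * (1 + ‖lpt d‖) ^ n * (‖c (x - d)‖ * (1 + ‖lpt (x - d)‖) ^ n) := by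
        rw [mul_pow]; ring
    _ ≤ ‖t d‖ * (1 + ‖lpt d‖) ^ n * C := mul_le_mul_of_nonneg_left (hC _) (by positivity)

lemma FourierKer.rapidDecay {b : ℤ × ℤ →₀ ℂ} {α κ : ℂ} {c : ℤ × ℤ → ℂ} (h : FourierKer b α κ c)
    {C₀ : ℝ} (hc : ∀ x, ‖c x‖ ≤ C₀) : RapidDecay c := by
  intro n
  induction n with
  | zero => exact ⟨C₀, by simpa using hc⟩
  | succ n ih =>
    obtain ⟨C, hC⟩ := ih
    have hC0 : 0 ≤ C := (by positivity : (0 : ℝ) ≤ _).trans (hC 0)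
    obtain ⟨T, hT0, hconv⟩ := exists_convol_bound (hop b) hC
    refine ⟨max (C * (2 + 2 * ‖κ‖)) (2 * (‖α‖ * (T * C))), fun x => ?_⟩
    rcases le_total ‖lpt x‖ (2 * ‖κ‖ + 1) with hx | hx
    · refine le_max_of_le_left ?_
      rw [pow_succ, ← mul_assoc]
      exact mul_le_mul (hC x) (by linarith) (by positivity) hC0
    · refine le_max_of_le_right ?_
      by_cases hcx : cls x = 0
      · rw [h.zero x hcx, norm_zero, zero_mul]; positivity
      have e := h.eqn x hcx
      have h3 : ‖lpt x + κ‖ * ‖c x‖ = ‖α‖ * ‖convol (hop b) c x‖ := by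
        rw [← norm_mul, ← norm_mul, eq_neg_of_add_eq_zero_left e, norm_neg]
      have h4 : (1 + ‖lpt x‖) ≤ 2 * ‖lpt x + κ‖ := by
        have : ‖lpt x‖ ≤ ‖lpt x + κ‖ + ‖κ‖ := by
          simpa using norm_sub_le (lpt x + κ) κ
        linarith
      calc ‖c x‖ * (1 + ‖lpt x‖) ^ (n + 1)
          = ‖c x‖ * (1 + ‖lpt x‖) ^ n * (1 + ‖lpt x‖) := by rw [pow_succ]; ring
        _ ≤ ‖c x‖ * (1 + ‖lpt x‖) ^ n * (2 * ‖lpt x + κ‖) := by gcongr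
        _ = 2 * (‖lpt x + κ‖ * ‖c x‖) * (1 + ‖lpt x‖) ^ n := by ring
        _ = 2 * (‖α‖ * (‖convol (hop b) c x‖ * (1 + ‖lpt x‖) ^ n)) := by rw [h3]; ring
        _ ≤ 2 * (‖α‖ * (T * C)) := mul_le_mul_of_nonneg_left
            (mul_le_mul_of_nonneg_left (hconv x) (norm_nonneg _)) two_pos.le

/-- The function with Fourier coefficients `c`. -/
def synth (c : ℤ × ℤ → ℂ) (z : ℂ) : ℂ := ∑' x, c x * chi x z

variable {c : ℤ × ℤ → ℂ}

lemma summable_synth (hc : Summable fun x => ‖c x‖) (z : ℂ) :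
    Summable fun x => c x * chi x z :=
  Summable.of_norm (by simpa only [norm_mul, norm_chi, mul_one] using hc)

lemma norm_iteratedFDeriv_chi_le (x : ℤ × ℤ) (n : ℕ) (z : ℂ) :
    ‖iteratedFDeriv ℝ n (chi x) z‖ ≤ (2 * ‖K‖) ^ n * (1 + ‖lpt x‖) ^ n := by
  set e : ℝ → ℂ := fun s => exp (I * s) with he
  have hed : ∀ m s, iteratedDeriv m e s = I ^ m * exp (I * s) := fun m => by
    induction m with
    | zero => intro s; simp [he]
    | succ m ih =>
      intro s
      rw [iteratedDeriv_succ, funext ih]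
      have h1 : HasDerivAt (fun s : ℝ => I * (s : ℂ)) (I * 1) s :=
        (ofRealCLM.hasDerivAt (x := s)).const_mul I
      rw [(h1.cexp.const_mul (I ^ m)).deriv]
      ring
  have hcomp : chi x = e ∘ pairL (K * lpt x) := by
    funext z; simp [chi, he, pairL_apply]
  have hsm : ContDiff ℝ n e := by
    have : ContDiff ℝ n fun s => exp (I * ofRealCLM s) := by fun_prop
    exact this
  rw [hcomp, ContinuousLinearMap.iteratedFDeriv_comp_right (pairL (K * lpt x)) hsm z le_rfl]
  refine (ContinuousMultilinearMap.norm_compContinuousLinearMap_le _ _).trans ?_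
  rw [norm_iteratedFDeriv_eq_norm_iteratedDeriv, hed, norm_mul, norm_pow, norm_I, one_pow, one_mul,
    mul_comm I, norm_exp_ofReal_mul_I, one_mul, Finset.prod_const, Finset.card_univ,
    Fintype.card_fin, ← mul_pow]
  refine pow_le_pow_left₀ (norm_nonneg _) ((norm_pairL_le _).trans ?_) n
  rw [norm_mul]
  nlinarith [norm_nonneg K, norm_nonneg (lpt x)]

lemma contDiff_synth (hc : RapidDecay c) : ContDiff ℝ (⊤ : ℕ∞) (synth c) := by
  refine contDiff_tsum (v := fun n x => (2 * ‖K‖) ^ n * (‖c x‖ * (1 + ‖lpt x‖) ^ n))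
    (fun x => contDiff_const.mul (contDiff_chi x)) (fun n _ => (hc.summable n).mul_left _)
    fun n x z _ => ?_
  have : (fun w => c x * chi x w) = c x • chi x := rfl
  rw [this, iteratedFDeriv_const_smul_apply ((contDiff_chi x).contDiffAt), norm_smul]
  calc ‖c x‖ * ‖iteratedFDeriv ℝ n (chi x) z‖
      ≤ ‖c x‖ * ((2 * ‖K‖) ^ n * (1 + ‖lpt x‖) ^ n) := by
        gcongr; exact norm_iteratedFDeriv_chi_le x n z
    _ = _ := by ring

lemma synth_add_lattice {x₀ : ℤ × ℤ} (hs : ∀ x, c x ≠ 0 → cls x = cls x₀) {γ : ℂ} (hγ : γ ∈ Λ)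
    (z : ℂ) : synth c (z + γ) = chi x₀ γ * synth c z := by
  rw [synth, synth, ← tsum_mul_left]
  refine tsum_congr fun x => ?_
  by_cases hx : c x = 0
  · simp [hx]
  have h0 : chi (x - x₀) γ = 1 :=
    chi_lattice_of_cls_zero (by rw [cls_sub, hs x hx, sub_self]) hγ
  have h1 := chi_add_left (x - x₀) x₀ γ
  rw [sub_add_cancel, h0, one_mul] at h1
  rw [chi_add_right, h1]
  ring

lemma coef_chi_self (x : ℤ × ℤ) : coef x (chi x) = 1 := by
  have h1 : ∀ z, chi x z * chi (-x) z = 1 := fun z => by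
    rw [← chi_add_left, add_neg_cancel, chi_zero_left]
  simp [coef, h1]

lemma coef_chi_of_ne {x y : ℤ × ℤ} (hxy : x ≠ y) (hc : cls x = cls y) : coef y (chi x) = 0 := by
  have h := coef_Dbar (v := chi x) (g := fun z => K * lpt x * chi x z) (continuous_chi x)
    (continuous_const.mul (continuous_chi x)) y (fun γ hγ z => by
      have h0 : chi (x - y) γ = 1 :=
        chi_lattice_of_cls_zero (by rw [cls_sub, hc, sub_self]) hγ
      have h1 := chi_add_left (x - y) y γ
      rw [sub_add_cancel, h0, one_mul] at h1
      rw [chi_add_right, h1, mul_comm])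
    (fun z _ => differentiable_chi x z) (fun z _ => Dbar_chi x z)
  rw [coef_const_mul] at h
  have h2 : (K * (lpt x - lpt y)) * coef y (chi x) = 0 := by linear_combination h
  exact (mul_eq_zero.1 h2).resolve_left
    (mul_ne_zero K_ne_zero (sub_ne_zero.2 fun e => hxy (lpt_injective e)))

lemma coef_synth (hc : RapidDecay c) {y : ℤ × ℤ} (hs : ∀ x, c x ≠ 0 → cls x = cls y) :
    coef y (synth c) = c y := by
  classical
  have hsm := hc.summable_norm
  have hcont : Continuous (synth c) := (contDiff_synth hc).continuous
  have hterm : ∀ x, Continuous fun z => c x * chi x z := fun x =>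
    continuous_const.mul (continuous_chi x)
  have hbound : ∀ s : Finset (ℤ × ℤ), y ∈ s →
      ‖coef y (synth c) - c y‖ ≤ ∑' x : {x // x ∉ s}, ‖c x‖ := fun s hys => by
    have h1 : coef y (fun z => synth c z + (-1) * ∑ x ∈ s, c x * chi x z)
        = coef y (synth c) - c y := by
      rw [coef_add (g := fun z => (-1) * ∑ x ∈ s, c x * chi x z) hcont
        (continuous_const.mul (continuous_finsetSum _ fun x _ => hterm x)), coef_const_mul,
        coef_sum s hterm, Finset.sum_eq_single y (fun x _ hxy => by
          rw [coef_const_mul]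
          by_cases hx : c x = 0
          · rw [hx, zero_mul]
          · rw [coef_chi_of_ne hxy (hs x hx), mul_zero]) (fun h => absurd hys h),
        coef_const_mul, coef_chi_self]
      ring
    rw [← h1]
    refine norm_coef_le (fun z => ?_) y
    have h2 := (summable_synth hsm z).sum_add_tsum_subtype_compl s
    have h3 : synth c z + (-1) * ∑ x ∈ s, c x * chi x z = ∑' x : {x // x ∉ s}, c x * chi x z := by
      rw [synth, ← h2]; ring
    rw [h3]
    refine (norm_tsum_le_tsum_norm ?_).trans (le_of_eq ?_)
    · simp only [norm_mul, norm_chi, mul_one]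
      exact hsm.subtype _
    · simp only [norm_mul, norm_chi, mul_one]
  have ht : Tendsto (fun s : Finset (ℤ × ℤ) => ∑' x : {x // x ∉ s}, ‖c x‖) atTop (𝓝 0) :=
    tendsto_tsum_compl_atTop_zero fun x => ‖c x‖
  have : ‖coef y (synth c) - c y‖ ≤ 0 :=
    ge_of_tendsto ht ((eventually_ge_atTop {y}).mono fun s hs =>
      hbound s (hs (Finset.mem_singleton_self y)))
  exact sub_eq_zero.1 (norm_le_zero_iff.1 this)

lemma synth_omega_mul (c : ℤ × ℤ → ℂ) (z : ℂ) :
    synth c (ω * z) = synth (fun x => c (rot x)) z := by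
  rw [synth, synth, ← rotEquiv.tsum_eq]
  refine tsum_congr fun x => ?_
  change c (rot x) * chi (rot x) (ω * z) = _
  rw [chi_omega_mul, rot_rot_rot]

end Synthesis

section Regularity

/-- Restriction of a lattice function to a residue class. -/
def restr (j : ZMod 3) (c : ℤ × ℤ → ℂ) (x : ℤ × ℤ) : ℂ := if cls x = j then c x else 0

/-- The pair of functions with combined Fourier coefficients `c`. -/
def synthPair (c : ℤ × ℤ → ℂ) (z : ℂ) : ℂ × ℂ := (synth (restr 2 c) z, synth (restr 1 c) z)

variable {b : ℤ × ℤ →₀ ℂ} {α k κ : ℂ} {c : ℤ × ℤ → ℂ} {v₁ v₂ : ℂ → ℂ}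

lemma restr_of_eq {j : ZMod 3} {x : ℤ × ℤ} (h : cls x = j) : restr j c x = c x := if_pos h

lemma restr_ne_zero {j : ZMod 3} {x : ℤ × ℤ} (h : restr j c x ≠ 0) : cls x = j := by
  by_contra hne
  exact h (if_neg hne)

lemma RapidDecay.restr (hc : RapidDecay c) (j : ZMod 3) : RapidDecay (restr j c) :=
  hc.mono fun x => by
    unfold TBG.restr
    split_ifs
    · exact le_rfl
    · rw [norm_zero]; exact norm_nonneg _

lemma coef_synth_restr (hc : RapidDecay c) {j : ZMod 3} {x : ℤ × ℤ} (hx : cls x = j) :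
    coef x (synth (restr j c)) = c x := by
  rw [coef_synth (hc.restr j) fun y hy => (restr_ne_zero hy).trans hx.symm, restr_of_eq hx]

lemma synth_restr_add_lattice {x₀ : ℤ × ℤ} {j : ZMod 3} (hx : cls x₀ = j) {γ : ℂ} (hγ : γ ∈ Λ)
    (z : ℂ) : synth (restr j c) (z + γ) = chi x₀ γ * synth (restr j c) z :=
  synth_add_lattice (fun _ hy => (restr_ne_zero hy).trans hx.symm) hγ z

lemma trig_add_lattice {x₀ : ℤ × ℤ} (hb : ∀ d, b d ≠ 0 → cls d = cls x₀) {γ : ℂ} (hγ : γ ∈ Λ)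
    (z : ℂ) : trig b (z + γ) = chi x₀ γ * trig b z := by
  rw [trig, trig, Finsupp.mul_sum]
  refine Finsupp.sum_congr fun d hd => ?_
  have h0 : chi (d - x₀) γ = 1 := chi_lattice_of_cls_zero
    (by rw [cls_sub, hb d (Finsupp.mem_support_iff.1 hd), sub_self]) hγ
  have h1 := chi_add_left (d - x₀) x₀ γ
  rw [sub_add_cancel, h0, one_mul] at h1
  rw [chi_add_right, h1]
  ring

lemma Dbar_add_lattice {f : ℂ → ℂ} {x₀ : ℤ × ℤ} {γ : ℂ} (hf : Differentiable ℝ f)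
    (h : ∀ z, f (z + γ) = chi x₀ γ * f z) (z : ℂ) : Dbar f (z + γ) = chi x₀ γ * Dbar f z := by
  rw [← Dbar_const_mul _ (hf z), ← funext h, Dbar, Dbar, fderiv_comp_add_right]

lemma continuous_Dbar {f : ℂ → ℂ} (hf : ContDiff ℝ (⊤ : ℕ∞) f) : Continuous (Dbar f) := by
  have h : Continuous (fderiv ℝ f) := hf.continuous_fderiv (by simp)
  unfold Dbar
  exact continuous_const.mul ((h.clm_apply continuous_const).add
    (continuous_const.mul (h.clm_apply continuous_const)))

lemma eq_zero_of_coef_equation {u v : ℂ → ℂ} {x₀ : ℤ × ℤ} {m : ℂ} {t : ℤ × ℤ →₀ ℂ}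
    (hu : ContDiff ℝ (⊤ : ℕ∞) u) (hv : Continuous v)
    (hu' : ∀ γ ∈ Λ, ∀ z, u (z + γ) = chi x₀ γ * u z)
    (hv' : ∀ γ ∈ Λ, ∀ z, trig t (z + γ) * v (z + γ) = chi x₀ γ * (trig t z * v z))
    (h : ∀ x, cls x = cls x₀ →
      (K * lpt x + m) * coef x u + α * convol t (fun y => coef y v) x = 0) (z : ℂ) :
    Dbar u z + m * u z + α * trig t z * v z = 0 := by
  have ht : Continuous (trig t) := (contDiff_trig t (n := 0)).continuous
  have hud : Differentiable ℝ u := hu.differentiable (by simp)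
  have hDc := continuous_Dbar hu
  have key := eq_zero_of_coef_eq_zero
    (f := fun z => Dbar u z + (m * u z + α * (trig t z * v z)))
    (hDc.add ((continuous_const.mul hu.continuous).add (continuous_const.mul (ht.mul hv)))) x₀
    (fun γ hγ z => by
      rw [Dbar_add_lattice hud (hu' γ hγ), hu' γ hγ, hv' γ hγ]; ring)
    (fun y hy => by
      have hp : ∀ γ ∈ Λ, ∀ z, u (z + γ) = chi y γ * u z := fun γ hγ z => by
        have h0 : chi (y - x₀) γ = 1 :=
          chi_lattice_of_cls_zero (by rw [cls_sub, hy, sub_self]) hγ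
        have h1 := chi_add_left (y - x₀) x₀ γ
        rw [sub_add_cancel, h0, one_mul] at h1
        rw [h1, hu' γ hγ]
      rw [coef_add (g := fun z => m * u z + α * (trig t z * v z)) hDc
        ((continuous_const.mul hu.continuous).add (continuous_const.mul (ht.mul hv))),
        coef_add (f := fun z => m * u z) (g := fun z => α * (trig t z * v z))
        (continuous_const.mul hu.continuous) (continuous_const.mul (ht.mul hv)),
        coef_const_mul, coef_const_mul, coef_trig_mul _ hv,
        coef_Dbar hu.continuous hDc y hp (fun z _ => hud z) (fun z _ => rfl)]
      linear_combination h y hy) z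
  linear_combination key

theorem FourierKer.inKer (hb : ∀ d, b d ≠ 0 → cls d = 1) (h : FourierKer b α κ c)
    (hc : RapidDecay c) :
    InKer (trig b) (fun z => trig b (-z)) α (K * κ) (synthPair c) := by
  have h1 := contDiff_synth (hc.restr 1)
  have h2 := contDiff_synth (hc.restr 2)
  have hb' := cls_of_mapDomain_neg hb
  have c1 : cls (0, 1) = 1 := by decide
  have c2 : cls (1, 1) = 2 := by decide
  have hch : ∀ (x y w : ℤ × ℤ), cls w = cls x + cls y → ∀ γ ∈ Λ, chi w γ = chi x γ * chi y γ :=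
    fun x y w hw γ hγ => by
      have h0 : chi (w - (x + y)) γ = 1 :=
        chi_lattice_of_cls_zero (by rw [cls_sub, cls_add, hw, sub_self]) hγ
      have h1 := chi_add_left (w - (x + y)) (x + y) γ
      rwa [sub_add_cancel, h0, one_mul, chi_add_left] at h1
  refine ⟨h2.prodMk h1, fun z => ?_, fun z => ?_, fun γ hγ z => ?_, fun γ hγ z => ?_⟩
  · refine eq_zero_of_coef_equation (x₀ := (1, 1)) h2 h1.continuous
      (fun γ hγ => synth_restr_add_lattice c2 hγ) (fun γ hγ z => ?_) (fun x hx => ?_) z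
    · rw [trig_add_lattice (x₀ := (0, 1)) (fun d hd => (hb d hd).trans c1.symm) hγ,
        synth_restr_add_lattice c1 hγ, hch (0, 1) (0, 1) (1, 1) (by decide) γ hγ]
      ring
    · rw [c2] at hx
      have e := convol_hop_of_cls_two hb h.zero hx
      rw [convol_congr (b := b) (g := fun y => coef y (synth (restr 1 c))) fun d hd =>
        (coef_synth_restr hc (by rw [cls_sub, hx, hb d hd]; decide)).symm] at e
      rw [coef_synth_restr hc hx, ← e]
      have := h.eqn x (by rw [hx]; decide)
      linear_combination K * this
  · change Dbar _ z + K * κ * synth (restr 1 c) z + α * trig b (-z) * synth (restr 2 c) z = 0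
    rw [trig_neg]
    refine eq_zero_of_coef_equation (x₀ := (0, 1)) h1 h2.continuous
      (fun γ hγ => synth_restr_add_lattice c1 hγ) (fun γ hγ z => ?_) (fun x hx => ?_) z
    · rw [trig_add_lattice (x₀ := (1, 1)) (fun d hd => (hb' d hd).trans c2.symm) hγ,
        synth_restr_add_lattice c2 hγ, hch (1, 1) (1, 1) (0, 1) (by decide) γ hγ]
      ring
    · rw [c1] at hx
      have e := convol_hop_of_cls_one hb h.zero hx
      rw [convol_congr (b := b.mapDomain Neg.neg) (g := fun y => coef y (synth (restr 2 c)))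
        fun d hd => (coef_synth_restr hc (by rw [cls_sub, hx, hb' d hd]; decide)).symm] at e
      rw [coef_synth_restr hc hx, ← e]
      have := h.eqn x (by rw [hx]; decide)
      linear_combination K * this
  · rw [← chi_lattice_of_cls_two c2 hγ]
    exact synth_restr_add_lattice c2 hγ z
  · rw [← chi_lattice_of_cls_one c1 hγ]
    exact synth_restr_add_lattice c1 hγ z

lemma InKer.weakKer {u : ℂ → ℂ × ℂ} (h : InKer (trig b) (fun z => trig b (-z)) α k u) :
    WeakKer b α k (fun z => (u z).1) (fun z => (u z).2) where
  cont₁ := h.1.fst.continuous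
  cont₂ := h.1.snd.continuous
  diff₁ z _ := h.1.fst.differentiable (by simp) z
  diff₂ z _ := h.1.snd.differentiable (by simp) z
  eq₁ z _ := h.2.1 z
  eq₂ z _ := h.2.2.1 z
  per₁ := h.2.2.2.1
  per₂ := h.2.2.2.2

lemma pairCoef_synthPair (hc : RapidDecay c) (h0 : ∀ x, cls x = 0 → c x = 0) (x : ℤ × ℤ) :
    pairCoef (fun z => (synthPair c z).1) (fun z => (synthPair c z).2) x = c x := by
  by_cases hx : cls x = 0
  · rw [pairCoef_of_cls_zero hx, h0 x hx]
  rcases cls_eq_one_or_two hx with hx | hx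
  · rw [pairCoef_of_cls_one hx]; exact coef_synth_restr hc hx
  · rw [pairCoef_of_cls_two hx]; exact coef_synth_restr hc hx

theorem WeakKer.inKer (hb : ∀ d, b d ≠ 0 → cls d = 1) (h : WeakKer b α k v₁ v₂) :
    InKer (trig b) (fun z => trig b (-z)) α k (fun z => (v₁ z, v₂ z)) := by
  obtain ⟨κ, rfl⟩ : ∃ κ, k = K * κ := ⟨K⁻¹ * k, (mul_inv_cancel_left₀ K_ne_zero k).symm⟩
  have hF := h.fourierKer hb
  obtain ⟨C, hC⟩ := h.exists_bound
  have hd := hF.rapidDecay hC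
  have hk := hF.inKer hb hd
  obtain ⟨e1, e2⟩ := eq_of_pairCoef_eq h hk.weakKer fun x =>
    (pairCoef_synthPair hd hF.zero x).symm
  have : (fun z => (v₁ z, v₂ z)) = synthPair (pairCoef v₁ v₂) :=
    funext fun z => Prod.ext (congrFun e1 z) (congrFun e2 z)
  rw [this]
  exact hk

lemma pairCoef_eq_zero_imp (h : WeakKer b α k v₁ v₂) (h0 : ∀ x, pairCoef v₁ v₂ x = 0) :
    v₁ = 0 ∧ v₂ = 0 := by
  have hz : WeakKer b α k 0 0 :=
    { cont₁ := continuous_const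
      cont₂ := continuous_const
      diff₁ := fun z _ => differentiableAt_const 0
      diff₂ := fun z _ => differentiableAt_const 0
      eq₁ := fun z _ => by simp [Dbar]
      eq₂ := fun z _ => by simp [Dbar]
      per₁ := by simp
      per₂ := by simp }
  exact eq_of_pairCoef_eq h hz fun x => by
    rw [h0]
    simp [pairCoef, coef]

end Regularity

section FiniteDimension

open Filter Topology

variable {b : ℤ × ℤ →₀ ℂ} {α k κ : ℂ}

lemma norm_convol_le (t : ℤ × ℤ →₀ ℂ) {c : ℤ × ℤ → ℂ} {C : ℝ} (hC : ∀ x, ‖c x‖ ≤ C) (x : ℤ × ℤ) :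
    ‖convol t c x‖ ≤ (∑ d ∈ t.support, ‖t d‖) * C := by
  rw [convol, Finsupp.sum, Finset.sum_mul]
  refine (norm_sum_le _ _).trans (Finset.sum_le_sum fun d _ => ?_)
  rw [norm_mul]
  exact mul_le_mul_of_nonneg_left (hC _) (norm_nonneg _)

/-- Bounded solutions are determined by finitely many coefficients. -/
lemma FourierKer.eq_zero_of_ball {c : ℤ × ℤ → ℂ} (h : FourierKer b α κ c) {C : ℝ}
    (hC : ∀ x, ‖c x‖ ≤ C)
    (h0 : ∀ x, ‖lpt x‖ ≤ 2 * (‖α‖ * ∑ d ∈ (hop b).support, ‖hop b d‖) + ‖κ‖ + 1 → c x = 0)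
    (x : ℤ × ℤ) : c x = 0 := by
  set T := ∑ d ∈ (hop b).support, ‖hop b d‖
  have hT : 0 ≤ T := Finset.sum_nonneg fun _ _ => norm_nonneg _
  have step : ∀ C : ℝ, (∀ x, ‖c x‖ ≤ C) → ∀ x, ‖c x‖ ≤ C * (1 / 2) := fun C hC x => by
    have hC0 : 0 ≤ C := (norm_nonneg _).trans (hC 0)
    rcases le_or_gt ‖lpt x‖ (2 * (‖α‖ * T) + ‖κ‖ + 1) with hx | hx
    · rw [h0 x hx, norm_zero]; positivity
    by_cases hcx : cls x = 0
    · rw [h.zero x hcx, norm_zero]; positivity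
    have h3 : ‖lpt x + κ‖ * ‖c x‖ = ‖α‖ * ‖convol (hop b) c x‖ := by
      rw [← norm_mul, ← norm_mul, eq_neg_of_add_eq_zero_left (h.eqn x hcx), norm_neg]
    have h4 : 2 * (‖α‖ * T) + 1 ≤ ‖lpt x + κ‖ := by
      have : ‖lpt x‖ ≤ ‖lpt x + κ‖ + ‖κ‖ := by
        simpa using norm_sub_le (lpt x + κ) κ
      linarith
    have h5 : ‖α‖ * ‖convol (hop b) c x‖ ≤ ‖α‖ * (T * C) :=
      mul_le_mul_of_nonneg_left (norm_convol_le _ hC x) (norm_nonneg _)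
    have h6 : (2 * (‖α‖ * T) + 1) * ‖c x‖ ≤ (2 * (‖α‖ * T) + 1) * (C * (1 / 2)) := by
      calc _ ≤ ‖lpt x + κ‖ * ‖c x‖ := mul_le_mul_of_nonneg_right h4 (norm_nonneg _)
        _ ≤ ‖α‖ * (T * C) := h3.trans_le h5
        _ ≤ _ := by nlinarith
    exact le_of_mul_le_mul_left h6 (by positivity)
  have hn : ∀ n : ℕ, ∀ x, ‖c x‖ ≤ C * (1 / 2) ^ n := fun n => by
    induction n with
    | zero => simpa using hC
    | succ n ih =>
      intro x
      rw [pow_succ, ← mul_assoc]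
      exact step _ ih x
  have ht : Tendsto (fun n : ℕ => C * (1 / 2 : ℝ) ^ n) atTop (𝓝 (C * 0)) :=
    (tendsto_pow_atTop_nhds_zero_of_lt_one (by norm_num) (by norm_num)).const_mul C
  rw [mul_zero] at ht
  exact norm_le_zero_iff.1 (ge_of_tendsto' ht fun n => hn n x)

/-- `Ker(α,k)` as a linear subspace. -/
def kerSubmodule (Up Um : ℂ → ℂ) (α k : ℂ) : Submodule ℂ (ℂ → ℂ × ℂ) where
  carrier := kerSet Up Um α k
  zero_mem' := by
    refine ⟨contDiff_const, fun z => ?_, fun z => ?_, fun γ _ z => ?_, fun γ _ z => ?_⟩ <;>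
      simp [Dbar]
  add_mem' := by
    intro u v hu hv
    have du1 : Differentiable ℝ fun z => (u z).1 := hu.1.fst.differentiable (by simp)
    have du2 : Differentiable ℝ fun z => (u z).2 := hu.1.snd.differentiable (by simp)
    have dv1 : Differentiable ℝ fun z => (v z).1 := hv.1.fst.differentiable (by simp)
    have dv2 : Differentiable ℝ fun z => (v z).2 := hv.1.snd.differentiable (by simp)
    refine ⟨hu.1.add hv.1, fun z => ?_, fun z => ?_, fun γ hγ z => ?_, fun γ hγ z => ?_⟩
    · simp only [Pi.add_apply, Prod.fst_add, Prod.snd_add]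
      rw [Dbar_add (du1 z) (dv1 z)]
      linear_combination hu.2.1 z + hv.2.1 z
    · simp only [Pi.add_apply, Prod.fst_add, Prod.snd_add]
      rw [Dbar_add (du2 z) (dv2 z)]
      linear_combination hu.2.2.1 z + hv.2.2.1 z
    · simp only [Pi.add_apply, Prod.fst_add]
      rw [hu.2.2.2.1 γ hγ, hv.2.2.2.1 γ hγ]; ring
    · simp only [Pi.add_apply, Prod.snd_add]
      rw [hu.2.2.2.2 γ hγ, hv.2.2.2.2 γ hγ]; ring
  smul_mem' := by
    intro r u hu
    have du1 : Differentiable ℝ fun z => (u z).1 := hu.1.fst.differentiable (by simp)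
    have du2 : Differentiable ℝ fun z => (u z).2 := hu.1.snd.differentiable (by simp)
    refine ⟨contDiff_const.smul hu.1, fun z => ?_, fun z => ?_, fun γ hγ z => ?_,
      fun γ hγ z => ?_⟩
    · simp only [Pi.smul_apply, Prod.smul_fst, Prod.smul_snd, smul_eq_mul]
      rw [Dbar_const_mul r (du1 z)]
      linear_combination r * hu.2.1 z
    · simp only [Pi.smul_apply, Prod.smul_fst, Prod.smul_snd, smul_eq_mul]
      rw [Dbar_const_mul r (du2 z)]
      linear_combination r * hu.2.2.1 z
    · simp only [Pi.smul_apply, Prod.smul_fst, smul_eq_mul]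
      rw [hu.2.2.2.1 γ hγ]; ring
    · simp only [Pi.smul_apply, Prod.smul_snd, smul_eq_mul]
      rw [hu.2.2.2.2 γ hγ]; ring

lemma mem_kerSubmodule {Up Um : ℂ → ℂ} {u : ℂ → ℂ × ℂ} :
    u ∈ kerSubmodule Up Um α k ↔ InKer Up Um α k u := Iff.rfl

theorem finite_kerSubmodule (hb : ∀ d, b d ≠ 0 → cls d = 1) (α k : ℂ) :
    Module.Finite ℂ (kerSubmodule (trig b) (fun z => trig b (-z)) α k) := by
  obtain ⟨κ, rfl⟩ : ∃ κ, k = K * κ := ⟨K⁻¹ * k, (mul_inv_cancel_left₀ K_ne_zero k).symm⟩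
  set R := 2 * (‖α‖ * ∑ d ∈ (hop b).support, ‖hop b d‖) + ‖κ‖ + 1
  have hfin := finite_norm_lpt_le R
  have : Finite {x | ‖lpt x‖ ≤ R} := hfin
  have hfc : ∀ u : kerSubmodule (trig b) (fun z => trig b (-z)) α (K * κ),
      WeakKer b α (K * κ) (fun z => (u.1 z).1) (fun z => (u.1 z).2) := fun u =>
    (mem_kerSubmodule.1 u.2).weakKer
  let L : kerSubmodule (trig b) (fun z => trig b (-z)) α (K * κ) →ₗ[ℂ]
      ({x | ‖lpt x‖ ≤ R} → ℂ) :=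
    { toFun := fun u x => pairCoef (fun z => (u.1 z).1) (fun z => (u.1 z).2) x
      map_add' := fun u v => by
        funext x
        have e1 := coef_add (hfc u).cont₁ (hfc v).cont₁ x.1
        have e2 := coef_add (hfc u).cont₂ (hfc v).cont₂ x.1
        simp only [pairCoef, Pi.add_apply]
        split_ifs
        · exact e1
        · exact e2
        · rw [add_zero]
      map_smul' := fun r u => by
        funext x
        simp only [pairCoef, Pi.smul_apply, smul_eq_mul, RingHom.id_apply]
        split_ifs
        · exact coef_const_mul r _ _
        · exact coef_const_mul r _ _
        · rw [mul_zero] }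
  refine Module.Finite.of_injective L ((injective_iff_map_eq_zero L).2 fun u hu => ?_)
  obtain ⟨C, hC⟩ := (hfc u).exists_bound
  have h0 := ((hfc u).fourierKer hb).eq_zero_of_ball hC fun x hx =>
    congrFun hu ⟨x, hx⟩
  obtain ⟨e1, e2⟩ := pairCoef_eq_zero_imp (hfc u) h0
  ext z
  · exact congrFun e1 z
  · exact congrFun e2 z

theorem two_le_kerDim (hb : ∀ d, b d ≠ 0 → cls d = 1) {u v : ℂ → ℂ × ℂ}
    (hu : InKer (trig b) (fun z => trig b (-z)) α k u)
    (hv : InKer (trig b) (fun z => trig b (-z)) α k v)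
    (hl : ∀ r s : ℂ, r • u + s • v = 0 → r = 0 ∧ s = 0) :
    2 ≤ kerDim (trig b) (fun z => trig b (-z)) α k := by
  have hspan : Submodule.span ℂ (kerSet (trig b) (fun z => trig b (-z)) α k) =
      kerSubmodule (trig b) (fun z => trig b (-z)) α k :=
    Submodule.span_eq (kerSubmodule (trig b) (fun z => trig b (-z)) α k)
  rw [kerDim, hspan]
  have := finite_kerSubmodule hb α k
  have hli : LinearIndependent ℂ
      ![(⟨u, hu⟩ : kerSubmodule (trig b) (fun z => trig b (-z)) α k), ⟨v, hv⟩] :=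
    LinearIndependent.pair_iff.2 fun r s h => hl r s (congrArg Subtype.val h)
  simpa using hli.fintype_card_le_finrank

end FiniteDimension

section Kronecker

open Filter Topology

/-- The nome of the lattice. -/
def nome : ℂ := exp (2 * Real.pi * I * ω)

/-- A term of the Kronecker series. -/
def kronTerm (w : ℂ) (n : ℤ) (z : ℂ) : ℂ := w ^ n / (1 - nome ^ n * exp (2 * Real.pi * I * z))

/-- The Kronecker series over an index set. -/
def kron (w : ℂ) (J : Set ℤ) (z : ℂ) : ℂ := ∑' n, J.indicator (fun n => kronTerm w n z) n

lemma nome_ne_zero : nome ≠ 0 := exp_ne_zero _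

lemma norm_nome : ‖nome‖ = Real.exp (-(Real.pi * Real.sqrt 3)) := by
  rw [nome, norm_exp]
  congr 1
  simp [omega_im, omega_re]
  ring

lemma norm_nome_lt_one : ‖nome‖ < 1 := by
  rw [norm_nome, Real.exp_lt_one_iff, neg_lt_zero]
  positivity

lemma norm_nome_pos : 0 < ‖nome‖ := norm_pos_iff.2 nome_ne_zero

lemma nome_zpow_mul_exp (n : ℤ) (z : ℂ) :
    nome ^ n * exp (2 * Real.pi * I * z) = exp (2 * Real.pi * I * (n * ω + z)) := by
  rw [nome, ← exp_int_mul, ← exp_add]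
  congr 1
  ring

lemma nome_zpow_mul_exp_eq_one {n : ℤ} {z : ℂ} (h : nome ^ n * exp (2 * Real.pi * I * z) = 1) :
    ∃ m : ℤ, z = (-n : ℤ) * ω + m := by
  rw [nome_zpow_mul_exp, exp_eq_one_iff] at h
  obtain ⟨m, hm⟩ := h
  refine ⟨m, ?_⟩
  have h2 : (2 * Real.pi * I : ℂ) ≠ 0 := two_pi_I_ne_zero
  have h3 : (2 * Real.pi * I) * (n * ω + z) = (2 * Real.pi * I) * m := by
    rw [hm]; ring
  have h4 := mul_left_cancel₀ h2 h3
  push_cast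
  linear_combination h4

lemma nome_zpow_mul_exp_ne_one {z : ℂ} (hz : z ∉ Λ) (n : ℤ) :
    nome ^ n * exp (2 * Real.pi * I * z) ≠ 1 := fun h => by
  obtain ⟨m, hm⟩ := nome_zpow_mul_exp_eq_one h
  exact hz ⟨_, _, hm⟩

lemma exists_nome_zpow_of_mem {z : ℂ} (hz : z ∈ Λ) :
    ∃ n : ℤ, nome ^ n * exp (2 * Real.pi * I * z) = 1 := by
  obtain ⟨m, n, rfl⟩ := hz
  refine ⟨-m, ?_⟩
  rw [nome_zpow_mul_exp, exp_eq_one_iff]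
  exact ⟨n, by push_cast; ring⟩

lemma exists_pos_le_of_eventually {J : Set ℤ} {f : ℤ → ℝ} (h : ∀ n ∈ J, 0 < f n) {δ₀ : ℝ}
    (hδ : 0 < δ₀) (he : ∀ᶠ n in cofinite, δ₀ ≤ f n) : ∃ δ > 0, ∀ n ∈ J, δ ≤ f n := by
  classical
  have hfin : Set.Finite {n | ¬ δ₀ ≤ f n} := he
  set s : Finset ℤ := hfin.toFinset.filter (· ∈ J)
  by_cases hs : s.Nonempty
  · obtain ⟨m, hm, hmin⟩ := s.exists_min_image f hs
    have hmJ : m ∈ J := (Finset.mem_filter.1 hm).2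
    refine ⟨min δ₀ (f m), lt_min hδ (h m hmJ), fun n hn => ?_⟩
    by_cases hn' : δ₀ ≤ f n
    · exact (min_le_left _ _).trans hn'
    · exact (min_le_right _ _).trans
        (hmin n (Finset.mem_filter.2 ⟨hfin.mem_toFinset.2 hn', hn⟩))
  · refine ⟨δ₀, hδ, fun n hn => ?_⟩
    by_contra hn'
    exact hs ⟨n, Finset.mem_filter.2 ⟨hfin.mem_toFinset.2 hn', hn⟩⟩

lemma tendsto_zpow_const_atTop {r : ℝ} (hr : 1 < r) :
    Tendsto (fun n : ℤ => r ^ n) atTop atTop := by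
  refine tendsto_atTop.2 fun x => ?_
  obtain ⟨N, hN⟩ := pow_unbounded_of_one_lt x hr
  filter_upwards [eventually_ge_atTop (N : ℤ)] with n hn
  exact hN.le.trans (by simpa using zpow_le_zpow_right₀ hr.le hn)

lemma exists_lower_bound {J : Set ℤ} {q ζ : ℂ} (hq0 : 0 < ‖q‖) (hq1 : ‖q‖ < 1) (hζ : ζ ≠ 0)
    (h : ∀ n ∈ J, q ^ n * ζ ≠ 1) :
    ∃ δ > 0, ∀ n ∈ J, 2 * δ * (1 + ‖q‖ ^ n) ≤ ‖1 - q ^ n * ζ‖ := by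
  have hpos : ∀ n : ℤ, 0 < 1 + ‖q‖ ^ n := fun n => by positivity
  have hζ' : 0 < ‖ζ‖ := norm_pos_iff.2 hζ
  obtain ⟨δ, hδ, hle⟩ := exists_pos_le_of_eventually (J := J)
    (f := fun n => ‖1 - q ^ n * ζ‖ / (1 + ‖q‖ ^ n))
    (fun n hn => div_pos (norm_pos_iff.2 (sub_ne_zero.2 (h n hn).symm)) (hpos n))
    (δ₀ := min (1 / 4) (‖ζ‖ / 4)) (by positivity) (by
      have hlow : ∀ x : ℝ, 0 < x → x * ‖ζ‖ ≤ 1 / 4 → x ≤ 1 → 1 / 4 * (1 + x) ≤ 1 - x * ‖ζ‖ := by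
        intro x hx h1 h2; nlinarith
      rw [Int.cofinite_eq, eventually_sup]
      constructor
      · have ht : Tendsto (fun n : ℤ => ‖q‖ ^ n) atBot atTop := by
          have := (tendsto_zpow_const_atTop (one_lt_inv₀ hq0 |>.2 hq1)).comp tendsto_neg_atBot_atTop
          refine this.congr fun n => ?_
          simp
        filter_upwards [ht.eventually_ge_atTop (max 1 (4 / ‖ζ‖))] with n hn
        refine (min_le_right _ _).trans ?_
        rw [le_div_iff₀ (hpos n)]
        have h1 : 1 ≤ ‖q‖ ^ n := (le_max_left _ _).trans hn
        have h2 : 4 ≤ ‖q‖ ^ n * ‖ζ‖ := by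
          rw [← div_le_iff₀ hζ']; exact (le_max_right _ _).trans hn
        have h3 : ‖q‖ ^ n * ‖ζ‖ - 1 ≤ ‖1 - q ^ n * ζ‖ := by
          have := norm_sub_norm_le (q ^ n * ζ) 1
          rwa [norm_mul, norm_zpow, norm_one, norm_sub_rev] at this
        nlinarith
      · have ht : Tendsto (fun n : ℤ => ‖q‖ ^ n) atTop (𝓝 0) := by
          have h1 : Tendsto (fun n : ℤ => (‖q‖⁻¹) ^ n) atTop atTop :=
            tendsto_zpow_const_atTop (one_lt_inv₀ hq0 |>.2 hq1)
          refine h1.inv_tendsto_atTop.congr fun n => ?_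
          simp
        have hev : ∀ᶠ n : ℤ in atTop, ‖q‖ ^ n < min 1 (1 / (4 * ‖ζ‖)) :=
          ht.eventually_lt_const (by positivity)
        filter_upwards [hev] with n hn
        refine (min_le_left _ _).trans ?_
        rw [le_div_iff₀ (hpos n)]
        have h1 : ‖q‖ ^ n ≤ 1 := (hn.trans_le (min_le_left _ _)).le
        have h2 : ‖q‖ ^ n * ‖ζ‖ ≤ 1 / 4 := by
          have := (hn.trans_le (min_le_right _ _)).le
          rw [le_div_iff₀ (by positivity)] at this
          linarith
        have h3 : 1 - ‖q‖ ^ n * ‖ζ‖ ≤ ‖1 - q ^ n * ζ‖ := by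
          have := norm_sub_norm_le 1 (q ^ n * ζ)
          rwa [norm_mul, norm_zpow, norm_one] at this
        exact (hlow _ (by positivity) h2 h1).trans h3)
  refine ⟨δ / 2, half_pos hδ, fun n hn => ?_⟩
  have := hle n hn
  rw [le_div_iff₀ (hpos n)] at this
  linarith

lemma summable_zpow_div {x y : ℝ} (hy : 0 < y) (hyx : y < x) (hx : x < 1) :
    Summable fun n : ℤ => x ^ n / (1 + y ^ n) := by
  have hx0 : 0 < x := hy.trans hyx
  refine Summable.of_nat_of_neg ?_ ?_
  · refine Summable.of_nonneg_of_le (fun n => by positivity) (fun n => ?_)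
      (summable_geometric_of_lt_one hx0.le hx)
    rw [zpow_natCast]
    refine div_le_self (by positivity) ?_
    have : 0 < y ^ (n : ℤ) := by positivity
    linarith
  · refine Summable.of_nonneg_of_le (fun n => by positivity) (fun n => ?_)
      (summable_geometric_of_lt_one (div_pos hy hx0).le ((div_lt_one hx0).2 hyx))
    rw [div_le_iff₀ (by positivity), zpow_neg, zpow_neg, zpow_natCast, zpow_natCast, div_pow]
    have : (y ^ n / x ^ n) * (1 + (y ^ n)⁻¹) = (x ^ n)⁻¹ + y ^ n / x ^ n := by
      field_simp
      ring
    rw [this]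
    have : 0 ≤ y ^ n / x ^ n := by positivity
    linarith

lemma exists_kron_bound {J : Set ℤ} {z₀ : ℂ}
    (h : ∀ n ∈ J, nome ^ n * exp (2 * Real.pi * I * z₀) ≠ 1) :
    ∃ δ > 0, ∃ V : Set ℂ, IsOpen V ∧ z₀ ∈ V ∧ ∀ z ∈ V, ∀ n ∈ J,
      δ * (1 + ‖nome‖ ^ n) ≤ ‖1 - nome ^ n * exp (2 * Real.pi * I * z)‖ := by
  obtain ⟨δ, hδ, hle⟩ := exists_lower_bound norm_nome_pos norm_nome_lt_one (exp_ne_zero _) h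
  have hc : Continuous fun z : ℂ => exp (2 * Real.pi * I * z) := by fun_prop
  refine ⟨δ, hδ, {z | ‖exp (2 * Real.pi * I * z) - exp (2 * Real.pi * I * z₀)‖ < δ},
    isOpen_lt (hc.sub continuous_const).norm continuous_const, by simpa using hδ,
    fun z hz n hn => ?_⟩
  have hz' : ‖exp (2 * Real.pi * I * z) - exp (2 * Real.pi * I * z₀)‖ < δ := hz
  have h1 := hle n hn
  have h2 : ‖1 - nome ^ n * exp (2 * Real.pi * I * z₀)‖ ≤
      ‖1 - nome ^ n * exp (2 * Real.pi * I * z)‖ +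
      ‖nome‖ ^ n * ‖exp (2 * Real.pi * I * z) - exp (2 * Real.pi * I * z₀)‖ := by
    rw [← norm_zpow, ← norm_mul]
    refine le_trans (le_of_eq ?_) (norm_add_le _ _)
    congr 1; ring
  have hp : 0 < ‖nome‖ ^ n := zpow_pos norm_nome_pos n
  nlinarith

lemma isOpen_compl_Λ : IsOpen Λᶜ := by
  refine isOpen_iff_mem_nhds.2 fun z₀ hz₀ => ?_
  obtain ⟨δ, hδ, V, hV, hzV, hle⟩ := exists_kron_bound (J := Set.univ) (z₀ := z₀)
    fun n _ => nome_zpow_mul_exp_ne_one hz₀ n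
  filter_upwards [hV.mem_nhds hzV] with z hz hzΛ
  obtain ⟨n, hn⟩ := exists_nome_zpow_of_mem hzΛ
  have := hle z hz n trivial
  rw [hn, sub_self, norm_zero] at this
  have hp : 0 < ‖nome‖ ^ n := zpow_pos norm_nome_pos n
  nlinarith

lemma kron_aux {w : ℂ} (hw0 : ‖nome‖ < ‖w‖) (hw1 : ‖w‖ < 1) {J : Set ℤ} {z₀ : ℂ}
    (h : ∀ n ∈ J, nome ^ n * exp (2 * Real.pi * I * z₀) ≠ 1) :
    DifferentiableAt ℂ (kron w J) z₀ ∧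
      Summable fun n => J.indicator (fun n => kronTerm w n z₀) n := by
  obtain ⟨δ, hδ, V, hV, hzV, hle⟩ := exists_kron_bound h
  have hu : Summable fun n : ℤ => δ⁻¹ * (‖w‖ ^ n / (1 + ‖nome‖ ^ n)) :=
    (summable_zpow_div norm_nome_pos hw0 hw1).mul_left _
  have hw : 0 < ‖w‖ := norm_nome_pos.trans hw0
  have hb : ∀ n, ∀ z ∈ V, ‖J.indicator (fun n => kronTerm w n z) n‖ ≤
      δ⁻¹ * (‖w‖ ^ n / (1 + ‖nome‖ ^ n)) := fun n z hz => by
    have hp : 0 < ‖nome‖ ^ n := zpow_pos norm_nome_pos n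
    have hp2 : 0 < ‖w‖ ^ n := zpow_pos hw n
    by_cases hn : n ∈ J
    · rw [Set.indicator_of_mem hn, kronTerm, norm_div, norm_zpow]
      have := hle z hz n hn
      rw [inv_mul_eq_div, div_div, mul_comm (1 + _) δ]
      exact div_le_div_of_nonneg_left hp2.le (by positivity) this
    · rw [Set.indicator_of_notMem hn, norm_zero]; positivity
  constructor
  · have hd := differentiableOn_tsum_of_summable_norm
      (F := fun (n : ℤ) z => J.indicator (fun n => kronTerm w n z) n) hu (fun n z hz => by
      by_cases hn : n ∈ J
      · simp only [Set.indicator_of_mem hn]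
        have hne : 1 - nome ^ n * exp (2 * Real.pi * I * z) ≠ 0 := by
          have h1 := hle z hz n hn
          have hp : 0 < ‖nome‖ ^ n := zpow_pos norm_nome_pos n
          exact norm_pos_iff.1 (lt_of_lt_of_le (by positivity) h1)
        unfold kronTerm
        have h2 : DifferentiableAt ℂ
            (fun z => 1 - nome ^ n * exp (2 * Real.pi * I * z)) z := by fun_prop
        exact ((differentiableAt_const _).div h2 hne).differentiableWithinAt
      · simp only [Set.indicator_of_notMem hn]
        exact differentiableWithinAt_const 0) hV hb
    exact (hd z₀ hzV).differentiableAt (hV.mem_nhds hzV)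
  · exact Summable.of_norm_bounded hu fun n => hb n z₀ hzV

lemma kron_add_one (w z : ℂ) : kron w Set.univ (z + 1) = kron w Set.univ z := by
  have : exp (2 * Real.pi * I * (z + 1)) = exp (2 * Real.pi * I * z) := by
    rw [mul_add, mul_one, exp_add, exp_two_pi_mul_I, mul_one]
  simp only [kron, kronTerm, this]

lemma kron_add_omega {w : ℂ} (hw : w ≠ 0) (z : ℂ) :
    kron w Set.univ (z + ω) = w⁻¹ * kron w Set.univ z := by
  simp only [kron, Set.indicator_univ]
  rw [← (Equiv.addRight (1 : ℤ)).tsum_eq (fun n => kronTerm w n z), ← tsum_mul_left]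
  refine tsum_congr fun n => ?_
  rw [kronTerm, kronTerm, Equiv.coe_addRight, mul_add, exp_add, ← nome, zpow_add_one₀ hw,
    zpow_add_one₀ nome_ne_zero]
  field_simp

lemma eq_zero_of_mem_Λ_of_norm_lt_one {z : ℂ} (hz : z ∈ Λ) (h : ‖z‖ < 1) : z = 0 := by
  obtain ⟨m, n, rfl⟩ := hz
  by_contra h0
  have h1 : (m, n) ≠ 0 := by
    rintro he
    simp only [Prod.mk_eq_zero] at he
    exact h0 (by rw [he.1, he.2]; simp)
  have := one_le_norm_lpt h1
  simp only [lpt] at this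
  linarith

lemma tendsto_mul_kron {w : ℂ} (hw0 : ‖nome‖ < ‖w‖) (hw1 : ‖w‖ < 1) :
    Tendsto (fun z => z * kron w Set.univ z) (𝓝[≠] 0) (𝓝 (-(2 * Real.pi * I)⁻¹)) := by
  have hne : ∀ n ∈ ({0}ᶜ : Set ℤ), nome ^ n * exp (2 * Real.pi * I * 0) ≠ 1 := fun n hn h => by
    obtain ⟨m, hm⟩ := nome_zpow_mul_exp_eq_one h
    have h2 : lpt (-n, m) = 0 := hm.symm
    rw [lpt_eq_zero_iff] at h2
    have := congrArg Prod.fst h2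
    simp only [Prod.fst_zero, neg_eq_zero] at this
    exact hn this
  have hcont := (kron_aux hw0 hw1 hne).1.continuousAt
  have hsplit : ∀ᶠ z in 𝓝[≠] (0 : ℂ), z * kron w {0}ᶜ z +
      -((z⁻¹ * (exp (2 * Real.pi * I * z) - 1))⁻¹) = z * kron w Set.univ z := by
    have hball : ∀ᶠ z in 𝓝[≠] (0 : ℂ), ‖z‖ < 1 := by
      refine eventually_nhdsWithin_of_eventually_nhds ?_
      exact (continuous_norm.tendsto' (0 : ℂ) 0 norm_zero).eventually_lt_const one_pos
    filter_upwards [hball, self_mem_nhdsWithin] with z hz hz0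
    have hz0' : z ≠ 0 := hz0
    have hzΛ : z ∉ Λ := fun h => hz0' (eq_zero_of_mem_Λ_of_norm_lt_one h hz)
    have hs := (kron_aux (J := Set.univ) hw0 hw1
      fun n _ => nome_zpow_mul_exp_ne_one hzΛ n).2
    rw [kron, kron, hs.tsum_eq_add_tsum_ite 0, mul_add, add_comm]
    have hne1 : exp (2 * Real.pi * I * z) ≠ 1 := by
      simpa using nome_zpow_mul_exp_ne_one hzΛ 0
    congr 1
    · rw [Set.indicator_of_mem (Set.mem_univ _), kronTerm, zpow_zero, zpow_zero, one_mul, mul_inv,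
        inv_inv, ← mul_neg, ← inv_neg, neg_sub, one_div]
    · congr 1
      refine tsum_congr fun n => ?_
      by_cases hn : n = 0
      · simp [hn]
      · simp [hn]
  have hder : HasDerivAt (fun z => exp (2 * Real.pi * I * z)) (2 * Real.pi * I) 0 := by
    have h1 : HasDerivAt (fun z : ℂ => 2 * Real.pi * I * z) (2 * Real.pi * I * 1) 0 :=
      (hasDerivAt_id 0).const_mul _
    simpa using h1.cexp
  have hslope := hder.tendsto_slope
  have h1 : Tendsto (fun z : ℂ => z⁻¹ * (exp (2 * Real.pi * I * z) - 1)) (𝓝[≠] 0)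
      (𝓝 (2 * Real.pi * I)) := by
    refine hslope.congr fun z => ?_
    simp [slope_def_field, div_eq_inv_mul]
  have h2 : Tendsto (fun z => z * kron w {0}ᶜ z) (𝓝[≠] 0) (𝓝 (0 * kron w {0}ᶜ 0)) :=
    (continuousAt_id.mul hcont).tendsto.mono_left nhdsWithin_le_nhds
  rw [zero_mul] at h2
  have h3 := h2.add (h1.inv₀ two_pi_I_ne_zero).neg
  rw [zero_add] at h3
  exact h3.congr' hsplit

end Kronecker

section Multipliers

open Filter Topology

/-- The unitary factor carrying the shift of the quasimomentum by `b`. -/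
def gauge (b z : ℂ) : ℂ := exp (I * (pair (-b) z : ℂ))

lemma gauge_add (b z w : ℂ) : gauge b (z + w) = gauge b z * gauge b w := by
  rw [gauge, gauge, gauge, pair_add_right, ofReal_add, mul_add, exp_add]

lemma gauge_ne_zero (b z : ℂ) : gauge b z ≠ 0 := exp_ne_zero _

lemma gauge_zero (b : ℂ) : gauge b 0 = 1 := by simp [gauge, pair]

lemma norm_gauge (b z : ℂ) : ‖gauge b z‖ = 1 := by
  rw [gauge, mul_comm, norm_exp_ofReal_mul_I]

lemma contDiff_gauge (b : ℂ) {n : WithTop ℕ∞} : ContDiff ℝ n (gauge b) := contDiff_exp_pair _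

lemma continuous_gauge (b : ℂ) : Continuous (gauge b) := (contDiff_gauge b (n := 0)).continuous

lemma Dbar_gauge (b z : ℂ) : Dbar (gauge b) z = -b * gauge b z := Dbar_exp_pair _ _

lemma gauge_add_left (b c z : ℂ) : gauge (b + c) z = gauge b z * gauge c z := by
  rw [gauge, gauge, gauge, neg_add, pair_add_left, ofReal_add, mul_add, exp_add]

lemma gauge_mul_omega (b z : ℂ) : gauge (b * ω) (ω * z) = gauge b z := by
  rw [gauge, gauge]
  congr 3
  have h : ω * (starRingEnd ℂ) ω = 1 := by
    rw [mul_conj, normSq_eq_norm_sq, norm_omega]; simp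
  rw [pair, pair, map_mul]
  congr 1
  linear_combination (-b * (starRingEnd ℂ) z) * h

/-- A meromorphic factor which, multiplied by `gauge b`, is lattice periodic, with at most simple
poles on the lattice. -/
structure IsMultiplier (b ρ : ℂ) (g : ℂ → ℂ) : Prop where
  diff : ∀ z ∉ Λ, DifferentiableAt ℂ g z
  res : Tendsto (fun z => z * g z) (𝓝[≠] 0) (𝓝 ρ)
  per : ∀ γ ∈ Λ, ∀ z, gauge b (z + γ) * g (z + γ) = gauge b z * g z

lemma periodic_of_one_of_omega {F : ℂ → ℂ} (h1 : ∀ z, F (z + 1) = F z)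
    (h2 : ∀ z, F (z + ω) = F z) : ∀ γ ∈ Λ, ∀ z, F (z + γ) = F z := by
  rintro γ ⟨m, n, rfl⟩ z
  have e1 : Function.Periodic F 1 := h1
  have e2 : Function.Periodic F ω := h2
  have e3 := e2.int_mul m (z + n)
  have e4 := e1.int_mul n z
  rw [mul_one] at e4
  rw [← e4, ← e3]
  congr 1
  ring

lemma exists_isMultiplier_of_re {b : ℂ} (hb : Int.fract (b.re / (2 * Real.pi)) ≠ 0) :
    ∃ ρ g, ρ ≠ 0 ∧ IsMultiplier b ρ g := by
  set r : ℝ := Int.fract (b.re / (2 * Real.pi)) with hr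
  have hr0 : 0 < r := lt_of_le_of_ne (Int.fract_nonneg _) (Ne.symm hb)
  have hr1 : r < 1 := Int.fract_lt_one _
  set c : ℂ := 2 * Real.pi * I * r with hc
  set w : ℂ := exp (c * ω) * gauge b ω with hw
  have hpi := Real.pi_pos
  have hnw : ‖w‖ = Real.exp (-(Real.pi * Real.sqrt 3 * r)) := by
    rw [hw, norm_mul, norm_gauge, mul_one, norm_exp]
    congr 1
    simp [hc, omega_im, omega_re]
    ring
  have h3 : 0 < Real.pi * Real.sqrt 3 := by positivity
  have hw0 : ‖nome‖ < ‖w‖ := by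
    rw [norm_nome, hnw, Real.exp_lt_exp]
    nlinarith
  have hw1 : ‖w‖ < 1 := by
    rw [hnw, Real.exp_lt_one_iff]
    nlinarith
  have hwne : w ≠ 0 := norm_pos_iff.1 (norm_nome_pos.trans hw0)
  have hone : gauge b 1 * exp c = 1 := by
    rw [gauge, ← exp_add, exp_eq_one_iff]
    refine ⟨-⌊b.re / (2 * Real.pi)⌋, ?_⟩
    have e1 : r = b.re / (2 * Real.pi) - ⌊b.re / (2 * Real.pi)⌋ := rfl
    have e2 : 2 * Real.pi * r = b.re - 2 * Real.pi * ⌊b.re / (2 * Real.pi)⌋ := by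
      rw [e1]; field_simp
    have e3 : (2 * Real.pi * r : ℂ) = b.re - 2 * Real.pi * ⌊b.re / (2 * Real.pi)⌋ := by
      exact_mod_cast e2
    have e4 : pair (-b) 1 = -b.re := by simp [pair_eq]
    rw [e4, hc]
    push_cast
    linear_combination I * e3
  refine ⟨-(2 * Real.pi * I)⁻¹, fun z => exp (c * z) * kron w Set.univ z,
    neg_ne_zero.2 (inv_ne_zero two_pi_I_ne_zero), fun z hz => ?_, ?_,
    periodic_of_one_of_omega (F := fun z => gauge b z * (exp (c * z) * kron w Set.univ z))
      (fun z => ?_) (fun z => ?_)⟩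
  · have h1 : DifferentiableAt ℂ (fun z => exp (c * z)) z := by fun_prop
    exact h1.mul (kron_aux hw0 hw1 fun n _ => nome_zpow_mul_exp_ne_one hz n).1
  · have h1 : Tendsto (fun z : ℂ => exp (c * z)) (𝓝[≠] 0) (𝓝 1) :=
      (Continuous.tendsto' (by fun_prop) 0 1 (by simp)).mono_left nhdsWithin_le_nhds
    have h2 := h1.mul (tendsto_mul_kron hw0 hw1)
    rw [one_mul] at h2
    exact h2.congr fun z => by ring
  · simp only [kron_add_one, gauge_add, mul_add, exp_add, mul_one]
    linear_combination (gauge b z * exp (c * z) * kron w Set.univ z) * hone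
  · simp only [kron_add_omega hwne, gauge_add, mul_add, exp_add]
    have h5 : exp (c * ω) * gauge b ω * w⁻¹ = 1 := mul_inv_cancel₀ hwne
    linear_combination (gauge b z * exp (c * z) * kron w Set.univ z) * h5

lemma omega_mul_mem_Λ {z : ℂ} (hz : z ∈ Λ) : ω * z ∈ Λ := by
  obtain ⟨m, n, rfl⟩ := hz
  refine ⟨n - m, -m, ?_⟩
  push_cast
  linear_combination (m : ℂ) * omega_sq

lemma mem_Λ_of_omega_mul {z : ℂ} (hz : ω * z ∈ Λ) : z ∈ Λ := by
  have := omega_mul_mem_Λ (omega_mul_mem_Λ hz)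
  rwa [← mul_assoc, ← mul_assoc, ← pow_three', omega_cube, one_mul] at this

lemma tendsto_omega_mul : Tendsto (fun z => ω * z) (𝓝[≠] 0) (𝓝[≠] 0) := by
  refine tendsto_nhdsWithin_iff.2 ⟨(Continuous.tendsto' (by fun_prop) 0 0
    (by simp)).mono_left nhdsWithin_le_nhds, ?_⟩
  filter_upwards [self_mem_nhdsWithin] with z hz
  exact mul_ne_zero omega_ne_zero hz

lemma IsMultiplier.rotate {b ρ : ℂ} {g : ℂ → ℂ} (h : IsMultiplier (b * ω) ρ g) :
    IsMultiplier b (ω⁻¹ * ρ) fun z => g (ω * z) where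
  diff z hz := by
    have h1 := h.diff (ω * z) fun hz' => hz (mem_Λ_of_omega_mul hz')
    exact h1.comp z (by fun_prop)
  res := by
    refine ((h.res.comp tendsto_omega_mul).const_mul ω⁻¹).congr fun z => ?_
    have := omega_ne_zero
    simp only [Function.comp_apply]
    field_simp
  per γ hγ z := by
    have := h.per (ω * γ) (omega_mul_mem_Λ hγ) (ω * z)
    rwa [← mul_add, gauge_mul_omega, gauge_mul_omega] at this

lemma mem_Λdual_of_re {b : ℂ} {A B : ℤ} (hA : b.re = 2 * Real.pi * A)
    (hB : (b * ω).re = 2 * Real.pi * B) : b ∈ Λdual := by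
  refine ⟨-A, -B - A, ?_⟩
  have h0 : Real.sqrt 3 ≠ 0 := by positivity
  have h3 : (Real.sqrt 3) ^ 2 = 3 := Real.sq_sqrt (by norm_num)
  rw [mul_re, omega_re, omega_im, hA] at hB
  have him : b.im = -(4 * Real.pi * (B + A / 2)) / Real.sqrt 3 := by
    rw [eq_div_iff h0]; linarith
  have e : (4 * Real.pi * I / Real.sqrt 3 * ((-A : ℤ) * ω + (-B - A : ℤ)) : ℂ) =
      ((4 * Real.pi / Real.sqrt 3 : ℝ) : ℂ) * (I * ((-A : ℤ) * ω + (-B - A : ℤ))) := by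
    push_cast; ring
  rw [e]
  apply Complex.ext
  · rw [re_ofReal_mul, hA]
    simp [omega_re, omega_im]
    field_simp
    ring
  · rw [im_ofReal_mul, him]
    simp [omega_re, omega_im]
    field_simp
    ring

theorem exists_isMultiplier {b : ℂ} (hb : b ∉ Λdual) : ∃ ρ g, ρ ≠ 0 ∧ IsMultiplier b ρ g := by
  by_cases h1 : Int.fract (b.re / (2 * Real.pi)) = 0
  · by_cases h2 : Int.fract ((b * ω).re / (2 * Real.pi)) = 0
    · refine absurd (mem_Λdual_of_re (A := ⌊b.re / (2 * Real.pi)⌋)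
        (B := ⌊(b * ω).re / (2 * Real.pi)⌋) ?_ ?_) hb
      · have := Int.self_sub_floor (b.re / (2 * Real.pi))
        rw [h1, sub_eq_zero, div_eq_iff (by positivity)] at this
        linarith
      · have := Int.self_sub_floor ((b * ω).re / (2 * Real.pi))
        rw [h2, sub_eq_zero, div_eq_iff (by positivity)] at this
        linarith
    · obtain ⟨ρ, g, hρ, hg⟩ := exists_isMultiplier_of_re h2
      exact ⟨_, _, mul_ne_zero (inv_ne_zero omega_ne_zero) hρ, hg.rotate⟩
  · exact exists_isMultiplier_of_re h1

lemma gauge_eq_one_of_mem_Λdual {k : ℂ} (hk : k ∈ Λdual) {γ : ℂ} (hγ : γ ∈ Λ) :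
    gauge k γ = 1 := by
  obtain ⟨d, hd, hkd⟩ := exists_lpt_of_mem_Λdual hk
  have h1 : gauge (k + K) γ = gauge (K * lpt (0, 1)) γ := by
    have e1 : ∀ x : ℤ × ℤ, gauge (K * lpt x) γ = (chi x γ)⁻¹ := fun x => by
      rw [gauge, chi, ← exp_neg, pair_eq, pair_eq]
      congr 1
      push_cast [neg_re, neg_im]
      ring
    rw [hkd, e1, e1, chi_lattice_of_cls_one hd hγ,
      chi_lattice_of_cls_one (x := (0, 1)) (by decide) hγ]
  have h2 : K * lpt (0, 1) = K := by simp [lpt]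
  rw [h2, gauge_add_left] at h1
  exact mul_right_cancel₀ (gauge_ne_zero K γ) (h1.trans (one_mul _).symm)

lemma isMultiplier_one {k : ℂ} (hk : k ∈ Λdual) : IsMultiplier k 0 fun _ => 1 where
  diff _ _ := differentiableAt_const 1
  res := (Continuous.tendsto' (by fun_prop) 0 0 (by simp)).mono_left nhdsWithin_le_nhds
  per γ hγ z := by rw [gauge_add, gauge_eq_one_of_mem_Λdual hk hγ, mul_one]

end Multipliers

section MultiplierAction

open Filter Topology

lemma hasDerivAt_of_Dbar_eq_zero {f : ℂ → ℂ} {z : ℂ} (hf : DifferentiableAt ℝ f z)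
    (h : Dbar f z = 0) : HasDerivAt f (fderiv ℝ f z 1) z := by
  rw [Dbar_of_hasFDerivAt hf.hasFDerivAt] at h
  have hI : fderiv ℝ f z I = I • fderiv ℝ f z 1 := by
    rw [smul_eq_mul]; linear_combination h
  exact ((differentiableAt_complex_iff_differentiableAt_real.2 ⟨hf, hI⟩).hasFDerivAt.restrictScalars
    ℝ).fderiv ▸ (differentiableAt_complex_iff_differentiableAt_real.2 ⟨hf, hI⟩).hasDerivAt

lemma zero_mem_Λ : (0 : ℂ) ∈ Λ := ⟨0, 0, by simp⟩

lemma add_mem_Λ {z w : ℂ} (hz : z ∈ Λ) (hw : w ∈ Λ) : z + w ∈ Λ := by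
  obtain ⟨m, n, rfl⟩ := hz
  obtain ⟨m', n', rfl⟩ := hw
  exact ⟨m + m', n + n', by push_cast; ring⟩

lemma neg_mem_Λ {z : ℂ} (hz : z ∈ Λ) : -z ∈ Λ := by
  obtain ⟨m, n, rfl⟩ := hz
  exact ⟨-m, -n, by push_cast; ring⟩

lemma add_mem_Λ_iff {z γ : ℂ} (hγ : γ ∈ Λ) : z + γ ∈ Λ ↔ z ∈ Λ :=
  ⟨fun h => by simpa using add_mem_Λ h (neg_mem_Λ hγ), fun h => add_mem_Λ h hγ⟩

open Classical in
/-- The continuous extension of a multiplier times a function vanishing at the lattice points. -/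
def mulExt (x : ℤ × ℤ) (s ρ : ℂ) (g f : ℂ → ℂ) (z : ℂ) : ℂ :=
  if z ∈ Λ then chi x z * (ρ * fderiv ℝ f 0 1) else gauge s z * g z * f z

variable {x : ℤ × ℤ} {s ρ : ℂ} {g f : ℂ → ℂ}

lemma mulExt_of_notMem {z : ℂ} (hz : z ∉ Λ) : mulExt x s ρ g f z = gauge s z * g z * f z :=
  if_neg hz

lemma mulExt_zero : mulExt x s ρ g f 0 = ρ * fderiv ℝ f 0 1 := by
  rw [mulExt, if_pos zero_mem_Λ, chi_zero_right, one_mul]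

lemma mulExt_eventuallyEq {z : ℂ} (hz : z ∉ Λ) :
    mulExt x s ρ g f =ᶠ[𝓝 z] fun z => gauge s z * g z * f z := by
  filter_upwards [isOpen_compl_Λ.mem_nhds hz] with w hw using mulExt_of_notMem hw

lemma mulExt_add (hg : IsMultiplier s ρ g) (hf : ∀ γ ∈ Λ, ∀ z, f (z + γ) = chi x γ * f z)
    {γ : ℂ} (hγ : γ ∈ Λ) (z : ℂ) : mulExt x s ρ g f (z + γ) = chi x γ * mulExt x s ρ g f z := by
  by_cases hz : z ∈ Λ
  · rw [mulExt, mulExt, if_pos hz, if_pos (add_mem_Λ hz hγ), chi_add_right]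
    ring
  · rw [mulExt_of_notMem hz, mulExt_of_notMem fun h => hz ((add_mem_Λ_iff hγ).1 h), hg.per γ hγ,
      hf γ hγ]
    ring

lemma continuousAt_mulExt_zero (hg : IsMultiplier s ρ g) (hf : DifferentiableAt ℝ f 0)
    (h0 : f 0 = 0) (hd : Dbar f 0 = 0) : ContinuousAt (mulExt x s ρ g f) 0 := by
  rw [continuousAt_iff_punctured_nhds, mulExt_zero]
  have h1 := (hasDerivAt_of_Dbar_eq_zero hf hd).tendsto_slope
  have h2 : Tendsto (gauge s) (𝓝[≠] 0) (𝓝 1) :=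
    ((continuous_gauge s).tendsto' 0 1 (gauge_zero s)).mono_left nhdsWithin_le_nhds
  have h3 := (h2.mul hg.res).mul h1
  rw [one_mul] at h3
  refine h3.congr' ?_
  have hball : ∀ᶠ z in 𝓝[≠] (0 : ℂ), ‖z‖ < 1 :=
    eventually_nhdsWithin_of_eventually_nhds
      ((continuous_norm.tendsto' (0 : ℂ) 0 norm_zero).eventually_lt_const one_pos)
  filter_upwards [hball, self_mem_nhdsWithin] with z hz hz0
  have hz0' : z ≠ 0 := hz0
  rw [mulExt_of_notMem fun h => hz0' (eq_zero_of_mem_Λ_of_norm_lt_one h hz), slope_def_field, h0,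
    sub_zero, sub_zero]
  field_simp

lemma continuous_mulExt (hg : IsMultiplier s ρ g) (hf : ContDiff ℝ (⊤ : ℕ∞) f)
    (h0 : f 0 = 0) (hd : Dbar f 0 = 0) (hper : ∀ γ ∈ Λ, ∀ z, f (z + γ) = chi x γ * f z) :
    Continuous (mulExt x s ρ g f) := by
  refine continuous_iff_continuousAt.2 fun z => ?_
  by_cases hz : z ∈ Λ
  · have h1 : mulExt x s ρ g f = fun w => chi x z * mulExt x s ρ g f (w - z) := funext fun w => by
      rw [← mulExt_add hg hper hz, sub_add_cancel]
    rw [h1]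
    have h2 : ContinuousAt (mulExt x s ρ g f) (z - z) := by
      rw [sub_self]
      exact continuousAt_mulExt_zero hg (hf.differentiable (by simp) 0) h0 hd
    have h3 : ContinuousAt (fun w => mulExt x s ρ g f (w - z)) z :=
      ContinuousAt.comp (f := fun w => w - z) h2 (by fun_prop)
    exact continuousAt_const.mul h3
  · exact (((continuous_gauge s).continuousAt.mul (hg.diff z hz).continuousAt).mul
      hf.continuous.continuousAt).congr (mulExt_eventuallyEq hz).symm

lemma differentiableAt_mulExt (hg : IsMultiplier s ρ g) (hf : ContDiff ℝ (⊤ : ℕ∞) f) {z : ℂ}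
    (hz : z ∉ Λ) : DifferentiableAt ℝ (mulExt x s ρ g f) z :=
  ((((contDiff_gauge s (n := 1)).differentiable one_ne_zero z).mul
    ((hg.diff z hz).restrictScalars ℝ)).mul
    (hf.differentiable (by simp) z)).congr_of_eventuallyEq (mulExt_eventuallyEq hz)

lemma Dbar_mulExt (hg : IsMultiplier s ρ g) (hf : ContDiff ℝ (⊤ : ℕ∞) f) {z : ℂ} (hz : z ∉ Λ) :
    Dbar (mulExt x s ρ g f) z = gauge s z * g z * (Dbar f z - s * f z) := by
  have h1 : DifferentiableAt ℝ (gauge s) z :=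
    (contDiff_gauge s (n := 1)).differentiable one_ne_zero z
  have h2 : DifferentiableAt ℝ g z := (hg.diff z hz).restrictScalars ℝ
  rw [Dbar_congr (mulExt_eventuallyEq hz), Dbar_mul (f := fun z => gauge s z * g z) (h1.mul h2)
    (hf.differentiable (by simp) z), Dbar_mul h1 h2, Dbar_gauge,
    Dbar_eq_zero_of_differentiableAt (hg.diff z hz)]
  ring

variable {b : ℤ × ℤ →₀ ℂ} {α k : ℂ} {u : ℂ → ℂ × ℂ}

theorem InKer.exists_multiplier_smul (hb : ∀ d, b d ≠ 0 → cls d = 1)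
    (hu : InKer (trig b) (fun z => trig b (-z)) α k u) (h0 : u 0 = 0) (hg : IsMultiplier s ρ g) :
    ∃ v, InKer (trig b) (fun z => trig b (-z)) α (k + s) v ∧
      (∀ z ∉ Λ, v z = (gauge s z * g z) • u z) ∧
      v 0 = ρ • (fderiv ℝ (fun z => (u z).1) 0 1, fderiv ℝ (fun z => (u z).2) 0 1) := by
  obtain ⟨hs, e1, e2, p1, p2⟩ := hu
  have c1 : cls (0, 1) = 1 := by decide
  have c2 : cls (1, 1) = 2 := by decide
  have p1' : ∀ γ ∈ Λ, ∀ z, (u (z + γ)).1 = chi (1, 1) γ * (u z).1 := fun γ hγ z => by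
    rw [chi_lattice_of_cls_two c2 hγ, p1 γ hγ]
  have p2' : ∀ γ ∈ Λ, ∀ z, (u (z + γ)).2 = chi (0, 1) γ * (u z).2 := fun γ hγ z => by
    rw [chi_lattice_of_cls_one c1 hγ, p2 γ hγ]
  have d1 : Dbar (fun z => (u z).1) 0 = 0 := by simpa [h0] using e1 0
  have d2 : Dbar (fun z => (u z).2) 0 = 0 := by simpa [h0] using e2 0
  have z1 : (u 0).1 = 0 := by rw [h0]; rfl
  have z2 : (u 0).2 = 0 := by rw [h0]; rfl
  have hw : WeakKer b α (k + s) (mulExt (1, 1) s ρ g fun z => (u z).1)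
      (mulExt (0, 1) s ρ g fun z => (u z).2) :=
    { cont₁ := continuous_mulExt hg hs.fst z1 d1 p1'
      cont₂ := continuous_mulExt hg hs.snd z2 d2 p2'
      diff₁ := fun z hz => differentiableAt_mulExt hg hs.fst hz
      diff₂ := fun z hz => differentiableAt_mulExt hg hs.snd hz
      eq₁ := fun z hz => by
        rw [Dbar_mulExt hg hs.fst hz, mulExt_of_notMem hz, mulExt_of_notMem hz]
        linear_combination (gauge s z * g z) * e1 z
      eq₂ := fun z hz => by
        rw [Dbar_mulExt hg hs.snd hz, mulExt_of_notMem hz, mulExt_of_notMem hz]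
        linear_combination (gauge s z * g z) * e2 z
      per₁ := fun γ hγ z => by
        rw [← chi_lattice_of_cls_two c2 hγ]
        exact mulExt_add hg p1' hγ z
      per₂ := fun γ hγ z => by
        rw [← chi_lattice_of_cls_one c1 hγ]
        exact mulExt_add hg p2' hγ z }
  refine ⟨_, hw.inKer hb, fun z hz => ?_, ?_⟩
  · simp only [mulExt_of_notMem hz]
    rfl
  · simp only [mulExt_zero]
    rfl

lemma eq_zero_of_omega_mul {f : ℂ → ℂ} (h : ∀ z, f (ω * z) = ω⁻¹ * f z) : f 0 = 0 := by
  have h1 := h 0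
  rw [mul_zero] at h1
  have h2 : (ω - 1) * f 0 = 0 := by
    rw [sub_mul, one_mul, sub_eq_zero]
    nth_rewrite 1 [h1]
    exact mul_inv_cancel_left₀ omega_ne_zero _
  exact (mul_eq_zero.1 h2).resolve_left (sub_ne_zero.2 omega_ne_one)

lemma fderiv_eq_zero_of_omega_mul {f : ℂ → ℂ} (hf : DifferentiableAt ℝ f 0) (hd : Dbar f 0 = 0)
    (h : ∀ z, f (ω * z) = ω⁻¹ * f z) : fderiv ℝ f 0 1 = 0 := by
  have h1 := hasDerivAt_of_Dbar_eq_zero hf hd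
  set d := fderiv ℝ f 0 1
  have h2 : HasDerivAt (fun z => f (ω * z)) (d * ω) 0 := by
    have h3 : HasDerivAt (fun z => ω * z) (ω * 1) (0 : ℂ) := (hasDerivAt_id _).const_mul ω
    rw [mul_one] at h3
    exact HasDerivAt.comp (h₂ := f) (0 : ℂ) (by rwa [mul_zero]) h3
  rw [funext h] at h2
  have h4 := (h1.const_mul ω⁻¹).unique h2
  have h5 : d = ω ^ 2 * d := by
    rw [inv_mul_eq_iff_eq_mul₀ omega_ne_zero] at h4
    linear_combination h4
  have h6 : (ω - 1) * d = 0 := by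
    linear_combination ω * h5 + d * omega_cube
  exact (mul_eq_zero.1 h6).resolve_left (sub_ne_zero.2 omega_ne_one)

lemma countable_Λ : Λ.Countable := by
  refine (Set.countable_range fun p : ℤ × ℤ => (p.1 * ω + p.2 : ℂ)).mono ?_
  rintro _ ⟨m, n, rfl⟩
  exact ⟨(m, n), rfl⟩

lemma countable_Λdual : Λdual.Countable := by
  refine (Set.countable_range fun p : ℤ × ℤ =>
    (4 * Real.pi * I / Real.sqrt 3 * (p.1 * ω + p.2) : ℂ)).mono ?_
  rintro _ ⟨m, n, rfl⟩
  exact ⟨(m, n), rfl⟩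

lemma exists_notMem_Λdual (k : ℂ) : ∃ a, a ∉ Λdual ∧ k - a ∉ Λdual := by
  obtain ⟨a, ha⟩ := ((countable_Λdual.union (countable_Λdual.image fun a => k - a)).dense_compl
    ℝ).nonempty
  refine ⟨a, fun h => ha (Or.inl h), fun h => ha (Or.inr ⟨_, h, by simp⟩)⟩

lemma eventually_notMem_Λ : ∀ᶠ z in 𝓝[≠] (0 : ℂ), z ∉ Λ := by
  have hball : ∀ᶠ z in 𝓝[≠] (0 : ℂ), ‖z‖ < 1 :=
    eventually_nhdsWithin_of_eventually_nhds
      ((continuous_norm.tendsto' (0 : ℂ) 0 norm_zero).eventually_lt_const one_pos)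
  filter_upwards [hball, self_mem_nhdsWithin] with z hz hz0 h
  exact hz0 (eq_zero_of_mem_Λ_of_norm_lt_one h hz)

lemma exists_isMultiplier_ne_zero (k : ℂ) :
    ∃ ρ g, IsMultiplier k ρ g ∧ ∃ z ∉ Λ, g z ≠ 0 := by
  by_cases hk : k ∈ Λdual
  · exact ⟨0, _, isMultiplier_one hk, _, eventually_notMem_Λ.exists.choose_spec, one_ne_zero⟩
  · obtain ⟨ρ, g, hρ, hg⟩ := exists_isMultiplier hk
    obtain ⟨z, hz, hz'⟩ := ((hg.res.eventually_ne hρ).and eventually_notMem_Λ).exists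
    exact ⟨ρ, g, hg, z, hz', right_ne_zero_of_mul hz⟩

lemma eqOn_zero_of_mul_eq_zero {H f : ℂ → ℂ} (hH : ∀ z ∉ Λ, DifferentiableAt ℂ H z)
    (hf : Continuous f) {z₁ : ℂ} (hz₁ : f z₁ ≠ 0) (h : ∀ z ∉ Λ, H z * f z = 0) :
    ∀ z ∉ Λ, H z = 0 := by
  obtain ⟨z₀, hz₀, hfz₀⟩ := (countable_Λ.dense_compl ℝ).exists_mem_open
    (hf.isOpen_preimage _ isOpen_compl_singleton) ⟨z₁, hz₁⟩
  have hc : IsPreconnected Λᶜ := (countable_Λ.isPathConnected_compl_of_one_lt_rank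
    (by rw [Complex.rank_real_complex]; exact Cardinal.one_lt_two)).isConnected.isPreconnected
  have han : AnalyticOnNhd ℂ H Λᶜ :=
    DifferentiableOn.analyticOnNhd (fun z hz => (hH z hz).differentiableWithinAt) isOpen_compl_Λ
  have hev : H =ᶠ[𝓝 z₀] 0 := by
    filter_upwards [isOpen_compl_Λ.mem_nhds hz₀,
      (hf.isOpen_preimage _ isOpen_compl_singleton).mem_nhds hfz₀] with z hz hfz
    exact (mul_eq_zero.1 (h z hz)).resolve_right hfz
  exact fun z hz => han.eqOn_zero_of_preconnected_of_eventuallyEq_zero hc hz₀ hev hz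

theorem exists_independent_of_omega_mul (hb : ∀ d, b d ≠ 0 → cls d = 1)
    (hu : InKer (trig b) (fun z => trig b (-z)) α 0 u) (hu0 : u ≠ 0)
    (hrot : ∀ z, u (ω * z) = ω⁻¹ • u z) (k : ℂ) :
    ∃ v w, InKer (trig b) (fun z => trig b (-z)) α k v ∧
      InKer (trig b) (fun z => trig b (-z)) α k w ∧
      ∀ r s : ℂ, r • v + s • w = 0 → r = 0 ∧ s = 0 := by
  have r1 : ∀ z, (u (ω * z)).1 = ω⁻¹ * (u z).1 := fun z => by rw [hrot]; rfl
  have r2 : ∀ z, (u (ω * z)).2 = ω⁻¹ * (u z).2 := fun z => by rw [hrot]; rfl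
  have z1 : (u 0).1 = 0 := eq_zero_of_omega_mul (f := fun z => (u z).1) r1
  have z2 : (u 0).2 = 0 := eq_zero_of_omega_mul (f := fun z => (u z).2) r2
  have h0 : u 0 = 0 := Prod.ext z1 z2
  have d1 : fderiv ℝ (fun z => (u z).1) 0 1 = 0 :=
    fderiv_eq_zero_of_omega_mul (hu.1.fst.differentiable (by simp) 0)
      (by simpa [h0] using hu.2.1 0) r1
  have d2 : fderiv ℝ (fun z => (u z).2) 0 1 = 0 :=
    fderiv_eq_zero_of_omega_mul (hu.1.snd.differentiable (by simp) 0)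
      (by simpa [h0] using hu.2.2.1 0) r2
  obtain ⟨ρ, g, hg, z₂, hz₂, hgz₂⟩ := exists_isMultiplier_ne_zero k
  obtain ⟨a, ha, hka⟩ := exists_notMem_Λdual k
  obtain ⟨ρ₁, g₁, hρ₁, hg₁⟩ := exists_isMultiplier ha
  obtain ⟨ρ₂, g₂, hρ₂, hg₂⟩ := exists_isMultiplier hka
  obtain ⟨v, hv, hvu, -⟩ := hu.exists_multiplier_smul hb h0 hg
  obtain ⟨v', hv', hvu', hv0⟩ := hu.exists_multiplier_smul hb h0 hg₁
  rw [d1, d2] at hv0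
  obtain ⟨w, hw, hwu, -⟩ := hv'.exists_multiplier_smul hb (hv0.trans (by simp)) hg₂
  rw [zero_add] at hv
  rw [zero_add, add_sub_cancel] at hw
  refine ⟨v, w, hv, hw, fun r s hrs => ?_⟩
  have hH : ∀ z ∉ Λ, r * g z + s * (g₁ z * g₂ z) = 0 := by
    have hprod : ∀ z ∉ Λ, (r * g z + s * (g₁ z * g₂ z)) • u z = 0 := fun z hz => by
      have h1 := congrFun hrs z
      have h2 : gauge k z = gauge a z * gauge (k - a) z := by
        rw [← gauge_add_left, add_sub_cancel]
      simp only [Pi.add_apply, Pi.smul_apply, Pi.zero_apply, hvu z hz, hwu z hz, hvu' z hz,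
        smul_smul, ← add_smul, h2] at h1
      refine (smul_eq_zero.1 h1).elim (fun h => ?_) fun h => by rw [h, smul_zero]
      have h3 : (gauge a z * gauge (k - a) z) * (r * g z + s * (g₁ z * g₂ z)) = 0 := by
        linear_combination h
      rw [(mul_eq_zero.1 h3).resolve_left
        (mul_ne_zero (gauge_ne_zero _ _) (gauge_ne_zero _ _)), zero_smul]
    have hdiff : ∀ z ∉ Λ, DifferentiableAt ℂ (fun z => r * g z + s * (g₁ z * g₂ z)) z :=
      fun z hz => ((hg.diff z hz).const_mul r).add
        (((hg₁.diff z hz).mul (hg₂.diff z hz)).const_mul s)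
    obtain ⟨z₁, hz₁⟩ := Function.ne_iff.1 hu0
    by_cases hc : (u z₁).1 = 0
    · refine eqOn_zero_of_mul_eq_zero hdiff hu.1.snd.continuous (z₁ := z₁)
        (fun h => hz₁ (Prod.ext hc h)) fun z hz => congrArg Prod.snd (hprod z hz)
    · exact eqOn_zero_of_mul_eq_zero hdiff hu.1.fst.continuous hc
        fun z hz => congrArg Prod.fst (hprod z hz)
  have hs : s = 0 := by
    have hid : Tendsto (fun z : ℂ => z) (𝓝[≠] 0) (𝓝 0) := nhdsWithin_le_nhds
    have h1 := ((hid.mul hg.res).const_mul r).add ((hg₁.res.mul hg₂.res).const_mul s)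
    have h2 : Tendsto (fun _ : ℂ => (0 : ℂ)) (𝓝[≠] 0) (𝓝 (s * (ρ₁ * ρ₂))) := by
      rw [zero_mul, mul_zero, zero_add] at h1
      refine h1.congr' ?_
      filter_upwards [eventually_notMem_Λ] with z hz
      linear_combination z ^ 2 * hH z hz
    have h3 := tendsto_nhds_unique h2 tendsto_const_nhds
    exact (mul_eq_zero.1 h3).resolve_right (mul_ne_zero hρ₁ hρ₂)
  have hr := hH z₂ hz₂
  rw [hs, zero_mul, add_zero] at hr
  exact ⟨(mul_eq_zero.1 hr).resolve_right hgz₂, hs⟩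

theorem isMagic_and_two_le_kerDim (hb : ∀ d, b d ≠ 0 → cls d = 1)
    (hu : InKer (trig b) (fun z => trig b (-z)) α 0 u) (hu0 : u ≠ 0)
    (hrot : ∀ z, u (ω * z) = ω⁻¹ • u z) :
    IsMagic (trig b) (fun z => trig b (-z)) α ∧
      ∀ k, 2 ≤ kerDim (trig b) (fun z => trig b (-z)) α k := by
  refine ⟨fun k => ?_, fun k => ?_⟩ <;>
    obtain ⟨v, w, hv, hw, h⟩ := exists_independent_of_omega_mul hb hu hu0 hrot k
  · refine ⟨v, hv, fun hv0 => ?_⟩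
    exact one_ne_zero (h 1 0 (by rw [hv0, smul_zero, zero_smul, add_zero])).1
  · exact two_le_kerDim hb hv hw h

end MultiplierAction

section Assembly

variable {b : ℤ × ℤ →₀ ℂ} {α : ℂ} {c : ℤ × ℤ → ℂ}

lemma FourierKer.eq_smul_op (h : FourierKer b α 0 c) : c = -α • op (hop b) (wt 0) c := by
  ext x
  rw [Pi.smul_apply, op_apply, wt, smul_eq_mul]
  split_ifs with hx
  · rw [h.zero x hx, zero_mul, mul_zero]
  · have h1 := h.eqn x hx
    have h2 : convol (hop b) c x = ∑ d ∈ (hop b).support, hop b d * c (x - d) := rfl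
    rw [← h2]
    have h3 := lpt_ne_zero_of_cls hx
    rw [add_zero] at h1 ⊢
    field_simp
    linear_combination h1

lemma fourierKer_of_eq_smul_op (h : c = α • op (hop b) (wt 0) c) : FourierKer b (-α) 0 c := by
  have hx : ∀ x, c x = α * (wt 0 x * convol (hop b) c x) := fun x => by
    conv_lhs => rw [h]
    rw [Pi.smul_apply, op_apply, smul_eq_mul]
    rfl
  refine ⟨fun x h0 => ?_, fun x h0 => ?_⟩
  · rw [hx, wt, if_pos h0, zero_mul, mul_zero]
  · have h3 := lpt_ne_zero_of_cls h0
    rw [hx x, wt, if_neg h0, add_zero]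
    field_simp
    ring

lemma synthPair_omega_mul (h : ∀ x, c (rot x) = ω⁻¹ * c x) (z : ℂ) :
    synthPair c (ω * z) = ω⁻¹ • synthPair c z := by
  have hj : ∀ j, synth (restr j c) (ω * z) = ω⁻¹ * synth (restr j c) z := fun j => by
    rw [synth_omega_mul, synth, synth, ← tsum_mul_left]
    refine tsum_congr fun x => ?_
    rw [restr, restr, cls_rot, h]
    split_ifs <;> ring
  rw [synthPair, synthPair, hj, hj]
  rfl

end Assembly

/-- **races to infinity (first part).**
For a potential with finitely many Fourier modes and coefficients in `π·ℚ(ω/√3)`,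
if there is one magic parameter then the set of non-simple magic parameters is infinite. -/
theorem races_to_infinity (S : Finset ℂ) (hS : ↑S ⊆ Λdual) (a : ℂ → ℂ)
    (ha : ∀ p ∈ S, InPiQomega (a p)) (U : ℂ → ℂ)
    (hUdef : ∀ z : ℂ, U z = ∑ p ∈ S, a p * Complex.exp (Complex.I * (pair (p + K) z : ℂ)))
    (hrot : ∀ z : ℂ, U (ω * z) = ω * U z)
    (hmagic : ∃ α : ℂ, IsMagic U (fun z => U (-z)) α) :
    {α : ℂ | IsMagic U (fun z => U (-z)) α ∧
      ∀ k : ℂ, 2 ≤ kerDim U (fun z => U (-z)) α k}.Infinite := by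
  obtain ⟨b, rfl, hb, hhop, hhalg⟩ := exists_trig_coefficients hS ha hUdef hrot
  obtain ⟨α₀, hα₀⟩ := hmagic
  obtain ⟨u, hu, hu0⟩ := hα₀ (K * 0)
  have hw := InKer.weakKer hu
  have hF := hw.fourierKer hb
  obtain ⟨C, hC⟩ := hw.exists_bound
  have hc0 : pairCoef (fun z => (u z).1) (fun z => (u z).2) ≠ 0 := fun h => by
    obtain ⟨e1, e2⟩ := pairCoef_eq_zero_imp hw (congrFun h)
    exact hu0 (funext fun z => Prod.ext (congrFun e1 z) (congrFun e2 z))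
  refine ((infinite_equivariant_eigenvalues hhop hhalg hc0 hC hF.eq_smul_op).image
    neg_injective.injOn).mono ?_
  rintro _ ⟨β, ⟨c, ⟨⟨C', hC'⟩, hcr⟩, hc, hce⟩, rfl⟩
  have hk := fourierKer_of_eq_smul_op hce
  have hd := hk.rapidDecay hC'
  have hin := hk.inKer hb hd
  rw [mul_zero] at hin
  refine isMagic_and_two_le_kerDim hb hin (fun h => hc (funext fun x => ?_))
    (synthPair_omega_mul hcr)
  rw [← pairCoef_synthPair hd hk.zero x, h]
  simp [pairCoef, coef]

end TBG
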